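/- Let p be a prime and n ≥ 1. For a pair X = (A, B) of n×n matrices over ℚ_p, let ι(X) denote the 2n×2n block matrix with blocks [[0, A], [B, 0]], and let 𝔇(X) ∈ ℚ_p be the coefficient of T^{2n} in the characteristic polynomial of the ℚ_p-linear endomorphism ad(ι(X)) : M_{2n}(ℚ_p) → M_{2n}(ℚ_p), M ↦ ι(X)·M − M·ι(X). Then there exists ε > 0 such that the function X ↦ ‖𝔇(X)‖_p^{−1/4 − ε} (interpreted as 0 when 𝔇(X) = 0) is locally integrable on M_n(ℚ_p) × M_n(ℚ_p) with respect to any additive Haar measure. -/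

import Mathlib

open MeasureTheory

/-- The Weyl discriminant polynomial `𝔇(X)`: the coefficient of `T^(2n)` in the
characteristic polynomial of the adjoint endomorphism `M ↦ ι(X)·M − M·ι(X)` of
`M_{2n}(ℚ_p)`, where `ι(A, B)` is the block matrix `[[0, A], [B, 0]]`. -/
noncomputable def weylDiscriminantGuoJacquet (p : ℕ) [Fact p.Prime] (n : ℕ)
    (X : Matrix (Fin n) (Fin n) ℚ_[p] × Matrix (Fin n) (Fin n) ℚ_[p]) : ℚ_[p] :=
  (LinearMap.charpoly
    (LinearMap.mulLeft ℚ_[p] (Matrix.fromBlocks 0 X.1 X.2 0) -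
      LinearMap.mulRight ℚ_[p] (Matrix.fromBlocks 0 X.1 X.2 0))).coeff (2 * n)

namespace PadicWeyl
open scoped ENNReal
noncomputable section
variable {p : ℕ} [hp : Fact p.Prime]

section HaarMeasure

/-- The Borel σ-algebra on `ℚ_[p]`. -/
scoped instance padicMeasurableSpace : MeasurableSpace ℚ_[p] := borel _

scoped instance padicBorelSpace : BorelSpace ℚ_[p] := ⟨rfl⟩

/-- The ring of integers as a compact set with nonempty interior. -/
def padicUnitBall (p : ℕ) [Fact p.Prime] : TopologicalSpace.PositiveCompacts ℚ_[p] where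
  carrier := Metric.closedBall 0 1
  isCompact' := isCompact_closedBall 0 1
  interior_nonempty' := ⟨0, Metric.ball_subset_interior_closedBall (by simp)⟩

/-- The Haar measure on `ℚ_[p]` giving the ring of integers volume one. -/
scoped instance padicMeasureSpace : MeasureSpace ℚ_[p] where
  volume := Measure.addHaarMeasure (padicUnitBall p)

scoped instance : (volume : Measure ℚ_[p]).IsAddHaarMeasure :=
  inferInstanceAs (Measure.addHaarMeasure (padicUnitBall p)).IsAddHaarMeasure

theorem volume_unitBall : volume (Metric.closedBall (0 : ℚ_[p]) 1) = 1 :=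
  Measure.addHaarMeasure_self (K₀ := padicUnitBall p)

theorem volume_unitBall_pi {ι : Type*} [Fintype ι] :
    volume (Metric.closedBall (0 : ι → ℚ_[p]) 1) = 1 := by
  have : Metric.closedBall (0 : ι → ℚ_[p]) 1 = Set.pi Set.univ fun _ => Metric.closedBall 0 1 := by
    rw [closedBall_pi _ zero_le_one]; rfl
  rw [this, volume_pi_pi]
  simp [volume_unitBall]

/-- The unit ball is a disjoint union of `p` translates of its multiple by `p`. -/
theorem volume_image_p_mul :
    (p : ℝ≥0∞) * volume ((fun x : ℚ_[p] => (p : ℚ_[p]) * x) '' Metric.closedBall 0 1) = 1 := by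
  have hp0 : (p : ℚ_[p]) ≠ 0 := by exact_mod_cast hp.out.ne_zero
  have himg : ((fun x : ℚ_[p] => (p : ℚ_[p]) * x) '' Metric.closedBall 0 1)
      = {y | ‖y‖ ≤ ‖(p : ℚ_[p])‖} := by
    ext y
    simp only [Set.mem_image, mem_closedBall_zero_iff, Set.mem_ofPred_eq]
    constructor
    · rintro ⟨x, hx, rfl⟩
      rw [norm_mul]; exact mul_le_of_le_one_right (norm_nonneg _) hx
    · intro h
      refine ⟨y / p, ?_, by field_simp⟩
      rw [norm_div]; exact div_le_one_of_le₀ h (norm_nonneg _)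
  have hcl : IsClosed {y : ℚ_[p] | ‖y‖ ≤ ‖(p : ℚ_[p])‖} :=
    isClosed_le continuous_norm continuous_const
  rw [himg]
  have hU : Metric.closedBall (0 : ℚ_[p]) 1
      = ⋃ i : Fin p, (fun y => -((i : ℕ) : ℚ_[p]) + y) ⁻¹' {y | ‖y‖ ≤ ‖(p : ℚ_[p])‖} := by
    ext x
    simp only [mem_closedBall_zero_iff, Set.mem_iUnion, Set.mem_preimage, Set.mem_ofPred_eq]
    constructor
    · intro hx
      obtain ⟨k, hk, hx'⟩ := PadicInt.exists_mem_range (⟨x, hx⟩ : ℤ_[p])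
      refine ⟨⟨k, hk⟩, ?_⟩
      have hx' := PadicInt.mem_nonunits.1 hx'
      have := (PadicInt.norm_le_pow_iff_norm_lt_pow_add_one (⟨x, hx⟩ - k : ℤ_[p]) (-1)).2
        (by simpa using hx')
      rw [Padic.norm_p]
      rw [neg_add_eq_sub]
      rw [zpow_neg_one] at this
      exact this
    · rintro ⟨i, hi⟩
      have h1 : ‖((i : ℕ) : ℚ_[p])‖ ≤ 1 := by exact_mod_cast Padic.norm_int_le_one (p := p) i
      have : x = (i : ℕ) + (-((i : ℕ) : ℚ_[p]) + x) := by ring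
      rw [this]
      exact (IsUltrametricDist.norm_add_le_max _ _).trans
        (max_le h1 (hi.trans Padic.norm_p_lt_one.le))
  have hd : Pairwise (Function.onFun Disjoint fun i : Fin p =>
      (fun y => -((i : ℕ) : ℚ_[p]) + y) ⁻¹' {y | ‖y‖ ≤ ‖(p : ℚ_[p])‖}) := by
    intro i j hij
    refine Set.disjoint_left.2 fun x hi hj => hij ?_
    simp only [Set.mem_preimage, Set.mem_ofPred_eq] at hi hj
    have h : ‖(((i : ℕ) : ℤ) - ((j : ℕ) : ℤ) : ℤ)‖ = ‖(((i : ℕ) : ℤ) - ((j : ℕ) : ℤ) : ℤ)‖ := rfl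
    have h2 : ‖((((i : ℕ) : ℤ) - ((j : ℕ) : ℤ) : ℤ) : ℚ_[p])‖ < 1 := by
      have e : ((((i : ℕ) : ℤ) - ((j : ℕ) : ℤ) : ℤ) : ℚ_[p])
          = (-((j : ℕ) : ℚ_[p]) + x) - (-((i : ℕ) : ℚ_[p]) + x) := by push_cast; ring
      rw [e]
      refine lt_of_le_of_lt ?_ (Padic.norm_p_lt_one (p := p))
      rw [sub_eq_add_neg]
      refine (IsUltrametricDist.norm_add_le_max _ _).trans (max_le hj (by rwa [norm_neg]))
    rw [Padic.norm_intCast_lt_one_iff] at h2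
    have := Int.eq_zero_of_abs_lt_dvd h2 (by
      rw [abs_lt]; constructor <;> have := i.2 <;> have := j.2 <;> omega)
    ext; omega
  have := volume_unitBall (p := p)
  rw [hU, measure_iUnion hd (fun i => (hcl.preimage (by fun_prop)).measurableSet)] at this
  simp only [measure_preimage_add] at this
  simpa using this

/-- Multiplication by a nonzero scalar rescales the Haar measure by the norm of the scalar. -/
theorem volume_preimage_mul (a : ℚ_[p]) (ha : a ≠ 0) (s : Set ℚ_[p]) :
    ‖a‖ₑ * volume ((fun x => a * x) ⁻¹' s) = volume s := by
  -- the modulus of multiplication by `a`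
  have key : ∀ a : ℚ_[p], a ≠ 0 → ∃ c : ℝ≥0∞, ∀ s : Set ℚ_[p],
      volume ((fun x => a * x) ⁻¹' s) = c * volume s := by
    intro a ha
    let e : ℚ_[p] ≃L[ℚ_[p]] ℚ_[p] := ContinuousLinearEquiv.unitsEquivAut ℚ_[p] (Units.mk0 a ha)
    have he : ∀ s, (volume.map e) s = volume ((fun x => a * x) ⁻¹' s) := by
      intro s
      refine (e.toHomeomorph.toMeasurableEquiv.map_apply (μ := volume) s).trans ?_
      congr 1
      ext x
      simp [e, mul_comm]
    have : (volume.map e).IsAddHaarMeasure := e.isAddHaarMeasure_map volume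
    refine ⟨((volume.map e).addHaarScalarFactor volume : NNReal), fun s => ?_⟩
    rw [← he]
    exact congrArg (fun μ : Measure ℚ_[p] => μ s)
      (Measure.isAddLeftInvariant_eq_smul (volume.map e) volume)
  choose! c hc using key
  have hball : ∀ a : ℚ_[p], a ≠ 0 →
      c a = volume ((fun x => a * x) ⁻¹' Metric.closedBall 0 1) := fun a ha => by
    rw [hc a ha, volume_unitBall, mul_one]
  have hmul : ∀ a b : ℚ_[p], a ≠ 0 → b ≠ 0 → c (a * b) = c a * c b := by
    intro a b ha hb
    rw [hball _ (mul_ne_zero ha hb), mul_comm (c a), hball a ha, ← hc b hb]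
    congr 1
    ext x
    simp [mul_assoc]
  have hunit : ∀ a : ℚ_[p], ‖a‖ = 1 → c a = 1 := by
    intro a ha
    rw [hball a (norm_ne_zero_iff.1 (by simp [ha])), ← volume_unitBall (p := p)]
    congr 1
    ext x
    simp [ha]
  have hp0 : (p : ℚ_[p]) ≠ 0 := by exact_mod_cast hp.out.ne_zero
  have hpn : ‖(p : ℚ_[p])‖ₑ * c (p : ℚ_[p]) = 1 := by
    have h1 := volume_image_p_mul (p := p)
    have h2 : c (p : ℚ_[p]) * volume ((fun x : ℚ_[p] => (p : ℚ_[p]) * x) ''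
        Metric.closedBall 0 1) = 1 := by
      rw [← hc _ hp0, Set.preimage_image_eq _ (mul_right_injective₀ hp0), volume_unitBall]
    have h3 : (p : ℝ≥0∞) * ‖(p : ℚ_[p])‖ₑ = 1 := by
      rw [enorm_eq_nnnorm, ← ENNReal.coe_natCast, ← ENNReal.coe_mul, ENNReal.coe_eq_one]
      ext
      have : (p : ℝ) ≠ 0 := by exact_mod_cast hp.out.ne_zero
      simp [this]
    calc ‖(p : ℚ_[p])‖ₑ * c (p : ℚ_[p]) = ‖(p : ℚ_[p])‖ₑ * c (p : ℚ_[p]) * 1 := (mul_one _).symm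
      _ = 1 := by rw [← h1, mul_mul_mul_comm, mul_comm _ (p : ℝ≥0∞), h3, h2, h1, one_mul]
  have hc1 : c 1 = 1 := hunit 1 (by simp)
  have hne : ∀ a : ℚ_[p], a ≠ 0 → c a * c a⁻¹ = 1 := fun a ha => by
    rw [← hmul a _ ha (inv_ne_zero ha), mul_inv_cancel₀ ha, hc1]
  have hall : ∀ k : ℕ, ‖(p : ℚ_[p]) ^ k‖ₑ * c ((p : ℚ_[p]) ^ k) = 1 := by
    intro k
    induction k with
    | zero => simp [hc1]
    | succ k ih =>
      rw [pow_succ, hmul _ _ (pow_ne_zero _ hp0) hp0, enorm_mul, mul_mul_mul_comm, ih, hpn, one_mul]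
  have hz : ∀ k : ℤ, ‖(p : ℚ_[p]) ^ k‖ₑ * c ((p : ℚ_[p]) ^ k) = 1 := by
    intro k
    obtain ⟨m, rfl | rfl⟩ := k.eq_nat_or_neg
    · exact_mod_cast hall m
    · have h1 := hall m
      have h2 := hne _ (pow_ne_zero m hp0)
      have h3 : ‖(p : ℚ_[p]) ^ m‖ₑ * ‖((p : ℚ_[p]) ^ m)⁻¹‖ₑ = 1 := by
        rw [← enorm_mul, mul_inv_cancel₀ (pow_ne_zero m hp0), enorm_one]
      rw [zpow_neg, zpow_natCast]
      calc _ = (‖(p : ℚ_[p]) ^ m‖ₑ * c ((p : ℚ_[p]) ^ m)) *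
            (‖((p : ℚ_[p]) ^ m)⁻¹‖ₑ * c ((p : ℚ_[p]) ^ m)⁻¹) := by rw [h1, one_mul]
        _ = 1 := by rw [mul_mul_mul_comm, h3, h2, one_mul]
  have hfin : ‖a‖ₑ * c a = 1 := by
    have h0 : ‖a * (p : ℚ_[p]) ^ (-a.valuation)‖ = 1 := by
      rw [norm_mul, Padic.norm_eq_zpow_neg_valuation ha, norm_zpow, Padic.norm_p, inv_zpow',
        neg_neg, ← zpow_add₀ (by exact_mod_cast hp.out.ne_zero), neg_add_cancel, zpow_zero]
    have h1 : a = (a * (p : ℚ_[p]) ^ (-a.valuation)) * (p : ℚ_[p]) ^ a.valuation := by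
      rw [mul_assoc, ← zpow_add₀ hp0, neg_add_cancel, zpow_zero, mul_one]
    rw [h1, hmul _ _ (norm_ne_zero_iff.1 (by rw [h0]; exact one_ne_zero)) (zpow_ne_zero _ hp0),
      hunit _ h0,
      enorm_mul, ← ofReal_norm, h0]
    simpa using hz _
  rw [hc a ha, ← mul_assoc, hfin, one_mul]

theorem enorm_finsetProd {K ι : Type*} [NormedField K] (s : Finset ι) (f : ι → K) :
    ‖∏ i ∈ s, f i‖ₑ = ∏ i ∈ s, ‖f i‖ₑ := by
  classical
  induction s using Finset.induction_on with
  | empty => simp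
  | insert a s ha ih => rw [Finset.prod_insert ha, Finset.prod_insert ha, enorm_mul, ih]

section Pi

open Matrix
variable {ι κ : Type*} [Fintype ι] [Fintype κ]

theorem measurePreserving_transvection [DecidableEq ι] (t : TransvectionStruct ι ℚ_[p]) :
    MeasurePreserving (toLin' t.toMatrix) := by
  have ht : Measurable (toLin' t.toMatrix) :=
    (LinearMap.continuous_on_pi _).measurable
  refine ⟨ht, (Measure.pi_eq fun s hs => ?_).symm⟩
  have h2s : MeasurableSet (Set.univ.pi s) := .pi Set.countable_univ fun i _ => hs i
  simp_rw [← Measure.pi_pi, ← lintegral_indicator_one h2s]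
  rw [lintegral_map (measurable_one.indicator h2s) ht, volume_pi]
  refine lintegral_eq_of_lmarginal_eq {t.i} ((measurable_one.indicator h2s).comp ht)
    (measurable_one.indicator h2s) ?_
  simp_rw [lmarginal_singleton]
  ext x
  cases t with | mk t_i t_j t_hij t_c =>
  simp [transvection, single_mulVec, t_hij.symm, ← Function.update_add,
    lintegral_add_right_eq_self fun xᵢ => Set.indicator (Set.univ.pi s) 1
      (Function.update x t_i xᵢ)]

theorem smul_map_diagonal [DecidableEq ι] {D : ι → ℚ_[p]} (h : det (diagonal D) ≠ 0) :
    ‖det (diagonal D)‖ₑ • Measure.map (toLin' (diagonal D)) volume = volume := by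
  refine (Measure.pi_eq fun s hs => ?_).symm
  simp only [det_diagonal, Measure.coe_smul, smul_eq_mul, Pi.smul_apply]
  rw [Measure.map_apply _ (MeasurableSet.univ_pi hs)]
  swap; · exact Continuous.measurable (LinearMap.continuous_on_pi _)
  have : (Matrix.toLin' (diagonal D) ⁻¹' Set.pi Set.univ fun i : ι => s i) =
      Set.pi Set.univ fun i : ι => (D i * ·) ⁻¹' s i := by
    ext f
    simp [mulVec_diagonal]
  rw [this, volume_pi_pi, enorm_finsetProd, ← Finset.prod_mul_distrib]
  refine Finset.prod_congr rfl fun i _ => volume_preimage_mul _ ?_ _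
  rw [det_diagonal] at h
  exact Finset.prod_ne_zero_iff.1 h i (Finset.mem_univ i)

theorem smul_map_matrix [DecidableEq ι] {M : Matrix ι ι ℚ_[p]} (hM : det M ≠ 0) :
    ‖det M‖ₑ • Measure.map (toLin' M) volume = volume := by
  apply diagonal_transvection_induction_of_det_ne_zero _ M hM
  · intro D hD
    exact smul_map_diagonal hD
  · intro t
    simp [(measurePreserving_transvection t).map_eq]
  · intro A B _ _ IHA IHB
    rw [toLin'_mul, det_mul, LinearMap.coe_comp, ← Measure.map_map, enorm_mul, mul_smul,
      ← Measure.map_smul, IHB, IHA]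
    · exact (LinearMap.continuous_on_pi _).measurable
    · exact (LinearMap.continuous_on_pi _).measurable

theorem volume_preimage_mulVec [DecidableEq ι] (M : Matrix ι ι ℚ_[p]) (hM : det M ≠ 0)
    {s : Set (ι → ℚ_[p])} (hs : MeasurableSet s) :
    ‖det M‖ₑ * volume ((fun x => M *ᵥ x) ⁻¹' s) = volume s := by
  conv_rhs => rw [← smul_map_matrix hM]
  rw [Measure.smul_apply, Measure.map_apply _ hs]
  · rfl
  · exact (LinearMap.continuous_on_pi _).measurable

theorem volume_preimage_rows [DecidableEq ι] (M : Matrix ι ι ℚ_[p]) (hM : det M ≠ 0)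
    {s : κ → Set (ι → ℚ_[p])} (hs : ∀ k, MeasurableSet (s k)) :
    ‖det M‖ₑ ^ Fintype.card κ * volume ((fun (X : κ → ι → ℚ_[p]) k => M *ᵥ X k) ⁻¹' 
      Set.univ.pi s) = volume (Set.univ.pi s) := by
  have : ((fun (X : κ → ι → ℚ_[p]) k => M *ᵥ X k) ⁻¹' Set.univ.pi s) =
      Set.univ.pi fun k => (fun x => M *ᵥ x) ⁻¹' s k := by
    ext; simp
  rw [this, volume_pi_pi, volume_pi_pi, ← Finset.card_univ, ← Finset.prod_const,
    ← Finset.prod_mul_distrib]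
  exact Finset.prod_congr rfl fun i _ => volume_preimage_mulVec M hM (hs i)

end Pi

end HaarMeasure

section NormPowers

theorem norm_sub_le_max_of_ultrametric {E : Type*} [SeminormedAddCommGroup E]
    [IsUltrametricDist E] (x y : E) : ‖x - y‖ ≤ max ‖x‖ ‖y‖ := by
  rw [sub_eq_add_neg, ← norm_neg y]
  exact IsUltrametricDist.norm_add_le_max _ _

theorem enorm_padic_p_zpow (k : ℤ) : ‖(p : ℚ_[p]) ^ k‖ₑ = ENNReal.ofReal ((p : ℝ) ^ (-k)) := by
  rw [← ofReal_norm, norm_zpow, Padic.norm_p, inv_zpow']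

theorem one_lt_p : (1 : ℝ) < p := by exact_mod_cast hp.out.one_lt

theorem p_pos : (0 : ℝ) < p := by exact_mod_cast hp.out.pos

theorem padic_p_ne_zero : (p : ℚ_[p]) ≠ 0 := by exact_mod_cast hp.out.ne_zero

theorem volume_closedBall_zpow (x : ℚ_[p]) (k : ℤ) :
    volume (Metric.closedBall x ((p : ℝ) ^ k)) = ENNReal.ofReal ((p : ℝ) ^ k) := by
  have h0 : volume (Metric.closedBall x ((p : ℝ) ^ k)) =
      volume (Metric.closedBall (0 : ℚ_[p]) ((p : ℝ) ^ k)) := by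
    rw [← measure_preimage_add volume x (Metric.closedBall x ((p : ℝ) ^ k))]
    congr 1; ext y; simp
  have h1 := volume_preimage_mul ((p : ℚ_[p]) ^ k) (zpow_ne_zero _ padic_p_ne_zero)
    (Metric.closedBall 0 1)
  have h2 : (fun x => (p : ℚ_[p]) ^ k * x) ⁻¹' Metric.closedBall 0 1 =
      Metric.closedBall 0 ((p : ℝ) ^ k) := by
    ext y
    have : (0 : ℝ) < (p : ℝ) ^ k := zpow_pos p_pos _
    simp only [Set.mem_preimage, mem_closedBall_zero_iff, norm_mul, norm_zpow, Padic.norm_p,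
      inv_zpow, inv_mul_le_one₀ this]
  rw [h2, volume_unitBall, enorm_padic_p_zpow] at h1
  have h3 : ENNReal.ofReal ((p : ℝ) ^ k) * ENNReal.ofReal ((p : ℝ) ^ (-k)) = 1 := by
    rw [← ENNReal.ofReal_mul (zpow_pos p_pos _).le, ← zpow_add₀ p_pos.ne']
    simp
  calc _ = ENNReal.ofReal ((p : ℝ) ^ k) * ENNReal.ofReal ((p : ℝ) ^ (-k)) *
        volume (Metric.closedBall (0 : ℚ_[p]) ((p : ℝ) ^ k)) := by rw [h3, one_mul, h0]
    _ = _ := by rw [mul_assoc, h1, mul_one]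

theorem enorm_rpow_neg_eq {x : ℚ_[p]} (hx : x ≠ 0) (s : ℝ) :
    ‖x‖ₑ ^ (-s) = ENNReal.ofReal (‖x‖ ^ (-s)) := by
  rw [← ofReal_norm, ENNReal.ofReal_rpow_of_pos (norm_pos_iff.2 hx)]

/-- Convergence of the integral of a power of the norm on a ball. -/
theorem lintegral_enorm_rpow_lt_top (s : ℝ) (hs : s < 1) (R : ℝ) :
    ∫⁻ t in Metric.closedBall (0 : ℚ_[p]) R, ‖t‖ₑ ^ (-s) < ⊤ := by
  obtain ⟨k, hk⟩ := pow_unbounded_of_one_lt R (one_lt_p (p := p))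
  have hsub : Metric.closedBall (0 : ℚ_[p]) R ⊆ Metric.closedBall 0 ((p : ℝ) ^ k) :=
    Metric.closedBall_subset_closedBall hk.le
  refine (lintegral_mono_set hsub).trans_lt ?_
  let B : ℕ → Set ℚ_[p] := fun m => Metric.closedBall 0 ((p : ℝ) ^ ((k : ℤ) - m))
  have hB : ∀ m, MeasurableSet (B m) := fun m => Metric.isClosed_closedBall.measurableSet
  have hpt : ∀ t ∈ Metric.closedBall (0 : ℚ_[p]) ((p : ℝ) ^ k), t ≠ 0 → ‖t‖ₑ ^ (-s) ≤
      ∑' m : ℕ, (B m).indicator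
        (fun _ => ENNReal.ofReal (((p : ℝ) ^ ((k : ℤ) - m)) ^ (-s))) t := by
    intro t ht ht0
    rw [mem_closedBall_zero_iff, Padic.norm_eq_zpow_neg_valuation ht0, ← zpow_natCast,
      zpow_le_zpow_iff_right₀ one_lt_p] at ht
    obtain ⟨m, hm⟩ := Int.eq_ofNat_of_zero_le (a := k + t.valuation) (by omega)
    refine le_trans (le_of_eq ?_) (ENNReal.le_tsum m)
    have e : ‖t‖ = (p : ℝ) ^ ((k : ℤ) - m) := by
      rw [Padic.norm_eq_zpow_neg_valuation ht0]; congr 1; omega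
    rw [Set.indicator_of_mem (by simp [B, e]), enorm_rpow_neg_eq ht0, e]
  have hae : ∀ᵐ t ∂(volume.restrict (Metric.closedBall (0 : ℚ_[p]) ((p : ℝ) ^ k))),
      ‖t‖ₑ ^ (-s) ≤ ∑' m : ℕ, (B m).indicator
        (fun _ => ENNReal.ofReal (((p : ℝ) ^ ((k : ℤ) - m)) ^ (-s))) t := by
    have h0 : ∀ᵐ t : ℚ_[p], t ≠ 0 := by simp [ae_iff]
    filter_upwards [ae_restrict_mem Metric.isClosed_closedBall.measurableSet,
      ae_restrict_of_ae h0] with t ht ht0 using hpt t ht ht0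
  refine (lintegral_mono_ae hae).trans_lt ?_
  refine (setLIntegral_le_lintegral _ _).trans_lt ?_
  rw [lintegral_tsum fun m => (measurable_const.indicator (hB m)).aemeasurable]
  have : ∀ m : ℕ, ∫⁻ t, (B m).indicator
      (fun _ => ENNReal.ofReal (((p : ℝ) ^ ((k : ℤ) - m)) ^ (-s))) t =
      ENNReal.ofReal (((p : ℝ) ^ k) ^ (1 - s) * (((p : ℝ) ^ (-(1 - s)))) ^ m) := by
    intro m
    rw [lintegral_indicator_const (hB m), volume_closedBall_zpow, ← ENNReal.ofReal_mul
      (Real.rpow_nonneg (zpow_pos p_pos _).le _)]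
    congr 1
    have hp := p_pos (p := p)
    simp only [← Real.rpow_intCast, ← Real.rpow_natCast, ← Real.rpow_mul hp.le,
      ← Real.rpow_add hp]
    congr 1
    push_cast
    ring
  simp_rw [this]
  have hr : (p : ℝ) ^ (-(1 - s)) < 1 := Real.rpow_lt_one_of_one_lt_of_neg one_lt_p (by linarith)
  have hsum : Summable fun m : ℕ => ((p : ℝ) ^ k) ^ (1 - s) * (((p : ℝ) ^ (-(1 - s)))) ^ m :=
    (summable_geometric_of_lt_one (Real.rpow_nonneg p_pos.le _) hr).mul_left _
  rw [← ENNReal.ofReal_tsum_of_nonneg (fun m => by have := p_pos (p := p); positivity) hsum]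
  exact ENNReal.ofReal_lt_top

/-- The integral over a ball of a power of the distance to a point of an algebraic closure is
bounded uniformly in the point. -/
theorem lintegral_enorm_sub_rpow_le (s : ℝ) (hs0 : 0 ≤ s) (R : ℝ) (α : PadicAlgCl p) :
    ∫⁻ t in Metric.closedBall (0 : ℚ_[p]) R, ‖algebraMap ℚ_[p] (PadicAlgCl p) t - α‖ₑ ^ (-s) ≤
      ∫⁻ t in Metric.closedBall (0 : ℚ_[p]) R, ‖t‖ₑ ^ (-s) := by
  rcases lt_or_ge R 0 with hR | hR
  · simp [Metric.closedBall_eq_empty.2 hR]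
  have hnorm : ∀ t : ℚ_[p], ‖algebraMap ℚ_[p] (PadicAlgCl p) t‖ = ‖t‖ := fun t =>
    PadicAlgCl.norm_extends p t
  have hcont : Continuous (algebraMap ℚ_[p] (PadicAlgCl p)) :=
    (AddMonoidHomClass.isometry_of_norm (algebraMap ℚ_[p] (PadicAlgCl p)) hnorm).continuous
  obtain ⟨t₀, ht₀, hmin⟩ := (isCompact_closedBall (0 : ℚ_[p]) R).exists_isMinOn
    ⟨0, by simpa using hR⟩ (f := fun t => ‖algebraMap ℚ_[p] (PadicAlgCl p) t - α‖)
    (by fun_prop)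
  have hle : ∀ t ∈ Metric.closedBall (0 : ℚ_[p]) R,
      ‖algebraMap ℚ_[p] (PadicAlgCl p) t - α‖ₑ ^ (-s) ≤ ‖t - t₀‖ₑ ^ (-s) := by
    intro t ht
    rw [ENNReal.rpow_neg, ENNReal.rpow_neg, ENNReal.inv_le_inv]
    refine ENNReal.rpow_le_rpow ?_ hs0
    rw [← ofReal_norm, ← ofReal_norm]
    refine ENNReal.ofReal_le_ofReal ?_
    rw [← hnorm, map_sub, ← sub_sub_sub_cancel_right _ _ α]
    exact (norm_sub_le_max_of_ultrametric _ _).trans (max_le le_rfl (hmin ht))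
  refine (setLIntegral_mono' Metric.isClosed_closedBall.measurableSet hle).trans ?_
  rw [← lintegral_indicator Metric.isClosed_closedBall.measurableSet,
    ← lintegral_indicator Metric.isClosed_closedBall.measurableSet,
    ← lintegral_sub_right_eq_self (fun t => (Metric.closedBall (0 : ℚ_[p]) R).indicator
      (fun t => ‖t‖ₑ ^ (-s)) t) t₀]
  refine lintegral_mono fun t => ?_
  by_cases ht : t ∈ Metric.closedBall (0 : ℚ_[p]) R
  · have : t - t₀ ∈ Metric.closedBall (0 : ℚ_[p]) R := by
      rw [mem_closedBall_zero_iff] at *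
      exact (norm_sub_le_max_of_ultrametric _ _).trans (max_le ht ht₀)
    rw [Set.indicator_of_mem ht, Set.indicator_of_mem this]
  · simp [Set.indicator_of_notMem ht]

theorem multiset_prod_le_sum_pow_card (s : Multiset ℝ≥0∞) (hs : s ≠ 0) :
    s.prod ≤ (s.map fun z => z ^ Multiset.card s).sum := by
  obtain ⟨m, hm, hmax⟩ := Multiset.exists_max_image id (by simpa using hs)
  calc s.prod ≤ m ^ Multiset.card s := Multiset.prod_le_pow_card _ _ hmax
    _ ≤ _ := Multiset.single_le_sum (by simp) _
        (Multiset.mem_map_of_mem (fun z => z ^ Multiset.card s) hm)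

theorem enorm_multiset_prod_rpow {K : Type*} [NormedField K] (s : Multiset K) (r : ℝ) :
    ‖s.prod‖ₑ ^ r = (s.map fun z => ‖z‖ₑ ^ r).prod := by
  induction s using Multiset.induction_on with
  | empty => simp
  | cons a s ih =>
    rw [Multiset.prod_cons, Multiset.map_cons, Multiset.prod_cons, enorm_mul,
      ENNReal.mul_rpow_of_ne_top enorm_ne_top enorm_ne_top, ih]

theorem lintegral_multiset_sum_le {X A : Type*} [MeasurableSpace X] (μ : Measure X)
    (g : A → X → ℝ≥0∞) (hg : ∀ a, Measurable (g a)) (C : ℝ≥0∞) (hC : ∀ a, ∫⁻ x, g a x ∂μ ≤ C)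
    (s : Multiset A) :
    ∫⁻ x, (s.map fun a => g a x).sum ∂μ ≤ Multiset.card s * C := by
  induction s using Multiset.induction_on with
  | empty => simp
  | cons a s ih =>
    simp only [Multiset.map_cons, Multiset.sum_cons, Multiset.card_cons]
    rw [lintegral_add_left (hg a), Nat.cast_add, Nat.cast_one, add_mul, one_mul, add_comm]
    exact add_le_add ih (hC a)

/-- The integral of a small negative power of a polynomial in one variable is controlled by its
leading coefficient. -/
theorem exists_lintegral_polynomial_rpow_le (d : ℕ) (ε : ℝ) (hε : 0 ≤ ε) (hd : d * ε < 1) (R : ℝ) :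
    ∃ C : ℝ≥0∞, C ≠ ⊤ ∧ C ≠ 0 ∧ ∀ P : Polynomial ℚ_[p], P.natDegree = d → P ≠ 0 →
      ∫⁻ t in Metric.closedBall (0 : ℚ_[p]) R, ‖P.eval t‖ₑ ^ (-ε) ≤
        C * ‖P.leadingCoeff‖ₑ ^ (-ε) := by
  let J := ∫⁻ t in Metric.closedBall (0 : ℚ_[p]) R, ‖t‖ₑ ^ (-(d * ε))
  have hJ : J < ⊤ := lintegral_enorm_rpow_lt_top _ hd R
  have hV : volume (Metric.closedBall (0 : ℚ_[p]) R) < ⊤ := measure_closedBall_lt_top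
  refine ⟨1 + volume (Metric.closedBall (0 : ℚ_[p]) R) + d * J, ?_, by simp, ?_⟩
  · finiteness
  intro P hPd hP0
  rcases Nat.eq_zero_or_pos d with h0 | hpos
  · rw [h0] at hPd
    rw [Polynomial.eq_C_of_natDegree_eq_zero hPd]
    simp only [Polynomial.eval_C, Polynomial.leadingCoeff_C, lintegral_const,
      Measure.restrict_apply_univ]
    rw [mul_comm]
    gcongr
    rw [h0]; simp
  have hnorm : ∀ t : ℚ_[p], ‖algebraMap ℚ_[p] (PadicAlgCl p) t‖ₑ = ‖t‖ₑ := fun t => by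
    rw [← ofReal_norm, ← ofReal_norm, PadicAlgCl.norm_extends p t]
  have hcont : Continuous (algebraMap ℚ_[p] (PadicAlgCl p)) :=
    (AddMonoidHomClass.isometry_of_norm (algebraMap ℚ_[p] (PadicAlgCl p))
      (PadicAlgCl.norm_extends p)).continuous
  set Q := P.map (algebraMap ℚ_[p] (PadicAlgCl p)) with hQ
  have hsplit : Q.Splits := IsAlgClosed.splits Q
  have hcard : Multiset.card Q.roots = d := by
    rw [← hsplit.natDegree_eq_card_roots, hQ, Polynomial.natDegree_map, hPd]
  have heval : ∀ t : ℚ_[p], ‖P.eval t‖ₑ ^ (-ε) = ‖P.leadingCoeff‖ₑ ^ (-ε) *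
      (Q.roots.map fun α => ‖algebraMap ℚ_[p] (PadicAlgCl p) t - α‖ₑ ^ (-ε)).prod := by
    intro t
    rw [← hnorm, ← hnorm, ← Polynomial.eval₂_at_apply, ← Polynomial.eval_map, ← hQ,
      hsplit.eval_eq_prod_roots, hQ, Polynomial.leadingCoeff_map, enorm_mul,
      ENNReal.mul_rpow_of_ne_top enorm_ne_top enorm_ne_top, enorm_multiset_prod_rpow,
      Multiset.map_map]
    rfl
  have hlc : ‖P.leadingCoeff‖ₑ ^ (-ε) ≠ ⊤ := by
    rw [enorm_rpow_neg_eq (Polynomial.leadingCoeff_ne_zero.2 hP0)]; exact ENNReal.ofReal_ne_top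
  simp_rw [heval]
  rw [lintegral_const_mul' _ _ hlc, mul_comm]
  gcongr
  refine le_trans ?_ (le_add_left le_rfl)
  have hle : ∀ t : ℚ_[p],
      (Q.roots.map fun α => ‖algebraMap ℚ_[p] (PadicAlgCl p) t - α‖ₑ ^ (-ε)).prod ≤
      (Q.roots.map fun α => ‖algebraMap ℚ_[p] (PadicAlgCl p) t - α‖ₑ ^ (-(d * ε))).sum := by
    intro t
    refine (multiset_prod_le_sum_pow_card _ ?_).trans (le_of_eq ?_)
    · intro h
      have := congrArg Multiset.card h
      simp only [Multiset.card_map, Multiset.card_zero] at this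
      omega
    · rw [Multiset.map_map, Multiset.card_map, hcard]
      congr 1
      refine Multiset.map_congr rfl fun α _ => ?_
      simp only [Function.comp]
      rw [← ENNReal.rpow_mul_natCast]
      congr 1; ring
  refine (lintegral_mono hle).trans ?_
  have := lintegral_multiset_sum_le (volume.restrict (Metric.closedBall (0 : ℚ_[p]) R))
    (fun (α : PadicAlgCl p) t => ‖algebraMap ℚ_[p] (PadicAlgCl p) t - α‖ₑ ^ (-(d * ε)))
    (fun α => by
      have : Continuous fun t : ℚ_[p] => ‖algebraMap ℚ_[p] (PadicAlgCl p) t - α‖ₑ := by fun_prop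
      exact this.measurable.pow_const _) J
    (fun α => lintegral_enorm_sub_rpow_le _ (by positivity) R α) Q.roots
  rwa [hcard] at this

/-- A small negative power of a nonzero polynomial is integrable on balls. -/
theorem exists_lintegral_mvPolynomial_rpow_lt_top_fin {N : ℕ} (f : MvPolynomial (Fin N) ℚ_[p])
    (hf : f ≠ 0) : ∃ ε₀ : ℝ, 0 < ε₀ ∧ ∀ ε : ℝ, 0 < ε → ε ≤ ε₀ → ∀ R : ℝ,
      ∫⁻ x in Metric.closedBall (0 : Fin N → ℚ_[p]) R, ‖MvPolynomial.eval x f‖ₑ ^ (-ε) < ⊤ := by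
  induction N with
  | zero =>
    refine ⟨1, one_pos, fun ε _ _ R => ?_⟩
    obtain ⟨a, rfl⟩ := MvPolynomial.C_surjective (Fin 0) f
    have ha : a ≠ 0 := fun h => hf (by simp [h])
    simp only [MvPolynomial.eval_C, lintegral_const, enorm_rpow_neg_eq ha]
    exact ENNReal.mul_lt_top ENNReal.ofReal_lt_top (by
      rw [Measure.restrict_apply_univ]; exact measure_closedBall_lt_top)
  | succ N ih =>
    set F := MvPolynomial.finSuccEquiv ℚ_[p] N f with hF
    have hF0 : F ≠ 0 := by simpa [hF] using hf
    set g := F.leadingCoeff with hg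
    obtain ⟨ε₁, hε₁, h₁⟩ := ih g (Polynomial.leadingCoeff_ne_zero.2 hF0)
    set d := F.natDegree
    refine ⟨min ε₁ (1 / (d + 2)), by positivity, fun ε hε hε' R => ?_⟩
    have hd : d * ε < 1 := by
      have := hε'.trans (min_le_right _ _)
      rw [le_div_iff₀ (by positivity)] at this
      nlinarith
    obtain ⟨C, hC, hC0, hCle⟩ := exists_lintegral_polynomial_rpow_le (p := p) d ε hε.le hd R
    have hpt : ∀ y : Fin N → ℚ_[p], ∫⁻ t in Metric.closedBall (0 : ℚ_[p]) R,
        ‖MvPolynomial.eval (Fin.cons t y) f‖ₑ ^ (-ε) ≤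
        C * ‖MvPolynomial.eval y g‖ₑ ^ (-ε) := by
      intro y
      by_cases hy : MvPolynomial.eval y g = 0
      · rw [hy]
        simp [hε, ENNReal.mul_top hC0]
      · have hdeg := Polynomial.natDegree_map_of_leadingCoeff_ne_zero (MvPolynomial.eval y) hy
        have hlead := Polynomial.leadingCoeff_map_of_leadingCoeff_ne_zero (MvPolynomial.eval y) hy
        have := hCle (F.map (MvPolynomial.eval y)) hdeg (fun h => hy (by
          rw [← hlead, h, Polynomial.leadingCoeff_zero]))
        rw [hlead] at this
        refine le_trans (le_of_eq ?_) this
        refine lintegral_congr fun t => ?_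
        rw [MvPolynomial.eval_eq_eval_mv_eval']
    have hmp := volume_preserving_piFinSuccAbove (fun _ : Fin (N + 1) => ℚ_[p]) 0
    set e := MeasurableEquiv.piFinSuccAbove (fun _ : Fin (N + 1) => ℚ_[p]) 0 with he
    let G : ℚ_[p] × (Fin N → ℚ_[p]) → ℝ≥0∞ := fun z =>
      ‖MvPolynomial.eval (Fin.cons z.1 z.2 : Fin (N + 1) → ℚ_[p]) f‖ₑ ^ (-ε)
    have hG : Measurable G := by
      have hc : Continuous fun z : ℚ_[p] × (Fin N → ℚ_[p]) =>
          (Fin.cons z.1 z.2 : Fin (N + 1) → ℚ_[p]) := by fun_prop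
      exact ((f.continuous_eval.comp hc).enorm.measurable).pow_const _
    have hGe : ∀ x, ‖MvPolynomial.eval x f‖ₑ ^ (-ε) = G (e x) := by
      intro x
      have : (Fin.cons (e x).1 (e x).2 : Fin (N + 1) → ℚ_[p]) = x := Fin.cons_self_tail x
      simp only [G, this]
    have hball : Metric.closedBall (0 : Fin (N + 1) → ℚ_[p]) R ⊆
        e ⁻¹' (Metric.closedBall 0 R ×ˢ Metric.closedBall 0 R) := by
      intro x hx
      rw [mem_closedBall_zero_iff] at hx
      simp only [Set.mem_preimage, Set.mem_prod, mem_closedBall_zero_iff]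
      refine ⟨(norm_le_pi_norm x 0).trans hx, (pi_norm_le_iff_of_nonneg
        ((norm_nonneg x).trans hx)).2 fun i => (norm_le_pi_norm x i.succ).trans hx⟩
    simp_rw [hGe]
    refine (lintegral_mono_set hball).trans_lt ?_
    rw [hmp.setLIntegral_comp_preimage_emb e.measurableEmbedding, Measure.volume_eq_prod,
      ← Measure.prod_restrict, lintegral_prod_symm _ hG.aemeasurable]
    refine (lintegral_mono hpt).trans_lt ?_
    rw [lintegral_const_mul' _ _ hC]
    exact ENNReal.mul_lt_top hC.lt_top (h₁ ε hε (hε'.trans (min_le_left _ _)) R)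

theorem exists_lintegral_mvPolynomial_rpow_lt_top {ι : Type*} [Fintype ι]
    (f : MvPolynomial ι ℚ_[p]) (hf : f ≠ 0) : ∃ ε₀ : ℝ, 0 < ε₀ ∧ ∀ ε : ℝ, 0 < ε → ε ≤ ε₀ → ∀ R : ℝ,
      ∫⁻ x in Metric.closedBall (0 : ι → ℚ_[p]) R, ‖MvPolynomial.eval x f‖ₑ ^ (-ε) < ⊤ := by
  let σ := Fintype.equivFin ι
  obtain ⟨ε₀, h0, h⟩ := exists_lintegral_mvPolynomial_rpow_lt_top_fin (MvPolynomial.rename σ f)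
    ((MvPolynomial.rename_injective _ σ.injective).ne_iff' (map_zero _) |>.2 hf)
  refine ⟨ε₀, h0, fun ε hε hε' R => (h ε hε hε' R).trans_le' (le_of_eq ?_)⟩
  have hmp := volume_measurePreserving_piCongrLeft (fun _ : ι => ℚ_[p]) σ.symm
  rw [← hmp.setLIntegral_comp_preimage_emb (MeasurableEquiv.measurableEmbedding _)]
  have e : ∀ x : Fin (Fintype.card ι) → ℚ_[p],
      MeasurableEquiv.piCongrLeft (fun _ : ι => ℚ_[p]) σ.symm x = x ∘ σ := by
    intro x
    ext i
    conv_lhs => rw [← σ.symm_apply_apply i]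
    exact MeasurableEquiv.piCongrLeft_apply_apply (e := σ.symm) (β := fun _ : ι => ℚ_[p]) x (σ i)
  simp_rw [e, MvPolynomial.eval_rename]
  congr 2
  ext x
  rw [Set.mem_preimage, e, mem_closedBall_zero_iff, mem_closedBall_zero_iff]
  have : ‖x ∘ σ‖ = ‖x‖ := by
    refine le_antisymm ((pi_norm_le_iff_of_nonneg (norm_nonneg _)).2 fun i =>
      norm_le_pi_norm x (σ i)) ((pi_norm_le_iff_of_nonneg (norm_nonneg _)).2 fun i => ?_)
    simpa using norm_le_pi_norm (x ∘ σ) (σ.symm i)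
  rw [this]

end NormPowers

section CellCovering

/-- A one-sided change of variables formula for a map that is controlled on the cells of a
sequence of finer and finer partitions into open sets. -/
theorem lintegral_image_le_of_cells {X Y : Type*} [TopologicalSpace X] [SecondCountableTopology X]
    [MeasurableSpace X] [OpensMeasurableSpace X] [MeasurableSpace Y] (μ : Measure X)
    (ν : Measure Y) (Φ : X → Y) (U : Set X) (h : Y → ℝ≥0∞) (K : X → ℝ≥0∞) (N : ℕ → X → Set X)
    (hopen : ∀ m, ∀ x ∈ U, IsOpen (N m x)) (hmem : ∀ m, ∀ x ∈ U, x ∈ N m x)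
    (hpart : ∀ m, ∀ x ∈ U, ∀ y ∈ N m x, N m y = N m x)
    (hmono : ∀ m, ∀ x ∈ U, N (m + 1) x ⊆ N m x)
    (hgood : ∀ x ∈ U, ∃ m, N m x ⊆ U ∧ (∀ y ∈ N m x, K y = K x) ∧
      ∫⁻ y in Φ '' N m x, h y ∂ν ≤ K x * μ (N m x)) :
    ∫⁻ y in Φ '' U, h y ∂ν ≤ ∫⁻ x in U, K x ∂μ := by
  classical
  let good : ℕ → X → Prop := fun m x => N m x ⊆ U ∧ (∀ y ∈ N m x, K y = K x) ∧
    ∫⁻ y in Φ '' N m x, h y ∂ν ≤ K x * μ (N m x)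
  have hgood' : ∀ x ∈ U, ∃ m, good m x := hgood
  have hanti : ∀ m k, ∀ x ∈ U, m ≤ k → N k x ⊆ N m x := by
    intro m k x hx hmk
    induction hmk with
    | refl => exact subset_rfl
    | step _ ih => exact (hmono _ x hx).trans ih
  have hinv : ∀ m, ∀ x ∈ U, ∀ y, good m x → y ∈ N m x → good m y := by
    rintro m x hx y ⟨h1, h2, h3⟩ hy
    have e := hpart m x hx y hy
    refine ⟨e ▸ h1, fun z hz => ?_, ?_⟩
    · rw [h2 z (e ▸ hz), h2 y hy]
    · rw [e, h2 y hy]; exact h3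
  let r : X → ℕ := fun x => if hx : ∃ m, good m x then Nat.find hx else 0
  have hr : ∀ x ∈ U, good (r x) x := by
    intro x hx
    have := hgood' x hx
    simp only [r, dif_pos this]
    exact Nat.find_spec this
  have hrmin : ∀ x m, good m x → r x ≤ m := by
    intro x m hm
    have : ∃ m, good m x := ⟨m, hm⟩
    simp only [r, dif_pos this]
    exact Nat.find_min' this hm
  let c : X → Set X := fun x => N (r x) x
  have hcU : ∀ x ∈ U, c x ⊆ U := fun x hx => (hr x hx).1
  have hcc : ∀ x ∈ U, ∀ y ∈ c x, c y = c x := by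
    intro x hx y hy
    have hyU := hcU x hx hy
    have h1 : r y ≤ r x := hrmin y _ (hinv _ x hx y (hr x hx) hy)
    have e := hpart _ x hx y hy
    have hxy : x ∈ N (r y) y := hanti _ _ y hyU h1 (e ▸ hmem (r x) x hx)
    have h2 : r x ≤ r y := hrmin x _ (hinv _ y hyU x (hr y hyU) hxy)
    have h3 : r y = r x := le_antisymm h1 h2
    simp only [c, h3, e]
  have hdisj : (c '' U).PairwiseDisjoint id := by
    rintro _ ⟨x, hx, rfl⟩ _ ⟨y, hy, rfl⟩ hne
    refine Set.disjoint_left.2 fun z hzx hzy => hne ?_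
    rw [← hcc x hx z hzx, ← hcc y hy z hzy]
  have hcount : (c '' U).Countable := by
    refine hdisj.countable_of_isOpen ?_ ?_
    · rintro _ ⟨x, hx, rfl⟩; exact hopen _ _ hx
    · rintro _ ⟨x, hx, rfl⟩; exact ⟨x, hmem _ _ hx⟩
  have hU : U = ⋃ s ∈ c '' U, s := by
    ext x
    simp only [Set.mem_iUnion, exists_prop]
    constructor
    · exact fun hx => ⟨c x, ⟨x, hx, rfl⟩, hmem _ _ hx⟩
    · rintro ⟨_, ⟨y, hy, rfl⟩, hx⟩; exact hcU y hy hx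
  have : Countable (c '' U) := hcount.to_subtype
  have himg : Φ '' U = ⋃ s : c '' U, Φ '' s := by
    conv_lhs => rw [hU]
    rw [Set.image_iUnion₂, Set.biUnion_eq_iUnion]
  have hrhs : ∫⁻ x in U, K x ∂μ = ∑' s : c '' U, ∫⁻ x in s, K x ∂μ := by
    conv_lhs => rw [hU]
    refine lintegral_biUnion hcount ?_ hdisj _
    rintro _ ⟨x, hx, rfl⟩; exact (hopen _ _ hx).measurableSet
  rw [himg, hrhs]
  refine (lintegral_iUnion_le _ _).trans (ENNReal.tsum_le_tsum ?_)
  rintro ⟨_, x, hx, rfl⟩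
  obtain ⟨_, h2, h3⟩ := hr x hx
  refine h3.trans (le_of_eq ?_)
  rw [← setLIntegral_const]
  exact setLIntegral_congr_fun (hopen _ _ hx).measurableSet fun y hy => (h2 y hy).symm

end CellCovering

open Polynomial

section RootIntegrals

theorem norm_galois (F : IntermediateField ℚ_[p] (PadicAlgCl p))
    (σ : PadicAlgCl p ≃ₐ[F] PadicAlgCl p) (x : PadicAlgCl p) : ‖σ x‖ = ‖x‖ := by
  rw [← PadicAlgCl.spectralNorm_eq, ← PadicAlgCl.spectralNorm_eq]
  exact (spectralNorm_eq_of_equiv (σ.restrictScalars ℚ_[p]) x).symm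

/-- The polynomial with the roots of `f` satisfying `P`. -/
def partialRootsProd (f : (PadicAlgCl p)[X]) (P : PadicAlgCl p → Prop) [DecidablePred P] :
    (PadicAlgCl p)[X] :=
  ((f.roots.filter P).map fun β => X - C β).prod

theorem partialRootsProd_lift (F : IntermediateField ℚ_[p] (PadicAlgCl p)) (f : F[X])
    (P : PadicAlgCl p → Prop) [DecidablePred P]
    (hP : ∀ (σ : PadicAlgCl p ≃ₐ[F] PadicAlgCl p) x, P (σ x) ↔ P x) :
    ∃ g : F[X], g.Monic ∧ g.map (algebraMap F (PadicAlgCl p)) =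
      partialRootsProd (f.map (algebraMap F (PadicAlgCl p))) P := by
  set φ := algebraMap F (PadicAlgCl p) with hφ
  set q := partialRootsProd (f.map φ) P with hq
  have hmon : q.Monic := monic_multiset_prod_of_monic _ _ fun β _ => monic_X_sub_C β
  have hfix : ∀ σ : PadicAlgCl p ≃ₐ[F] PadicAlgCl p,
      q.map (σ : PadicAlgCl p →+* PadicAlgCl p) = q := by
    intro σ
    have hroots : (f.map φ).roots.map σ = (f.map φ).roots := by
      have h1 := (IsAlgClosed.splits (f.map φ)).roots_map (σ : PadicAlgCl p →+* PadicAlgCl p)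
      rw [Polynomial.map_map] at h1
      have h2 : (σ : PadicAlgCl p →+* PadicAlgCl p).comp φ = φ := by
        ext x; exact σ.commutes x
      rw [h2] at h1
      exact h1.symm
    have hfil : ((f.map φ).roots.filter P).map σ = (f.map φ).roots.filter P := by
      conv_rhs => rw [← hroots, Multiset.filter_map]
      congr 1
      refine Multiset.filter_congr fun x _ => (hP σ x).symm
    rw [hq, partialRootsProd, Polynomial.map_multiset_prod, Multiset.map_map]
    conv_rhs => rw [← hfil, Multiset.map_map]
    simp
  have hlift : q ∈ lifts φ := by
    rw [lifts_iff_coeff_lifts]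
    intro i
    have := (InfiniteGalois.mem_range_algebraMap_iff_fixed (k := F) (q.coeff i)).2 fun σ => by
      conv_rhs => rw [← hfix σ]
      simp
    exact this
  obtain ⟨g, hg, -, hgm⟩ := lifts_and_natDegree_eq_and_monic hlift hmon
  exact ⟨g, hgm, hg⟩

theorem exists_root_near {K : Type*} [NormedField K] [IsAlgClosed K] {N : ℕ} (f₀ : K[X])
    (hf₀ : f₀.Monic) (hN : f₀.natDegree = N) {α : K} (hα : f₀.IsRoot α) {η : ℝ} (hη : 0 < η) :
    ∃ δ : ℝ, 0 < δ ∧ ∀ f : K[X], f.Monic → f.natDegree = N →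
      (∀ i < N, ‖f.coeff i - f₀.coeff i‖ < δ) → ∃ β ∈ f.roots, ‖β - α‖ < η := by
  set M : ℝ := ∑ i ∈ Finset.range N, ‖α‖ ^ i with hM
  have hM0 : 0 ≤ M := Finset.sum_nonneg fun i _ => by positivity
  refine ⟨η ^ N / (M + 1), by positivity, fun f hf hfN hclose => ?_⟩
  by_contra! hcon
  have h1 : η ^ N ≤ ‖f.eval α‖ := by
    rw [(IsAlgClosed.splits f).eval_eq_prod_roots, hf.leadingCoeff, one_mul]
    have hcard : Multiset.card f.roots = N := by
      rw [← (IsAlgClosed.splits f).natDegree_eq_card_roots, hfN]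
    rw [← hcard]
    generalize f.roots = s at hcon
    induction s using Multiset.induction_on with
    | empty => simp
    | cons a s ih =>
      rw [Multiset.card_cons, Multiset.map_cons, Multiset.prod_cons, norm_mul, pow_succ, mul_comm]
      refine mul_le_mul ?_ (ih fun β hβ => hcon β (Multiset.mem_cons_of_mem hβ)) (by positivity)
        (by positivity)
      rw [norm_sub_rev]
      exact hcon a (Multiset.mem_cons_self a s)
  have h2 : f.eval α = ∑ i ∈ Finset.range N, (f.coeff i - f₀.coeff i) * α ^ i := by
    have e : f.eval α = f.eval α - f₀.eval α := by rw [hα.eq_zero, sub_zero]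
    rw [e, eval_eq_sum_range, eval_eq_sum_range, hfN, hN, Finset.sum_range_succ,
      Finset.sum_range_succ, ← hfN, hf.coeff_natDegree, hfN, ← hN, hf₀.coeff_natDegree, hN]
    simp only [sub_mul, Finset.sum_sub_distrib]
    ring
  have h3 : ‖f.eval α‖ ≤ η ^ N / (M + 1) * M := by
    rw [h2, hM, Finset.mul_sum]
    refine (norm_sum_le _ _).trans (Finset.sum_le_sum fun i hi => ?_)
    rw [norm_mul, norm_pow]
    exact mul_le_mul_of_nonneg_right (hclose i (Finset.mem_range.1 hi)).le (by positivity)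
  have h4 : η ^ N / (M + 1) * M < η ^ N := by
    rw [div_mul_eq_mul_div, div_lt_iff₀ (by positivity)]
    have : 0 < η ^ N := by positivity
    nlinarith
  linarith

/-- All roots of monic polynomials of degree at most `n` over any finite extension `F` of `ℚ_[p]`
lie in a common finite extension. -/
def HasCommonSplittingField (p : ℕ) [Fact p.Prime] (n : ℕ) : Prop :=
  ∀ F : IntermediateField ℚ_[p] (PadicAlgCl p), FiniteDimensional ℚ_[p] F →
    ∃ L : IntermediateField ℚ_[p] (PadicAlgCl p), FiniteDimensional ℚ_[p] L ∧
      ∀ f : F[X], f.Monic → f.natDegree ≤ n → ∀ β, aeval β f = 0 → β ∈ L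

theorem exists_common_field_near {n : ℕ} (ih : HasCommonSplittingField p n)
    (F : IntermediateField ℚ_[p] (PadicAlgCl p)) (hF : FiniteDimensional ℚ_[p] F)
    (f₀ : (PadicAlgCl p)[X]) (hf₀ : f₀.Monic) (hN : f₀.natDegree = n + 1) {α α' : PadicAlgCl p}
    (hα : f₀.IsRoot α) (hα' : f₀.IsRoot α') (hne : α ≠ α') :
    ∃ L : IntermediateField ℚ_[p] (PadicAlgCl p), FiniteDimensional ℚ_[p] L ∧ ∃ δ : ℝ, 0 < δ ∧
      ∀ f : F[X], f.Monic → f.natDegree = n + 1 →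
        (∀ i < n + 1, ‖(f.coeff i : PadicAlgCl p) - f₀.coeff i‖ < δ) →
        ∀ β, aeval β f = 0 → β ∈ L := by
  classical
  set η := ‖α' - α‖ with hη
  have hη0 : 0 < η := norm_pos_iff.2 (sub_ne_zero.2 hne.symm)
  obtain ⟨δ₁, hδ₁, h₁⟩ := exists_root_near f₀ hf₀ hN hα hη0
  obtain ⟨δ₂, hδ₂, h₂⟩ := exists_root_near f₀ hf₀ hN hα' hη0
  let F' := F ⊔ IntermediateField.adjoin ℚ_[p] {α}
  have hαF : α ∈ F' := (le_sup_right : _ ≤ F') (IntermediateField.mem_adjoin_simple_self _ α)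
  have : FiniteDimensional ℚ_[p] (IntermediateField.adjoin ℚ_[p] {α}) :=
    IntermediateField.adjoin.finiteDimensional (Algebra.IsIntegral.isIntegral α)
  have hF' : FiniteDimensional ℚ_[p] F' := IntermediateField.finiteDimensional_sup _ _
  obtain ⟨L, hL, hroots⟩ := ih F' hF'
  refine ⟨L, hL, min δ₁ δ₂, lt_min hδ₁ hδ₂, fun f hf hfN hclose β hβ => ?_⟩
  set φ := algebraMap F (PadicAlgCl p) with hφ
  have hfm : (f.map φ).Monic := hf.map φ
  have hfN' : (f.map φ).natDegree = n + 1 := by rw [hf.natDegree_map, hfN]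
  obtain ⟨γ, hγ, hγα⟩ := h₁ (f.map φ) hfm hfN' fun i hi => by
    rw [coeff_map]; exact (hclose i hi).trans_le (min_le_left _ _)
  obtain ⟨γ', hγ', hγα'⟩ := h₂ (f.map φ) hfm hfN' fun i hi => by
    rw [coeff_map]; exact (hclose i hi).trans_le (min_le_right _ _)
  have hγ'α : ¬ ‖γ' - α‖ < η := by
    intro h
    have : η ≤ max ‖γ' - α‖ ‖γ' - α'‖ := by
      rw [hη]
      refine le_trans (le_of_eq ?_) (norm_sub_le_max_of_ultrametric _ _)
      congr 1; ring
    exact absurd this (not_le.2 (max_lt h hγα'))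
  let g : F'[X] := f.map (IntermediateField.inclusion (le_sup_left : F ≤ F')).toRingHom
  have hg : g.map (algebraMap F' (PadicAlgCl p)) = f.map φ := by
    rw [Polynomial.map_map]; rfl
  have hP : ∀ (σ : PadicAlgCl p ≃ₐ[F'] PadicAlgCl p) x, ‖σ x - α‖ < η ↔ ‖x - α‖ < η := by
    intro σ x
    have e : σ α = α := σ.commutes ⟨α, hαF⟩
    rw [← norm_galois F' σ (x - α), map_sub, e]
  have hcard : Multiset.card (f.map φ).roots = n + 1 := by
    rw [← (IsAlgClosed.splits (f.map φ)).natDegree_eq_card_roots, hfN']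
  have hβr : β ∈ (f.map φ).roots := by
    rw [mem_roots hfm.ne_zero, IsRoot, eval_map_algebraMap, hβ]
  have key : ∀ (P : PadicAlgCl p → Prop) [DecidablePred P],
      (∀ (σ : PadicAlgCl p ≃ₐ[F'] PadicAlgCl p) x, P (σ x) ↔ P x) →
      (∃ γ ∈ (f.map φ).roots, ¬ P γ) → P β → β ∈ L := by
    rintro P _ hP ⟨γ, hγ, hPγ⟩ hPβ
    obtain ⟨q, hqm, hq⟩ := partialRootsProd_lift F' g P hP
    rw [hg] at hq
    have hlt : Multiset.card ((f.map φ).roots.filter P) < n + 1 := by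
      rw [← hcard]
      refine Multiset.card_lt_card (lt_of_le_of_ne (Multiset.filter_le _ _) fun h => hPγ ?_)
      exact (Multiset.filter_eq_self.1 h) γ hγ
    refine hroots q hqm ?_ β ?_
    · rw [← hqm.natDegree_map (algebraMap F' (PadicAlgCl p)), hq, partialRootsProd,
        natDegree_multiset_prod_X_sub_C_eq_card]
      omega
    · rw [← eval_map_algebraMap, hq, partialRootsProd, eval_multiset_prod, Multiset.map_map]
      refine Multiset.prod_eq_zero (Multiset.mem_map.2 ⟨β, Multiset.mem_filter.2 ⟨hβr, hPβ⟩, ?_⟩)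
      simp
  by_cases hb : ‖β - α‖ < η
  · exact key (fun x => ‖x - α‖ < η) hP ⟨γ', hγ', hγ'α⟩ hb
  · exact key (fun x => ¬ ‖x - α‖ < η) (fun σ x => not_congr (hP σ x))
      ⟨γ, hγ, not_not.2 hγα⟩ hb

/-- Normalised coefficient vectors of monic polynomials of degree `n + 1` over `F`. -/
def normalizedCoeffs (F : IntermediateField ℚ_[p] (PadicAlgCl p)) (n : ℕ) :
    Set (Fin (n + 1) → PadicAlgCl p) :=
  {a | (∀ i, a i ∈ F ∧ ‖a i‖ ≤ 1) ∧ a (Fin.last n) = 0 ∧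
    ∃ i : Fin (n + 1), ‖(p : ℚ_[p])‖ ^ (n + 1 - (i : ℕ)) ≤ ‖a i‖}

theorem isCompact_normalizedCoeffs (F : IntermediateField ℚ_[p] (PadicAlgCl p))
    (hF : FiniteDimensional ℚ_[p] F) (n : ℕ) : IsCompact (normalizedCoeffs F n) := by
  have h1 : IsCompact {x : PadicAlgCl p | x ∈ F ∧ ‖x‖ ≤ 1} := by
    have : FiniteDimensional ℚ_[p] F.toSubmodule := hF
    have : ProperSpace F.toSubmodule := FiniteDimensional.proper ℚ_[p] _
    have h := (isCompact_closedBall (0 : F.toSubmodule) 1).image continuous_subtype_val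
    convert h using 1
    ext x
    constructor
    · rintro ⟨hx, hx'⟩
      exact ⟨⟨x, hx⟩, by simpa using hx', rfl⟩
    · rintro ⟨y, hy, rfl⟩
      exact ⟨y.2, by simpa using hy⟩
  have h2 : IsCompact (Set.univ.pi fun _ : Fin (n + 1) => {x : PadicAlgCl p | x ∈ F ∧ ‖x‖ ≤ 1}) :=
    isCompact_univ_pi fun _ => h1
  have h3 : IsClosed {a : Fin (n + 1) → PadicAlgCl p | a (Fin.last n) = 0 ∧
      ∃ i : Fin (n + 1), ‖(p : ℚ_[p])‖ ^ (n + 1 - (i : ℕ)) ≤ ‖a i‖} := by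
    refine IsClosed.and (isClosed_eq (continuous_apply _) continuous_const) ?_
    have : {a : Fin (n + 1) → PadicAlgCl p | ∃ i : Fin (n + 1),
        ‖(p : ℚ_[p])‖ ^ (n + 1 - (i : ℕ)) ≤ ‖a i‖} =
        ⋃ i : Fin (n + 1), {a | ‖(p : ℚ_[p])‖ ^ (n + 1 - (i : ℕ)) ≤ ‖a i‖} := by
      ext; simp
    rw [this]
    exact isClosed_iUnion_of_finite fun i =>
      isClosed_le continuous_const (continuous_apply i).norm
  convert h2.inter_right h3 using 1
  ext a
  simp [normalizedCoeffs]

theorem exists_distinct_roots {n : ℕ} {a : Fin (n + 1) → PadicAlgCl p}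
    (h0 : a (Fin.last n) = 0) (hne : ∃ i, a i ≠ 0) {f : (PadicAlgCl p)[X]} (hf : f.Monic)
    (hN : f.natDegree = n + 1) (hfa : ∀ i : Fin (n + 1), f.coeff i = a i) :
    ∃ α α', f.IsRoot α ∧ f.IsRoot α' ∧ α ≠ α' := by
  by_contra! hcon
  obtain ⟨α, hα⟩ := IsAlgClosed.exists_root f (by
    rw [degree_eq_natDegree hf.ne_zero, hN]; exact_mod_cast (Nat.succ_ne_zero n))
  have hcard : Multiset.card f.roots = n + 1 := by
    rw [← (IsAlgClosed.splits f).natDegree_eq_card_roots, hN]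
  have hroots : f.roots = Multiset.replicate (n + 1) α :=
    Multiset.eq_replicate.2 ⟨hcard, fun β hβ => hcon β α (isRoot_of_mem_roots hβ) hα⟩
  have hf' : f = (X - C α) ^ (n + 1) := by
    rw [(IsAlgClosed.splits f).eq_prod_roots, hroots, hf.leadingCoeff]
    rw [Multiset.map_replicate, Multiset.prod_replicate, map_one, one_mul]
  have hα0 : α = 0 := by
    have h1 : f.nextCoeff = 0 := by
      rw [nextCoeff_of_natDegree_pos (by omega), hN, ← h0, ← hfa]; simp
    rw [hf', Monic.nextCoeff_pow (monic_X_sub_C α), nextCoeff_X_sub_C, nsmul_eq_mul, mul_neg,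
      neg_eq_zero, mul_eq_zero] at h1
    exact h1.resolve_left (by exact_mod_cast Nat.succ_ne_zero n)
  obtain ⟨i, hi⟩ := hne
  apply hi
  rw [← hfa, hf', hα0, map_zero, sub_zero, coeff_X_pow, if_neg (by omega)]

theorem exists_common_field_normalized {n : ℕ} (ih : HasCommonSplittingField p n)
    (F : IntermediateField ℚ_[p] (PadicAlgCl p)) (hF : FiniteDimensional ℚ_[p] F) :
    ∃ L : IntermediateField ℚ_[p] (PadicAlgCl p), FiniteDimensional ℚ_[p] L ∧
      ∀ f : F[X], f.Monic → f.natDegree = n + 1 →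
        (fun i : Fin (n + 1) => (f.coeff i : PadicAlgCl p)) ∈ normalizedCoeffs F n →
        ∀ β, aeval β f = 0 → β ∈ L := by
  let poly : (Fin (n + 1) → PadicAlgCl p) → (PadicAlgCl p)[X] := fun a =>
    X ^ (n + 1) + ∑ i : Fin (n + 1), C (a i) * X ^ (i : ℕ)
  have hdeg : ∀ a : Fin (n + 1) → PadicAlgCl p,
      (∑ i : Fin (n + 1), C (a i) * X ^ (i : ℕ)).degree < ((n + 1 : ℕ) : WithBot ℕ) := fun a =>
    degree_sum_fin_lt a
  have hmon : ∀ a, (poly a).Monic := fun a => monic_X_pow_add (hdeg a)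
  have hnat : ∀ a, (poly a).natDegree = n + 1 := fun a => natDegree_eq_of_degree_eq_some (by
    simp only [poly]
    rw [degree_add_eq_left_of_degree_lt, degree_X_pow]
    rw [degree_X_pow]; exact hdeg a)
  have hcoeff : ∀ a (i : Fin (n + 1)), (poly a).coeff i = a i := by
    intro a i
    have : ((i : ℕ) = n + 1) = False := by simp; omega
    simp only [poly, coeff_add, coeff_X_pow, finsetSum_coeff, coeff_C_mul, this, if_false, zero_add]
    rw [Finset.sum_eq_single i]
    · simp
    · intro j _ hj
      rw [if_neg (fun h => hj (Fin.ext h.symm)), mul_zero]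
    · simp
  have hloc : ∀ a ∈ normalizedCoeffs F n, ∃ L : IntermediateField ℚ_[p] (PadicAlgCl p),
      FiniteDimensional ℚ_[p] L ∧ ∃ δ : ℝ, 0 < δ ∧
      ∀ f : F[X], f.Monic → f.natDegree = n + 1 →
        (∀ i : Fin (n + 1), ‖(f.coeff i : PadicAlgCl p) - a i‖ < δ) →
        ∀ β, aeval β f = 0 → β ∈ L := by
    rintro a ⟨-, h0, i, hi⟩
    have hne : ∃ i, a i ≠ 0 := ⟨i, fun h => by
      rw [h, norm_zero] at hi
      have : 0 < ‖(p : ℚ_[p])‖ := norm_pos_iff.2 (by exact_mod_cast hp.out.ne_zero)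
      exact absurd hi (not_le.2 (by positivity))⟩
    obtain ⟨α, α', hα, hα', hαα'⟩ :=
      exists_distinct_roots h0 hne (hmon a) (hnat a) (hcoeff a)
    obtain ⟨L, hL, δ, hδ, h⟩ :=
      exists_common_field_near ih F hF (poly a) (hmon a) (hnat a) hα hα' hαα'
    refine ⟨L, hL, δ, hδ, fun f hf hfN hclose => h f hf hfN fun i hi => ?_⟩
    have := hclose ⟨i, hi⟩
    rwa [← hcoeff a] at this
  choose! L hL δ hδ h using hloc
  obtain ⟨t, htS, ht⟩ := (isCompact_normalizedCoeffs F hF n).elim_nhds_subcover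
    (fun a => Metric.ball a (δ a)) fun a ha => Metric.ball_mem_nhds a (hδ a ha)
  have hfd : ∀ a : t, FiniteDimensional ℚ_[p] (L a) := fun a => hL a (htS a a.2)
  refine ⟨⨆ a : t, L a, IntermediateField.finiteDimensional_iSup_of_finite,
    fun f hf hfN hmem β hβ => ?_⟩
  obtain ⟨a, ha, hfa⟩ := Set.mem_iUnion₂.1 (ht hmem)
  refine (le_iSup (fun a : t => L a) ⟨a, ha⟩) (h a (htS a ha) f hf hfN (fun i => ?_) β hβ)
  rw [Metric.mem_ball, dist_pi_lt_iff (hδ a (htS a ha))] at hfa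
  simpa [dist_eq_norm] using hfa i

theorem exists_normalizing_exponent {n : ℕ} (a : ℕ → ℝ) {i₀ : ℕ} (hi₀ : i₀ < n + 1)
    (ha₀ : 0 < a i₀) :
    ∃ k : ℤ, (∀ i < n + 1, a i * ‖(p : ℚ_[p])‖ ^ (k * ((n + 1 - i : ℕ) : ℤ)) ≤ 1) ∧
      ∃ i < n + 1, ‖(p : ℚ_[p])‖ ^ (n + 1 - i : ℕ) ≤
        a i * ‖(p : ℚ_[p])‖ ^ (k * ((n + 1 - i : ℕ) : ℤ)) := by
  set ρ := ‖(p : ℚ_[p])‖ with hρ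
  have hρ0 : 0 < ρ := norm_pos_iff.2 (by exact_mod_cast hp.out.ne_zero)
  have hρ1 : ρ < 1 := Padic.norm_p_lt_one
  have hbound : ∃ N : ℕ, ∀ i < n + 1, a i * ρ ^ N ≤ 1 := by
    have : Filter.Tendsto (fun N : ℕ => (∑ i ∈ Finset.range (n + 1), |a i|) * ρ ^ N)
        Filter.atTop (nhds ((∑ i ∈ Finset.range (n + 1), |a i|) * 0)) :=
      (tendsto_pow_atTop_nhds_zero_of_lt_one hρ0.le hρ1).const_mul _
    rw [mul_zero] at this
    obtain ⟨N, hN⟩ := (this.eventually (gt_mem_nhds one_pos)).exists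
    refine ⟨N, fun i hi => le_trans ?_ hN.le⟩
    refine mul_le_mul_of_nonneg_right ((le_abs_self _).trans ?_) (by positivity)
    exact Finset.single_le_sum (f := fun i => |a i|) (fun _ _ => abs_nonneg _)
      (Finset.mem_range.2 hi)
  obtain ⟨N, hN⟩ := hbound
  obtain ⟨M, hM⟩ : ∃ M : ℕ, ρ ^ M < a i₀ := exists_pow_lt_of_lt_one ha₀ hρ1
  obtain ⟨k, hk, hkmin⟩ := Int.exists_least_of_bdd
    (P := fun k : ℤ => ∀ i < n + 1, a i * ρ ^ (k * ((n + 1 - i : ℕ) : ℤ)) ≤ 1)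
    ⟨-(M : ℤ), fun z hz => by
      by_contra! hlt
      have h1 := hz i₀ hi₀
      have h2 : ρ ^ (-(M : ℤ)) ≤ ρ ^ (z * ((n + 1 - i₀ : ℕ) : ℤ)) := by
        refine zpow_le_zpow_right_of_le_one₀ hρ0 hρ1.le ?_
        have : (1 : ℤ) ≤ ((n + 1 - i₀ : ℕ) : ℤ) := by omega
        nlinarith
      have h3 : 1 < a i₀ * ρ ^ (-(M : ℤ)) := by
        rw [zpow_neg, zpow_natCast, ← div_eq_mul_inv, one_lt_div (by positivity)]
        exact hM
      have := mul_le_mul_of_nonneg_left h2 ha₀.le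
      linarith⟩
    ⟨(N : ℤ), fun i hi => by
      rcases le_or_gt (a i) 0 with h | h
      · exact (mul_nonpos_of_nonpos_of_nonneg h (by positivity)).trans zero_le_one
      refine le_trans (mul_le_mul_of_nonneg_left ?_ h.le) (hN i hi)
      rw [← zpow_natCast]
      refine zpow_le_zpow_right_of_le_one₀ hρ0 hρ1.le ?_
      have : (1 : ℤ) ≤ ((n + 1 - i : ℕ) : ℤ) := by omega
      nlinarith⟩
  refine ⟨k, hk, ?_⟩
  by_contra! hcon
  have := hkmin (k - 1) fun i hi => by
    have h1 := (hcon i hi).le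
    have e : ρ ^ (k * ((n + 1 - i : ℕ) : ℤ)) =
        ρ ^ ((k - 1) * ((n + 1 - i : ℕ) : ℤ)) * ρ ^ (n + 1 - i : ℕ) := by
      rw [← zpow_natCast ρ (n + 1 - i), ← zpow_add₀ hρ0.ne']
      congr 1; ring
    rw [e, ← mul_assoc] at h1
    exact (mul_le_iff_le_one_left (by positivity)).1 h1
  omega

theorem hasCommonSplittingField (n : ℕ) : HasCommonSplittingField p n := by
  induction n with
  | zero =>
    intro F hF
    refine ⟨F, hF, fun f hf hdeg β hβ => ?_⟩
    rw [hf.natDegree_eq_zero.1 (Nat.le_zero.1 hdeg)] at hβ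
    simp at hβ
  | succ n ih =>
    intro F hF
    obtain ⟨L₁, hL₁, h₁⟩ := ih F hF
    obtain ⟨L₂, hL₂, h₂⟩ := exists_common_field_normalized ih F hF
    refine ⟨F ⊔ (L₁ ⊔ L₂), IntermediateField.finiteDimensional_sup _ _, fun f hf hdeg β hβ => ?_⟩
    have hFle : F ≤ F ⊔ (L₁ ⊔ L₂) := le_sup_left
    have hL₁le : L₁ ≤ F ⊔ (L₁ ⊔ L₂) := le_sup_left.trans le_sup_right
    have hL₂le : L₂ ≤ F ⊔ (L₁ ⊔ L₂) := le_sup_right.trans le_sup_right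
    rcases Nat.lt_or_ge n f.natDegree with hlt | hle
    swap; · exact hL₁le (h₁ f hf hle β hβ)
    have hN : f.natDegree = n + 1 := by omega
    -- translate so that the sum of the roots vanishes
    let b : F := -(f.coeff n) / (n + 1 : F)
    let g : F[X] := taylor b f
    have hgN : g.natDegree = n + 1 := by rw [natDegree_taylor, hN]
    have hg : g.Monic := by
      rw [Monic, leadingCoeff_taylor]; exact hf
    have hgn : g.coeff n = 0 := by
      have e : (hasseDeriv n f) = C ((n + 1 : ℕ) : F) * X + C (f.coeff n) := by
        ext j
        rw [hasseDeriv_coeff]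
        rcases j with _ | _ | j
        · simp
        · have : f.coeff (n + 1) = 1 := by rw [← hN]; exact hf
          simp [add_comm 1 n, this]
        · have : f.coeff (j + 1 + 1 + n) = 0 := coeff_eq_zero_of_natDegree_lt (by omega)
          have h1 : (1 : F[X]).coeff (j + 1) = 0 := by simp [coeff_one]
          simp [this, h1]
      have hne : (n + 1 : F) ≠ 0 := by exact_mod_cast Nat.succ_ne_zero n
      simp only [g, taylor_coeff, e, eval_add, eval_mul, eval_C, eval_X, b]
      push_cast
      field_simp
      ring
    have hgβ : aeval (β - b) g = 0 := by
      rw [← hβ]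
      simp only [g, taylor_apply, aeval_comp]
      congr 2
      simp
    have hβ' : β - b ∈ F ⊔ (L₁ ⊔ L₂) → β ∈ F ⊔ (L₁ ⊔ L₂) := fun h => by
      have := add_mem h (hFle b.2)
      simpa using this
    apply hβ'
    by_cases hall : ∀ i < n + 1, g.coeff i = 0
    · have e : g = X ^ (n + 1) := by
        rw [hg.as_sum, hgN]
        rw [Finset.sum_eq_zero fun i hi => by
            rw [hall i (Finset.mem_range.1 hi), map_zero, zero_mul],
          add_zero]
      rw [e, map_pow, aeval_X] at hgβ
      rw [eq_zero_of_pow_eq_zero hgβ]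
      exact zero_mem _
    · push Not at hall
      obtain ⟨i₀, hi₀, hgi₀⟩ := hall
      have hex : ∃ k : ℤ, (∀ i < n + 1, ‖((g.coeff i : F) : PadicAlgCl p)‖ *
          ‖(p : ℚ_[p])‖ ^ (k * ((n + 1 - i : ℕ) : ℤ)) ≤ 1) ∧ ∃ i < n + 1, 
          ‖(p : ℚ_[p])‖ ^ (n + 1 - i : ℕ) ≤ ‖((g.coeff i : F) : PadicAlgCl p)‖ *
          ‖(p : ℚ_[p])‖ ^ (k * ((n + 1 - i : ℕ) : ℤ)) := 
        exists_normalizing_exponent (fun i => ‖((g.coeff i : F) : PadicAlgCl p)‖) hi₀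
          (norm_pos_iff.2 (by simpa using hgi₀))
      obtain ⟨k, hk1, hk2⟩ := hex
      let s : F := (p : F) ^ k
      have hp0 : (p : PadicAlgCl p) ≠ 0 := by exact_mod_cast hp.out.ne_zero
      have hsp : (s : PadicAlgCl p) = (p : PadicAlgCl p) ^ k := by
        have : ((p : F) : PadicAlgCl p) = p := map_natCast (algebraMap F (PadicAlgCl p)) p
        rw [← this]
        exact map_zpow₀ (algebraMap F (PadicAlgCl p)) (p : F) k
      have hs0 : (s : PadicAlgCl p) ≠ 0 := by
        rw [hsp]; exact zpow_ne_zero _ hp0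
      have hsn : ∀ m : ℕ, ‖(s : PadicAlgCl p) ^ m‖ = ‖(p : ℚ_[p])‖ ^ (k * (m : ℤ)) := by
        intro m
        have : ‖(p : PadicAlgCl p)‖ = ‖(p : ℚ_[p])‖ := by
          rw [← PadicAlgCl.norm_extends]; simp
        rw [hsp, norm_pow, norm_zpow, this, zpow_mul, zpow_natCast]
      have hnorm : ∀ i, ‖(((g.scaleRoots s).coeff i : F) : PadicAlgCl p)‖ =
          ‖((g.coeff i : F) : PadicAlgCl p)‖ * ‖(p : ℚ_[p])‖ ^ (k * ((n + 1 - i : ℕ) : ℤ)) := by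
        intro i
        rw [coeff_scaleRoots, hgN, ← hsn]
        simp
      have hroot : aeval ((s : PadicAlgCl p) * (β - b)) (g.scaleRoots s) = 0 := by
        have := scaleRoots_aeval_eq_zero (r := s) hgβ
        exact this
      have := h₂ (g.scaleRoots s) ((monic_scaleRoots_iff s).2 hg)
        (by rw [natDegree_scaleRoots, hgN]) ?_ _ hroot
      · have h3 := mul_mem (inv_mem (hFle s.2)) (hL₂le this)
        rwa [inv_mul_cancel_left₀ hs0] at h3
      · refine ⟨fun i => ⟨SetLike.coe_mem _, ?_⟩, ?_, ?_⟩
        · rw [hnorm]; exact hk1 i i.2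
        · simp [coeff_scaleRoots, hgn]
        · obtain ⟨i, hi, h⟩ := hk2
          refine ⟨⟨i, hi⟩, ?_⟩
          rw [hnorm]; exact h

end RootIntegrals

section AdMatrix
open Matrix
open scoped Kronecker
variable {R S m : Type*} [CommRing R] [CommRing S] [DecidableEq m]

/-- The matrix of `X ↦ M * X - X * M` in the standard basis. -/
def adMatrix (M : Matrix m m R) : Matrix (m × m) (m × m) R := M ⊗ₖ 1 - 1 ⊗ₖ Mᵀ

theorem adMatrix_map (f : R →+* S) (M : Matrix m m R) :
    (adMatrix M).map f = adMatrix (M.map f) := by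
  ext ⟨i, j⟩ ⟨k, l⟩
  simp [adMatrix, Matrix.kroneckerMap_apply, Matrix.one_apply, apply_ite f]

theorem adMatrix_smul (t : R) (M : Matrix m m R) : adMatrix (t • M) = t • adMatrix M := by
  ext ⟨i, j⟩ ⟨k, l⟩
  simp [adMatrix, Matrix.kroneckerMap_apply]
  ring

variable [Fintype m]

theorem charpoly_mulLeft_sub_mulRight (M : Matrix m m R) :
    LinearMap.charpoly (LinearMap.mulLeft R M - LinearMap.mulRight R M) =
      (adMatrix M).charpoly := by
  rw [← LinearMap.charpoly_toMatrix _ (Matrix.stdBasis R m m)]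
  congr 1
  ext ⟨i, j⟩ ⟨k, l⟩
  rw [LinearMap.toMatrix_apply, Matrix.stdBasis_eq_single]
  have : ∀ N : Matrix m m R, (Matrix.stdBasis R m m).repr N (i, j) = N i j := fun N => rfl
  rw [this]
  simp only [LinearMap.sub_apply, LinearMap.mulLeft_apply, LinearMap.mulRight_apply, adMatrix,
    Matrix.sub_apply, Matrix.kroneckerMap_apply, Matrix.transpose_apply, Matrix.one_apply,
    Matrix.mul_apply, Matrix.single_apply]
  congr 1
  · by_cases h : j = l
    · subst h; simp
    · simp [h, Ne.symm h]
  · by_cases h : i = k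
    · subst h; simp
    · simp [h, Ne.symm h]

theorem charpoly_eq_of_mul_eq {M N P : Matrix m m R} (hP : IsUnit P.det) (h : M * P = P * N) :
    M.charpoly = N.charpoly := by
  obtain ⟨u, rfl⟩ := (Matrix.isUnit_iff_isUnit_det P).2 hP
  rw [← Matrix.charpoly_units_conj u N, ← h, Matrix.mul_assoc]
  simp

theorem charpoly_adMatrix_eq_of_mul_eq {M N P : Matrix m m R} (hP : IsUnit P.det)
    (h : M * P = P * N) : (adMatrix M).charpoly = (adMatrix N).charpoly := by
  have hPP : P * P⁻¹ = 1 := Matrix.mul_nonsing_inv P hP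
  have hPP' : P⁻¹ * P = 1 := Matrix.nonsing_inv_mul P hP
  have h2 : P⁻¹ * M = N * P⁻¹ := by
    calc P⁻¹ * M = P⁻¹ * (M * P) * P⁻¹ := by
          rw [Matrix.mul_assoc, Matrix.mul_assoc, hPP, Matrix.mul_one]
      _ = N * P⁻¹ := by rw [h, ← Matrix.mul_assoc, hPP', Matrix.one_mul]
  have hu : IsUnit (P ⊗ₖ (P⁻¹)ᵀ).det := by
    rw [Matrix.det_kronecker, Matrix.det_transpose]
    refine (hP.pow _).mul (IsUnit.pow _ ?_)
    rw [Matrix.isUnit_nonsing_inv_det_iff]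
    exact hP
  refine charpoly_eq_of_mul_eq hu ?_
  rw [adMatrix, adMatrix, Matrix.sub_mul, Matrix.mul_sub, ← Matrix.mul_kronecker_mul,
    ← Matrix.mul_kronecker_mul, ← Matrix.mul_kronecker_mul, ← Matrix.mul_kronecker_mul, h,
    ← Matrix.transpose_mul, ← Matrix.transpose_mul, h2]
  simp

theorem charpoly_adMatrix_diagonal (d : m → R) :
    (adMatrix (diagonal d)).charpoly = ∏ x : m × m, (X - C (d x.1 - d x.2)) := by
  have : adMatrix (diagonal d) = diagonal fun x : m × m => d x.1 - d x.2 := by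
    rw [adMatrix, Matrix.diagonal_transpose]
    nth_rewrite 1 [← Matrix.diagonal_one]
    nth_rewrite 1 [← Matrix.diagonal_one]
    rw [Matrix.diagonal_kronecker_diagonal, Matrix.diagonal_kronecker_diagonal,
      Matrix.diagonal_sub]
    simp
  rw [this, Matrix.charpoly_diagonal]

theorem coeff_charpoly_smul (M : Matrix m m R) (t : R) (k : ℕ) :
    t ^ k * (t • M).charpoly.coeff k = t ^ Fintype.card m * M.charpoly.coeff k := by
  have h : (t • M).charpoly.comp (C t * X) = C (t ^ Fintype.card m) * M.charpoly := by
    rw [Matrix.charpoly, Matrix.charpoly, ← coe_compRingHom_apply, RingHom.map_det, C_pow,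
      ← Matrix.det_smul]
    congr 1
    ext1 i j
    by_cases hij : i = j
    · subst hij
      simp [Matrix.charmatrix_apply_eq, mul_sub]
    · simp [Matrix.charmatrix_apply_ne _ _ _ hij]
  have := congrArg (fun q => q.coeff k) h
  simp only [coeff_C_mul] at this
  rw [← this, comp_C_mul_X_coeff, mul_comm]

/-- The coefficient of `T ^ (2 * n)` in the characteristic polynomial of `ad (ι (A, B))`. -/
def blockDisc {n : ℕ} (A B : Matrix (Fin n) (Fin n) R) : R :=
  (adMatrix (Matrix.fromBlocks 0 A B 0)).charpoly.coeff (2 * n)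

variable {n : ℕ}

theorem map_blockDisc (f : R →+* S) (A B : Matrix (Fin n) (Fin n) R) :
    f (blockDisc A B) = blockDisc (A.map f) (B.map f) := by
  rw [blockDisc, ← coeff_map, ← Matrix.charpoly_map, adMatrix_map, blockDisc, Matrix.fromBlocks_map]
  simp

theorem blockDisc_conj {g h : Matrix (Fin n) (Fin n) R} (hg : IsUnit g.det) (hh : IsUnit h.det)
    (A B : Matrix (Fin n) (Fin n) R) :
    blockDisc (g⁻¹ * A * h) (h⁻¹ * B * g) = blockDisc A B := by
  rw [blockDisc, blockDisc]
  congr 1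
  symm
  refine charpoly_adMatrix_eq_of_mul_eq (P := Matrix.fromBlocks g 0 0 h) ?_ ?_
  · rw [Matrix.det_fromBlocks_zero₂₁]; exact hg.mul hh
  · rw [Matrix.fromBlocks_multiply, Matrix.fromBlocks_multiply]
    simp [← Matrix.mul_assoc, Matrix.mul_nonsing_inv _ hg, Matrix.mul_nonsing_inv _ hh]

theorem blockDisc_smul (t : R) (A B : Matrix (Fin n) (Fin n) R) :
    t ^ (2 * n) * blockDisc (t • A) (t • B) = t ^ ((2 * n) * (2 * n)) * blockDisc A B := by
  have : Matrix.fromBlocks 0 (t • A) (t • B) 0 = t • Matrix.fromBlocks 0 A B 0 := by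
    rw [Matrix.fromBlocks_smul]; simp
  rw [blockDisc, this, adMatrix_smul, coeff_charpoly_smul, blockDisc]
  congr 2
  simp [two_mul]

end AdMatrix

section Companion
open Matrix
variable {R S : Type*} [CommRing R] [CommRing S] {n : ℕ}

/-- The companion matrix acting on columns by `(C v)ᵢ = vᵢ₊₁` except for the last row. -/
def companion (c : Fin n → R) : Matrix (Fin n) (Fin n) R :=
  Matrix.of fun i j => if (i : ℕ) + 1 = n then -c j else if (j : ℕ) = i + 1 then 1 else 0

/-- The monic polynomial with lower coefficients `c`. -/
def monicPoly (c : Fin n → R) : R[X] := X ^ n + ∑ i : Fin n, C (c i) * X ^ (i : ℕ)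

theorem map_companion (f : R →+* S) (c : Fin n → R) :
    (companion c).map f = companion fun i => f (c i) := by
  ext i j
  simp only [companion, Matrix.map_apply, Matrix.of_apply]
  split_ifs <;> simp

theorem companion_mulVec (c : Fin n → R) (v : Fin n → R) (i : Fin n) :
    (companion c *ᵥ v) i = if h : (i : ℕ) + 1 < n then v ⟨i + 1, h⟩ else - ∑ j, c j * v j := by
  simp only [Matrix.mulVec, dotProduct, companion, Matrix.of_apply]
  split_ifs with h1 h2 h2
  · omega
  · simp
  · rw [Finset.sum_eq_single ⟨i + 1, h2⟩]
    · simp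
    · intro b _ hb
      rw [if_neg (fun h => hb (Fin.ext h)), zero_mul]
    · simp
  · omega

theorem companion_mulVec_pow (c : Fin n → R) {t : R} (ht : (monicPoly c).eval t = 0) :
    (companion c *ᵥ fun i => t ^ (i : ℕ)) = t • fun i : Fin n => t ^ (i : ℕ) := by
  ext i
  rw [companion_mulVec]
  simp only [Pi.smul_apply, smul_eq_mul]
  split_ifs with h
  · simp [pow_succ']
  · have hi : (i : ℕ) + 1 = n := by omega
    rw [← pow_succ', hi]
    simp only [monicPoly, eval_add, eval_pow, eval_X, eval_finsetSum, eval_mul, eval_C] at ht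
    linear_combination -ht

theorem companion_mul_vandermonde (c : Fin n → R) {l : Fin n → R}
    (hl : ∀ i, (monicPoly c).eval (l i) = 0) :
    companion c * (vandermonde l)ᵀ = (vandermonde l)ᵀ * diagonal l := by
  ext i j
  have := congrFun (companion_mulVec_pow c (hl j)) i
  rw [Matrix.mul_diagonal]
  simp only [Pi.smul_apply, smul_eq_mul] at this
  rw [Matrix.transpose_apply, vandermonde_apply, mul_comm, ← this]
  rfl

theorem coeff_charpoly_adMatrix_diagonal {m : Type*} [Fintype m] [DecidableEq m] (d : m → R) :
    (adMatrix (diagonal d)).charpoly.coeff (Fintype.card m) =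
      ∏ a, ∏ b ∈ Finset.univ.erase a, (d b - d a) := by
  have h : (adMatrix (diagonal d)).charpoly =
      (∏ a, ∏ b ∈ Finset.univ.erase a, (X - C (d a - d b))) * X ^ Fintype.card m := by
    rw [charpoly_adMatrix_diagonal, Fintype.prod_prod_type]
    have : ∀ a, ∏ b, (X - C (d a - d b)) =
        (∏ b ∈ Finset.univ.erase a, (X - C (d a - d b))) * X := fun a => by
      rw [← Finset.prod_erase_mul _ _ (Finset.mem_univ a)]; simp
    simp only [this, Finset.prod_mul_distrib, Finset.prod_const, Finset.card_univ]
  rw [h, coeff_mul_X_pow', if_pos le_rfl, Nat.sub_self, coeff_zero_eq_eval_zero]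
  simp [eval_prod]

theorem blockDisc_companion {K : Type*} [Field K] (h2 : (2 : K) ≠ 0) (c : Fin n → K)
    {y : Fin n → K} (hy0 : ∀ i, y i ≠ 0) (hyi : Function.Injective fun i => y i ^ 2)
    (hc : ∀ i, (monicPoly c).eval (y i ^ 2) = 0) :
    blockDisc 1 (companion c) = (∏ i, -(4 * y i ^ 2)) *
      (∏ i, ∏ j ∈ Finset.univ.erase i, (y i ^ 2 - y j ^ 2)) ^ 2 := by
  set V := (vandermonde fun i => y i ^ 2)ᵀ with hV
  have hVC : companion c * V = V * diagonal fun i => y i ^ 2 := companion_mul_vandermonde c hc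
  have hVdet : V.det ≠ 0 := by
    rw [hV, Matrix.det_transpose]; exact det_vandermonde_ne_zero_iff.2 hyi
  let P : Matrix (Fin n ⊕ Fin n) (Fin n ⊕ Fin n) K :=
    fromBlocks V 0 0 V * fromBlocks 1 1 (diagonal y) (-diagonal y)
  have hP : IsUnit P.det := by
    rw [isUnit_iff_ne_zero, Matrix.det_mul, Matrix.det_fromBlocks_zero₂₁,
      Matrix.det_fromBlocks_one₁₁]
    refine mul_ne_zero (mul_ne_zero hVdet hVdet) ?_
    rw [Matrix.mul_one, Matrix.diagonal_neg, Matrix.diagonal_sub, Matrix.det_diagonal,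
      Finset.prod_ne_zero_iff]
    intro i _
    have : -y i - y i = -(2 * y i) := by ring
    simp only [this]
    exact neg_ne_zero.2 (mul_ne_zero h2 (hy0 i))
  have key : fromBlocks 0 1 (companion c) 0 * P = P * diagonal (Sum.elim y (-y)) := by
    have e : (diagonal (Sum.elim y (-y)) : Matrix (Fin n ⊕ Fin n) (Fin n ⊕ Fin n) K) =
      fromBlocks (diagonal y) 0 0 (-diagonal y) := by
      rw [← Matrix.fromBlocks_diagonal, Matrix.diagonal_neg]; rfl
    have e2 : (diagonal fun i => y i ^ 2) = diagonal y * diagonal y := by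
      rw [Matrix.diagonal_mul_diagonal]; simp only [sq]
    simp only [P, e, Matrix.fromBlocks_multiply, Matrix.mul_zero, Matrix.zero_mul, add_zero,
      zero_add, Matrix.one_mul, Matrix.mul_one, hVC, e2, Matrix.mul_neg, Matrix.neg_mul, neg_neg,
      neg_zero]
    simp only [Matrix.mul_assoc]
  rw [blockDisc, charpoly_adMatrix_eq_of_mul_eq hP key]
  have hcard : 2 * n = Fintype.card (Fin n ⊕ Fin n) := by simp [two_mul]
  rw [hcard, coeff_charpoly_adMatrix_diagonal, Fintype.prod_sum_type, ← Finset.prod_pow,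
    ← Finset.prod_mul_distrib, ← Finset.prod_mul_distrib]
  refine Finset.prod_congr rfl fun i _ => ?_
  have e1 : (Finset.univ.erase (Sum.inl i) : Finset (Fin n ⊕ Fin n)) =
      (Finset.univ.erase i).disjSum Finset.univ := by
    ext x; cases x <;> simp
  have e2 : (Finset.univ.erase (Sum.inr i) : Finset (Fin n ⊕ Fin n)) =
      Finset.univ.disjSum (Finset.univ.erase i) := by
    ext x; cases x <;> simp
  rw [e1, e2, Finset.prod_disjSum, Finset.prod_disjSum]
  simp only [Sum.elim_inl, Sum.elim_inr, Pi.neg_apply]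
  rw [← Finset.mul_prod_erase _ (fun j => -y j - y i) (Finset.mem_univ i),
    ← Finset.mul_prod_erase _ (fun j => y j - -y i) (Finset.mem_univ i)]
  have h1 : ∏ j ∈ Finset.univ.erase i, (y i ^ 2 - y j ^ 2) =
      (∏ j ∈ Finset.univ.erase i, (y j - y i)) * ∏ j ∈ Finset.univ.erase i, (-y j - y i) := by
    rw [← Finset.prod_mul_distrib]
    exact Finset.prod_congr rfl fun j _ => by ring
  have h1' : ∏ j ∈ Finset.univ.erase i, (y i ^ 2 - y j ^ 2) =
      (∏ j ∈ Finset.univ.erase i, (y j - -y i)) * ∏ j ∈ Finset.univ.erase i, (-y j - -y i) := by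
    rw [← Finset.prod_mul_distrib]
    exact Finset.prod_congr rfl fun j _ => by ring
  rw [sq (∏ j ∈ Finset.univ.erase i, (y i ^ 2 - y j ^ 2))]
  nth_rewrite 1 [h1]
  rw [h1']
  ring

theorem monicPoly_degree (c : Fin n → R) :
    (∑ i : Fin n, C (c i) * X ^ (i : ℕ)).degree < (n : WithBot ℕ) := degree_sum_fin_lt c

theorem monic_monicPoly (c : Fin n → R) : (monicPoly c).Monic :=
  monic_X_pow_add (monicPoly_degree c)

theorem natDegree_monicPoly [Nontrivial R] (c : Fin n → R) : (monicPoly c).natDegree = n := by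
  refine natDegree_eq_of_degree_eq_some ?_
  rw [monicPoly, degree_add_eq_left_of_degree_lt, degree_X_pow]
  rw [degree_X_pow]; exact monicPoly_degree c

theorem coeff_monicPoly (c : Fin n → R) (i : Fin n) : (monicPoly c).coeff i = c i := by
  have : ((i : ℕ) = n) = False := by simp; omega
  simp only [monicPoly, coeff_add, coeff_X_pow, finsetSum_coeff, coeff_C_mul, this, if_false,
    zero_add]
  rw [Finset.sum_eq_single i]
  · simp
  · intro j _ hj
    rw [if_neg (fun h => hj (Fin.ext h.symm)), mul_zero]
  · simp

theorem monicPoly_coeff [Nontrivial R] {f : R[X]} (hf : f.Monic) (hn : f.natDegree = n) :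
    monicPoly (fun i : Fin n => f.coeff i) = f := by
  ext k
  rcases lt_trichotomy k n with h | h | h
  · exact coeff_monicPoly _ ⟨k, h⟩
  · subst h
    have h1 := (monic_monicPoly fun i : Fin k => f.coeff i).coeff_natDegree
    rw [natDegree_monicPoly] at h1
    rw [h1, ← hn, hf.coeff_natDegree]
  · rw [coeff_eq_zero_of_natDegree_lt (by rw [natDegree_monicPoly]; exact h),
      coeff_eq_zero_of_natDegree_lt (by rw [hn]; exact h)]

theorem map_monicPoly (f : R →+* S) (c : Fin n → R) :
    (monicPoly c).map f = monicPoly fun i => f (c i) := by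
  simp [monicPoly, Polynomial.map_sum]

theorem aeval_companion_mul_vandermonde (c : Fin n → R) {l : Fin n → R}
    (hl : ∀ i, (monicPoly c).eval (l i) = 0) (q : R[X]) :
    aeval (companion c) q * (vandermonde l)ᵀ =
      (vandermonde l)ᵀ * diagonal fun i => q.eval (l i) := by
  have h := companion_mul_vandermonde c hl
  induction q using Polynomial.induction_on' with
  | add a b ha hb =>
    rw [map_add, Matrix.add_mul, ha, hb, ← Matrix.mul_add, Matrix.diagonal_add]
    simp
  | monomial k a =>
    have hk : companion c ^ k * (vandermonde l)ᵀ = (vandermonde l)ᵀ * diagonal l ^ k := by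
      induction k with
      | zero => simp
      | succ k ih =>
        rw [pow_succ, Matrix.mul_assoc, h, ← Matrix.mul_assoc, ih, Matrix.mul_assoc, pow_succ]
    rw [aeval_monomial, Matrix.mul_assoc, hk, Matrix.diagonal_pow, Algebra.algebraMap_eq_smul_one,
      Matrix.smul_mul, Matrix.one_mul, ← Matrix.mul_smul, ← Matrix.diagonal_smul]
    congr 2
    ext i
    simp [eval_monomial]

end Companion

section Twist
open Matrix
variable {R S : Type*} [CommRing R] [CommRing S] {n : ℕ}

/-- The polynomial `∑ xᵢ Xⁱ`. -/
def lowPoly (x : Fin n → R) : R[X] := ∑ i : Fin n, C (x i) * X ^ (i : ℕ)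

theorem eval_lowPoly (x : Fin n → R) (t : R) : (lowPoly x).eval t = ∑ i, x i * t ^ (i : ℕ) := by
  simp [lowPoly, eval_finsetSum]

theorem aeval_lowPoly {A : Type*} [Ring A] [Algebra R A] (x : Fin n → R) (a : A) :
    aeval a (lowPoly x) = ∑ i : Fin n, x i • a ^ (i : ℕ) := by
  simp [lowPoly, Algebra.algebraMap_eq_smul_one]

/-- The matrix `C q(C)²`, where `C` is the companion matrix of `c` and `q` has coefficients `x`. -/
def twist (c x : Fin n → R) : Matrix (Fin n) (Fin n) R :=
  companion c * aeval (companion c) (lowPoly x) ^ 2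

theorem map_twist (f : R →+* S) (c x : Fin n → R) :
    (twist c x).map f = twist (fun i => f (c i)) fun i => f (x i) := by
  rw [twist, twist, aeval_lowPoly, aeval_lowPoly, ← RingHom.mapMatrix_apply, map_mul, map_pow,
    map_sum,
    RingHom.mapMatrix_apply, map_companion]
  congr 2
  refine Finset.sum_congr rfl fun i _ => ?_
  rw [← map_companion, ← RingHom.mapMatrix_apply, ← map_pow]
  ext a b
  simp

theorem charpoly_twist (c x : Fin n → R) {l : Fin n → R}
    (hl : ∀ i, (monicPoly c).eval (l i) = 0) (hV : IsUnit (vandermonde l).det) :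
    (twist c x).charpoly = ∏ i, (X - C (l i * (lowPoly x).eval (l i) ^ 2)) := by
  rw [← Matrix.charpoly_diagonal]
  refine charpoly_eq_of_mul_eq (P := (vandermonde l)ᵀ) (by rwa [Matrix.det_transpose]) ?_
  rw [twist, sq, Matrix.mul_assoc, Matrix.mul_assoc, aeval_companion_mul_vandermonde c hl,
    ← Matrix.mul_assoc (aeval _ _), aeval_companion_mul_vandermonde c hl, ← Matrix.mul_assoc,
    ← Matrix.mul_assoc, companion_mul_vandermonde c hl, Matrix.mul_assoc, Matrix.mul_assoc,
    Matrix.diagonal_mul_diagonal, Matrix.diagonal_mul_diagonal]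
  simp only [sq]

/-- The lower coefficients of the characteristic polynomial of `twist c x`. -/
def twistCoeff (c x : Fin n → R) (k : Fin n) : R := (twist c x).charpoly.coeff k

theorem map_twistCoeff (f : R →+* S) (c x : Fin n → R) (k : Fin n) :
    f (twistCoeff c x k) = twistCoeff (fun i => f (c i)) (fun i => f (x i)) k := by
  rw [twistCoeff, ← coeff_map, ← Matrix.charpoly_map, map_twist, twistCoeff]

theorem monicPoly_twistCoeff [Nontrivial R] (c x : Fin n → R) :
    monicPoly (twistCoeff c x) = (twist c x).charpoly :=
  monicPoly_coeff (Matrix.charpoly_monic _) (by simp [Matrix.charpoly_natDegree_eq_dim])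

/-- `twistCoeff c x` as a polynomial in `x`. -/
def twistPoly (c : Fin n → R) (k : Fin n) : MvPolynomial (Fin n) R :=
  twistCoeff (fun i => MvPolynomial.C (c i)) MvPolynomial.X k

theorem eval_twistPoly (c x : Fin n → R) (k : Fin n) :
    MvPolynomial.eval x (twistPoly c k) = twistCoeff c x k := by
  rw [twistPoly, map_twistCoeff]
  simp

theorem map_twistPoly (f : R →+* S) (c : Fin n → R) (k : Fin n) :
    MvPolynomial.map f (twistPoly c k) = twistPoly (fun i => f (c i)) k := by
  rw [twistPoly, map_twistCoeff, twistPoly]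
  simp

/-- The Jacobian matrix of a polynomial map. -/
def jacobian {ι : Type*} (Φ : ι → MvPolynomial ι R) (x : ι → R) : Matrix ι ι R :=
  Matrix.of fun k a => MvPolynomial.eval x (MvPolynomial.pderiv a (Φ k))

theorem map_jacobian {ι : Type*} (f : R →+* S) (Φ : ι → MvPolynomial ι R) (x : ι → R) :
    (jacobian Φ x).map f = jacobian (fun k => MvPolynomial.map f (Φ k)) fun i => f (x i) := by
  ext k a
  simp only [jacobian, Matrix.map_apply, Matrix.of_apply]
  rw [MvPolynomial.pderiv_map, MvPolynomial.eval_map, MvPolynomial.eval₂_comp]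
  rfl

theorem vandermonde_mul_jacobian_twistPoly {K : Type*} [Field K] (c x : Fin n → K) {l : Fin n → K}
    (hl : ∀ i, (monicPoly c).eval (l i) = 0) (hli : Function.Injective l) {μ : Fin n → K}
    (hμ : ∀ i, μ i = l i * (lowPoly x).eval (l i) ^ 2) :
    vandermonde μ * jacobian (twistPoly c) x =
      diagonal (fun i => -(2 * (l i * (lowPoly x).eval (l i)) *
        ∏ j ∈ Finset.univ.erase i, (μ i - μ j))) * vandermonde l := by
  ext i a
  let M : Fin n → MvPolynomial (Fin n) K := fun j =>
    MvPolynomial.C (l j) * (lowPoly MvPolynomial.X).eval (MvPolynomial.C (l j)) ^ 2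
  have hM : ∀ j, MvPolynomial.eval x (M j) = μ j := by
    intro j
    simp [M, hμ, eval_lowPoly]
  have h1 : monicPoly (twistPoly c) = ∏ j, (X - C (M j)) := by
    have : twistPoly c = twistCoeff (fun i => MvPolynomial.C (c i)) MvPolynomial.X := rfl
    rw [this, monicPoly_twistCoeff, charpoly_twist (l := fun i => MvPolynomial.C (l i))]
    · intro i
      have := congrArg (MvPolynomial.C (σ := Fin n)) (hl i)
      rw [map_zero, ← eval_map_apply, map_monicPoly] at this
      exact this
    · have : (vandermonde fun i => MvPolynomial.C (σ := Fin n) (l i)) =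
        MvPolynomial.C.mapMatrix (vandermonde l) := by
        ext i j; simp [vandermonde_apply]
      rw [this, ← RingHom.map_det]
      exact (isUnit_iff_ne_zero.2 (det_vandermonde_ne_zero_iff.2 hli)).map _
  have h2 := congrArg (fun f => MvPolynomial.eval x
    (MvPolynomial.pderiv a (f.eval (MvPolynomial.C (μ i))))) h1
  simp only [eval_prod, eval_sub, eval_X, eval_C] at h2
  rw [← Finset.mul_prod_erase _ _ (Finset.mem_univ i), Derivation.leibniz] at h2
  simp only [monicPoly, eval_add, eval_pow, eval_X, eval_finsetSum, eval_mul, eval_C, map_add,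
    map_sub, hM, smul_eq_mul, map_mul, map_sum, Derivation.leibniz,
    MvPolynomial.eval_C, sub_self, zero_mul, zero_add, map_prod, MvPolynomial.pderiv_C,
    zero_sub, map_neg, ← MvPolynomial.C_pow, mul_zero] at h2
  have h3 : MvPolynomial.eval x (MvPolynomial.pderiv a (M i)) =
      2 * (l i * (lowPoly x).eval (l i)) * l i ^ (a : ℕ) := by
    have h4 : ∀ b : Fin n, MvPolynomial.eval x (MvPolynomial.pderiv a
        (MvPolynomial.X b * MvPolynomial.C (l i) ^ (b : ℕ))) =
        if b = a then l i ^ (b : ℕ) else 0 := by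
      intro b
      rw [← MvPolynomial.C_pow, Derivation.leibniz, MvPolynomial.pderiv_C, MvPolynomial.pderiv_X]
      by_cases hb : b = a
      · subst hb; simp
      · simp [hb]
    have h5 : MvPolynomial.eval x (MvPolynomial.pderiv a
        ((lowPoly MvPolynomial.X).eval (MvPolynomial.C (l i)))) = l i ^ (a : ℕ) := by
      rw [eval_lowPoly, map_sum, map_sum]
      simp only [h4, Finset.sum_ite_eq', Finset.mem_univ, if_true]
    have h6 : MvPolynomial.eval x ((lowPoly MvPolynomial.X).eval (MvPolynomial.C (l i))) =
        (lowPoly x).eval (l i) := by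
      simp [eval_lowPoly]
    simp only [M, sq, Derivation.leibniz, map_add, map_mul, smul_eq_mul,
      MvPolynomial.pderiv_C, mul_zero, add_zero, h5, h6, MvPolynomial.eval_C]
    ring
  rw [h3] at h2
  rw [Matrix.diagonal_mul, vandermonde_apply, Matrix.mul_apply]
  simp only [vandermonde_apply, jacobian, Matrix.of_apply]
  rw [h2]
  ring

end Twist

section ChangeOfVariablesPolynomial

theorem hasFDerivAt_mvPolynomial {ι : Type*} [Fintype ι] (f : MvPolynomial ι ℚ_[p])
    (x : ι → ℚ_[p]) :
    HasFDerivAt (fun y : ι → ℚ_[p] => MvPolynomial.eval y f)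
      (∑ i, MvPolynomial.eval x (MvPolynomial.pderiv i f) •
        (ContinuousLinearMap.proj i : (ι → ℚ_[p]) →L[ℚ_[p]] ℚ_[p])) x := by
  classical
  induction f using MvPolynomial.induction_on with
  | C a =>
    have e : (fun y : ι → ℚ_[p] => MvPolynomial.eval y (MvPolynomial.C a)) = fun _ => a := by
      ext; simp
    rw [e]
    refine (hasFDerivAt_const (𝕜 := ℚ_[p]) a x).congr_fderiv ?_
    ext v
    simp
  | add f g hf hg =>
    have e : (fun y : ι → ℚ_[p] => MvPolynomial.eval y (f + g)) =
        fun y => MvPolynomial.eval y f + MvPolynomial.eval y g := by ext; simp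
    rw [e]
    refine (hf.add hg).congr_fderiv ?_
    ext v
    simp [add_mul, Finset.sum_add_distrib]
  | mul_X f i hf =>
    have hX : HasFDerivAt (fun y : ι → ℚ_[p] => y i)
      (ContinuousLinearMap.proj i : (ι → ℚ_[p]) →L[ℚ_[p]] ℚ_[p]) x := hasFDerivAt_apply i x
    have e : (fun y : ι → ℚ_[p] => MvPolynomial.eval y (f * MvPolynomial.X i)) =
        fun y => MvPolynomial.eval y f * y i := by ext; simp
    rw [e]
    refine (hf.mul hX).congr_fderiv ?_
    ext v
    have h1 : ∀ b, MvPolynomial.eval x (Pi.single (M := fun _ => MvPolynomial ι ℚ_[p]) b 1 i) =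
        if b = i then 1 else 0 := by
      intro b
      by_cases h : b = i
      · subst h; simp
      · simp [h, Ne.symm h]
    simp [Derivation.leibniz, h1, add_mul, Finset.sum_add_distrib, Finset.mul_sum, mul_assoc]

theorem hasFDerivAt_polynomialMap {ι : Type*} [Fintype ι] [DecidableEq ι]
    (Φ : ι → MvPolynomial ι ℚ_[p]) (x : ι → ℚ_[p]) :
    HasFDerivAt (fun (y : ι → ℚ_[p]) k => MvPolynomial.eval y (Φ k))
      (LinearMap.toContinuousLinearMap (Matrix.mulVecLin (jacobian Φ x))) x := by
  rw [hasFDerivAt_pi']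
  intro k
  refine (hasFDerivAt_mvPolynomial (Φ k) x).congr_fderiv ?_
  ext v
  simp [jacobian, Matrix.mulVec, dotProduct]

theorem volume_image_closedBall_le {n : ℕ} (Φ : Fin n → MvPolynomial (Fin n) ℚ_[p])
    (x : Fin n → ℚ_[p]) (hx : (jacobian Φ x).det ≠ 0) :
    ∃ r₀ : ℝ, 0 < r₀ ∧ ∀ r, 0 < r → r ≤ r₀ →
      volume ((fun (y : Fin n → ℚ_[p]) k => MvPolynomial.eval y (Φ k)) '' Metric.closedBall x r) ≤
        ‖(jacobian Φ x).det‖ₑ * volume (Metric.closedBall x r) := by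
  set J := jacobian Φ x with hJ
  set F : (Fin n → ℚ_[p]) → Fin n → ℚ_[p] := fun y k => MvPolynomial.eval y (Φ k) with hF
  have hJJ : J⁻¹ * J = 1 := Matrix.nonsing_inv_mul J (isUnit_iff_ne_zero.2 hx)
  have hJdet : J⁻¹.det * J.det = 1 := by rw [← Matrix.det_mul, hJJ, Matrix.det_one]
  let T : (Fin n → ℚ_[p]) →L[ℚ_[p]] (Fin n → ℚ_[p]) :=
    LinearMap.toContinuousLinearMap (Matrix.mulVecLin J⁻¹)
  have hT : ∀ v, T v = J⁻¹.mulVec v := fun v => rfl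
  have hd := hasFDerivAt_polynomialMap Φ x
  have ho := (hasFDerivAt_iff_isLittleO.1 hd).bound (c := (‖T‖ + 1)⁻¹) (by positivity)
  obtain ⟨r₁, hr₁, hball⟩ := Metric.eventually_nhds_iff.1 ho
  refine ⟨r₁ / 2, by positivity, fun r hr hrr => ?_⟩
  have hsub : F '' Metric.closedBall x r ⊆
      (fun z => z - F x) ⁻¹' ((fun v => J⁻¹.mulVec v) ⁻¹' Metric.closedBall 0 r) := by
    rintro _ ⟨y, hy, rfl⟩
    rw [Metric.mem_closedBall] at hy
    have h1 := hball (y := y) (by linarith)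
    simp only [Set.mem_preimage, mem_closedBall_zero_iff]
    rw [← hT]
    have e : T (F y - F x) = T (F y - F x - J.mulVec (y - x)) + (y - x) := by
      conv_rhs => rw [map_sub, hT (J.mulVec _), Matrix.mulVec_mulVec, hJJ, Matrix.one_mulVec]
      abel
    rw [e]
    refine (IsUltrametricDist.norm_add_le_max _ _).trans (max_le ?_ (by rwa [← dist_eq_norm]))
    refine (T.le_opNorm _).trans ?_
    refine (mul_le_mul_of_nonneg_left h1 (norm_nonneg _)).trans ?_
    rw [← mul_assoc, ← dist_eq_norm]
    have : ‖T‖ * (‖T‖ + 1)⁻¹ ≤ 1 := by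
      rw [← div_eq_mul_inv, div_le_one (by positivity)]; linarith
    calc _ ≤ 1 * dist y x := mul_le_mul_of_nonneg_right this dist_nonneg
      _ ≤ r := by linarith
  refine (measure_mono hsub).trans (le_of_eq ?_)
  rw [(measurePreserving_sub_right volume (F x)).measure_preimage_emb
    (MeasurableEquiv.subRight (F x)).measurableEmbedding]
  have h2 := volume_preimage_mulVec J⁻¹
    (by intro h; rw [h, zero_mul] at hJdet; exact zero_ne_one hJdet)
    (s := Metric.closedBall 0 r) Metric.isClosed_closedBall.measurableSet
  have h3 : volume (Metric.closedBall x r) = volume (Metric.closedBall (0 : Fin n → ℚ_[p]) r) :=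
    Measure.addHaar_closedBall_center volume x r
  rw [h3, ← h2, ← mul_assoc, ← enorm_mul, mul_comm J.det, hJdet]
  simp

theorem norm_le_one_of_monicPoly_eval {K : Type*} [NormedField K] [IsUltrametricDist K] {n : ℕ}
    (c : Fin n → K) (hc : ∀ i, ‖c i‖ ≤ 1) {t : K} (ht : (monicPoly c).eval t = 0) : ‖t‖ ≤ 1 := by
  by_contra! h
  have hn : 0 < n := by
    rcases Nat.eq_zero_or_pos n with rfl | h
    · simp [monicPoly] at ht
    · exact h
  have e : t ^ n = -∑ i : Fin n, c i * t ^ (i : ℕ) := by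
    simp only [monicPoly, eval_add, eval_pow, eval_X, eval_finsetSum, eval_mul, eval_C] at ht
    linear_combination ht
  have h1 : ‖∑ i : Fin n, c i * t ^ (i : ℕ)‖ ≤ ‖t‖ ^ (n - 1) := by
    refine IsUltrametricDist.norm_sum_le_of_forall_le_of_nonneg (by positivity) fun i _ => ?_
    rw [norm_mul, norm_pow]
    calc _ ≤ 1 * ‖t‖ ^ (n - 1) := mul_le_mul (hc i) (pow_le_pow_right₀ h.le (by omega))
          (by positivity) zero_le_one
      _ = _ := one_mul _
  have h2 : ‖t‖ ^ n ≤ ‖t‖ ^ (n - 1) := by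
    rw [← norm_pow, e, norm_neg]; exact h1
  exact absurd h2 (not_le.2 (pow_lt_pow_right₀ h (by omega)))

end ChangeOfVariablesPolynomial

section SepDisc
open Matrix
variable {R S : Type*} [CommRing R] [CommRing S] {n : ℕ}

/-- A discriminant that detects multiple and zero roots of `monicPoly c`. -/
def sepDisc (c : Fin n → R) : R :=
  (monicPoly c).eval 0 * (aeval (companion c) (derivative (monicPoly c))).det

theorem map_aeval_matrix (f : R →+* S) (M : Matrix (Fin n) (Fin n) R) (q : R[X]) :
    (aeval M q).map f = aeval (M.map f) (q.map f) := by
  rw [aeval_def, aeval_def, eval₂_map, ← RingHom.mapMatrix_apply, hom_eval₂]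
  congr 1
  ext a i j
  by_cases h : i = j <;> simp [Matrix.algebraMap_matrix_apply, h]

theorem map_sepDisc (f : R →+* S) (c : Fin n → R) :
    f (sepDisc c) = sepDisc fun i => f (c i) := by
  rw [sepDisc, map_mul, RingHom.map_det, RingHom.mapMatrix_apply, map_aeval_matrix, map_companion,
    ← derivative_map, map_monicPoly, ← eval₂_hom, ← eval_map, map_monicPoly, map_zero, sepDisc]

theorem aeval_derivative_ne_zero_of_sepDisc {K : Type*} [Field K] {c : Fin n → K}
    (hc : sepDisc c ≠ 0) {t : K} (ht : (monicPoly c).eval t = 0) :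
    (derivative (monicPoly c)).eval t ≠ 0 := by
  intro h
  have hn : 0 < n := by
    rcases Nat.eq_zero_or_pos n with rfl | h
    · simp [monicPoly] at ht
    · exact h
  have h1 := aeval_companion_mul_vandermonde c (l := fun _ => t) (fun _ => ht)
    (derivative (monicPoly c))
  simp only [h, Matrix.diagonal_zero, Matrix.mul_zero] at h1
  have hdet : IsUnit (aeval (companion c) (derivative (monicPoly c))).det :=
    isUnit_iff_ne_zero.2 fun h2 => hc (by rw [sepDisc, h2, mul_zero])
  have h2 := congrArg (fun N => (aeval (companion c) (derivative (monicPoly c)))⁻¹ * N) h1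
  simp only [Matrix.mul_zero] at h2
  rw [← Matrix.mul_assoc, Matrix.nonsing_inv_mul _ hdet, Matrix.one_mul] at h2
  have h3 := congrFun (congrFun h2 ⟨0, hn⟩) ⟨0, hn⟩
  simp [vandermonde_apply] at h3

theorem injective_and_ne_zero_of_sepDisc {K : Type*} [Field K] {c : Fin n → K}
    (hc : sepDisc c ≠ 0) {μ : Fin n → K} (hμ : monicPoly c = ∏ i, (X - C (μ i))) :
    Function.Injective μ ∧ ∀ i, μ i ≠ 0 := by
  have hroot : ∀ i, (monicPoly c).eval (μ i) = 0 := by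
    intro i
    rw [hμ, eval_prod]
    exact Finset.prod_eq_zero (Finset.mem_univ i) (by simp)
  refine ⟨fun i j hij => ?_, fun i hi => ?_⟩
  · by_contra hne
    apply aeval_derivative_ne_zero_of_sepDisc hc (hroot i)
    have e : monicPoly c = (X - C (μ i)) ^ 2 *
        ∏ k ∈ (Finset.univ.erase i).erase j, (X - C (μ k)) := by
      rw [hμ, ← Finset.mul_prod_erase _ _ (Finset.mem_univ i),
        ← Finset.mul_prod_erase (Finset.univ.erase i) _
          (Finset.mem_erase.2 ⟨Ne.symm hne, Finset.mem_univ j⟩), ← hij]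
      ring
    rw [e, sq]
    simp [derivative_mul]
  · apply hc
    have := hroot i
    rw [hi] at this
    rw [sepDisc, this, zero_mul]

theorem sepDisc_ne_zero {K : Type*} [Field K] {c : Fin n → K} {l : Fin n → K}
    (hl : ∀ i, (monicPoly c).eval (l i) = 0) (hli : Function.Injective l) (hl0 : ∀ i, l i ≠ 0) :
    sepDisc c ≠ 0 := by
  have hf : monicPoly c = ∏ i, (X - C (l i)) := by
    refine eq_of_monic_of_dvd_of_natDegree_le (monic_prod_of_monic _ _ fun i _ => monic_X_sub_C _)
      (monic_monicPoly c) ?_ ?_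
    · exact Finset.prod_dvd_of_coprime ((pairwise_coprime_X_sub_C hli).set_pairwise _)
        fun i _ => dvd_iff_isRoot.2 (hl i)
    · rw [natDegree_monicPoly, natDegree_prod_of_monic _ _ fun i _ => monic_X_sub_C _]
      simp
  have hV : (vandermonde l).det ≠ 0 := det_vandermonde_ne_zero_iff.2 hli
  have h1 := congrArg Matrix.det (aeval_companion_mul_vandermonde c hl (derivative (monicPoly c)))
  rw [det_mul, det_mul, det_transpose, mul_comm, det_diagonal] at h1
  rw [sepDisc, mul_left_cancel₀ hV h1]
  refine mul_ne_zero ?_ (Finset.prod_ne_zero_iff.2 fun i _ => ?_)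
  · rw [hf, eval_prod]
    exact Finset.prod_ne_zero_iff.2 fun i _ => by simpa using hl0 i
  · rw [hf, ← Finset.mul_prod_erase _ _ (Finset.mem_univ i), derivative_mul]
    simp only [derivative_sub, derivative_X, derivative_C, sub_zero, one_mul, eval_add, eval_mul,
      eval_sub, eval_X, eval_C, sub_self, zero_mul, add_zero, eval_prod]
    exact Finset.prod_ne_zero_iff.2 fun j hj =>
      sub_ne_zero.2 fun h => (Finset.mem_erase.1 hj).1 (hli h.symm)

theorem exists_sqrt_roots {K : Type*} [Field K] [IsAlgClosed K] (c : Fin n → K) :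
    ∃ y : Fin n → K, monicPoly c = ∏ i, (X - C (y i ^ 2)) := by
  have h1 := (IsAlgClosed.splits (monicPoly c)).eq_prod_roots
  have hcard : Multiset.card (monicPoly c).roots = n := by
    rw [← (IsAlgClosed.splits (monicPoly c)).natDegree_eq_card_roots, natDegree_monicPoly]
  rw [(monic_monicPoly c).leadingCoeff, map_one, one_mul] at h1
  obtain ⟨l, hl⟩ := Quot.exists_rep (monicPoly c).roots
  have hlen : l.length = n := by rw [← hcard, ← hl]; rfl
  have hsq : ∀ t : K, ∃ s, s ^ 2 = t := fun t => IsAlgClosed.exists_pow_nat_eq t (by norm_num)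
  choose s hs using hsq
  refine ⟨fun i => s (l.get (i.cast hlen.symm)), ?_⟩
  conv_lhs => rw [h1, ← hl]
  subst hlen
  simp only [hs, Fin.cast_eq_self]
  change ((l : Multiset K).map fun a => X - C a).prod = _
  rw [Multiset.map_coe, Multiset.prod_coe, ← List.prod_ofFn]
  congr 1
  conv_lhs => rw [← List.ofFn_get l, List.map_ofFn]
  rfl
end SepDisc

section NormBound
open Matrix
variable {n : ℕ}

theorem norm_prod_off_diag {K : Type*} [NormedField K] (μ : Fin n → K) :
    ‖∏ i, ∏ j ∈ Finset.univ.erase i, (μ i - μ j)‖ = ‖(vandermonde μ).det‖ ^ 2 := by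
  have h := Finset.prod_prod_Ioi_mul_eq_prod_prod_off_diag (fun i j : Fin n => ‖μ i - μ j‖)
  rw [det_vandermonde, norm_prod, norm_prod, ← Finset.prod_pow]
  simp only [norm_prod, ← Finset.prod_pow]
  refine Eq.trans ?_ (h.symm.trans ?_)
  · refine Finset.prod_congr rfl fun i _ => ?_
    refine Finset.prod_congr (by ext; simp) fun j _ => norm_sub_rev _ _
  · refine Finset.prod_congr rfl fun i _ => Finset.prod_congr rfl fun j _ => ?_
    rw [norm_sub_rev (μ i), sq]

theorem det_jacobian_twistPoly_bound {K : Type*} [NormedField K] [IsUltrametricDist K]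
    (h2 : (2 : K) ≠ 0) (φ : ℚ_[p] →+* K) (hφ : ∀ t, ‖φ t‖ = ‖t‖)
    (c₀ : Fin n → ℚ_[p]) {y₀ : Fin n → K}
    (hy0 : ∀ i, y₀ i ≠ 0) (hyi : Function.Injective fun i => y₀ i ^ 2)
    (hc : ∀ i, (monicPoly (fun k => φ (c₀ k))).eval (y₀ i ^ 2) = 0) :
    ∃ A : ℝ, 0 < A ∧ ∀ x : Fin n → ℚ_[p], (∀ k, ‖twistCoeff c₀ x k‖ ≤ 1) →
      sepDisc (twistCoeff c₀ x) ≠ 0 →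
        (jacobian (twistPoly c₀) x).det ≠ 0 ∧
        ‖(jacobian (twistPoly c₀) x).det‖ ^ 4 ≤
          A * ‖blockDisc 1 (companion (twistCoeff c₀ x))‖ := by
  have hV0 : (vandermonde fun i => y₀ i ^ 2).det ≠ 0 := det_vandermonde_ne_zero_iff.2 hyi
  refine ⟨‖(2 : K)‖ ^ (2 * n) * (∏ i, ‖y₀ i‖) ^ 4 *
    ‖(vandermonde fun i => y₀ i ^ 2).det‖ ^ 4, ?_, fun x hx hsep => ?_⟩
  · have : 0 < ∏ i, ‖y₀ i‖ := Finset.prod_pos fun i _ => norm_pos_iff.2 (hy0 i)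
    have := norm_pos_iff.2 h2
    have := norm_pos_iff.2 hV0
    positivity
  let y : Fin n → K := fun i => y₀ i * (lowPoly (fun k => φ (x k))).eval (y₀ i ^ 2)
  have hmap : (fun i => φ (twistCoeff c₀ x i)) =
      twistCoeff (fun k => φ (c₀ k)) (fun k => φ (x k)) :=
    funext fun i => map_twistCoeff φ c₀ x i
  have hμ : ∀ i, y i ^ 2 = y₀ i ^ 2 * (lowPoly (fun k => φ (x k))).eval (y₀ i ^ 2) ^ 2 :=
    fun i => mul_pow _ _ _
  have hprod : monicPoly (fun i => φ (twistCoeff c₀ x i)) = ∏ i, (X - C (y i ^ 2)) := by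
    rw [hmap, monicPoly_twistCoeff, charpoly_twist _ _ hc (isUnit_iff_ne_zero.2 hV0)]
    exact Finset.prod_congr rfl fun i _ => by rw [hμ]
  have hsep' : sepDisc (fun i => φ (twistCoeff c₀ x i)) ≠ 0 := by
    rw [← map_sepDisc]
    exact (map_ne_zero φ).2 hsep
  obtain ⟨hinj, hne⟩ := injective_and_ne_zero_of_sepDisc hsep' hprod
  have hy : ∀ i, y i ≠ 0 := fun i h => hne i (by rw [h]; simp)
  have hroot : ∀ i, (monicPoly fun i => φ (twistCoeff c₀ x i)).eval (y i ^ 2) = 0 := by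
    intro i
    rw [hprod, eval_prod]
    exact Finset.prod_eq_zero (Finset.mem_univ i) (by simp)
  have hy1 : ∀ i, ‖y i‖ ≤ 1 := by
    intro i
    have := norm_le_one_of_monicPoly_eval (fun i => φ (twistCoeff c₀ x i))
      (fun i => by rw [hφ]; exact hx i) (hroot i)
    rw [norm_pow] at this
    exact (pow_le_one_iff_of_nonneg (norm_nonneg _) two_ne_zero).1 this
  have hV : (vandermonde fun i => y i ^ 2).det ≠ 0 := det_vandermonde_ne_zero_iff.2 hinj
  set J := (jacobian (twistPoly c₀) x).det with hJ
  have hJ' : (jacobian (twistPoly (fun k => φ (c₀ k))) (fun k => φ (x k))).det = φ J := by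
    rw [hJ, RingHom.map_det, RingHom.mapMatrix_apply, map_jacobian]
    simp only [map_twistPoly]
  have h3 := congrArg (fun M => ‖Matrix.det M‖)
    (vandermonde_mul_jacobian_twistPoly (fun k => φ (c₀ k)) (fun k => φ (x k)) hc hyi hμ)
  simp only [det_mul, det_diagonal, hJ', norm_mul, hφ, norm_prod,
    norm_neg, Finset.prod_mul_distrib, Finset.prod_const, Finset.card_univ, Fintype.card_fin]
    at h3
  have h4 := norm_prod_off_diag fun i => y i ^ 2
  simp only [norm_prod] at h4
  rw [h4] at h3
  have h5 := blockDisc_companion h2 (fun i => φ (twistCoeff c₀ x i)) hy hinj hroot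
  have h6 : blockDisc 1 (companion fun i => φ (twistCoeff c₀ x i)) =
      φ (blockDisc 1 (companion (twistCoeff c₀ x))) := by
    rw [map_blockDisc, map_companion, Matrix.map_one _ (map_zero φ) (map_one φ)]
  rw [h6] at h5
  have h7 := congrArg norm h5
  rw [hφ, norm_mul, norm_pow, norm_prod_off_diag, norm_prod] at h7
  have h44 : ‖(4 : K)‖ = ‖(2 : K)‖ ^ 2 := by
    rw [← norm_pow]; norm_num
  simp only [norm_neg, norm_mul, Finset.prod_mul_distrib, Finset.prod_const, Finset.card_univ,
    Fintype.card_fin, norm_pow, h44, Finset.prod_pow] at h7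
  set v := ‖(vandermonde fun i => y i ^ 2).det‖ with hv
  set v₀ := ‖(vandermonde fun i => y₀ i ^ 2).det‖ with hv₀
  have hvpos : 0 < v := norm_pos_iff.2 hV
  have hyy : ∏ i, ‖y i‖ = (∏ i, ‖y₀ i‖) * ∏ i, ‖(lowPoly (fun k => φ (x k))).eval (y₀ i ^ 2)‖ := by
    rw [← Finset.prod_mul_distrib]
    exact Finset.prod_congr rfl fun i _ => norm_mul _ _
  have hJeq : ‖J‖ = ‖(2 : K)‖ ^ n * (∏ i, ‖y₀ i‖) * (∏ i, ‖y i‖) * v * v₀ := by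
    apply mul_left_cancel₀ hvpos.ne'
    rw [h3, hyy]
    simp only [norm_pow, Finset.prod_pow]
    ring
  have hY : 0 < ∏ i, ‖y i‖ := Finset.prod_pos fun i _ => norm_pos_iff.2 (hy i)
  have hY0 : 0 < ∏ i, ‖y₀ i‖ := Finset.prod_pos fun i _ => norm_pos_iff.2 (hy0 i)
  have hY1 : ∏ i, ‖y i‖ ≤ 1 := Finset.prod_le_one (fun i _ => norm_nonneg _) fun i _ => hy1 i
  have hv0pos : 0 < v₀ := norm_pos_iff.2 hV0
  have h2pos := norm_pos_iff.2 h2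
  refine ⟨norm_pos_iff.1 (by rw [hJeq]; positivity), ?_⟩
  rw [hJeq, h7]
  have hY2 : (∏ i, ‖y i‖) ^ 2 ≤ 1 := pow_le_one₀ hY.le hY1
  calc _ = (‖(2 : K)‖ ^ (2 * n) * (∏ i, ‖y₀ i‖) ^ 4 * v₀ ^ 4 *
        ((‖(2 : K)‖ ^ 2) ^ n * (∏ i, ‖y i‖) ^ 2 * (v ^ 2) ^ 2)) * (∏ i, ‖y i‖) ^ 2 := by
        ring
    _ ≤ _ := mul_le_of_le_one_right (by positivity) hY2

end NormBound

section Fiber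
open Matrix Filter Topology
variable {n : ℕ}

theorem eventually_norm_eq {X : Type*} [TopologicalSpace X] {f : X → ℚ_[p]} (hf : Continuous f)
    {x : X} (hx : f x ≠ 0) : ∀ᶠ y in 𝓝 x, ‖f y‖ = ‖f x‖ := by
  have h := (Metric.tendsto_nhds.1 (hf.tendsto x)) ‖f x‖ (norm_pos_iff.2 hx)
  filter_upwards [h] with y hy
  rw [dist_eq_norm] at hy
  have h1 := IsUltrametricDist.norm_add_eq_max_of_norm_ne_norm (x := f y - f x) (y := f x) hy.ne
  rwa [sub_add_cancel, max_eq_right hy.le] at h1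

theorem enorm_eq_of_norm_eq {E F : Type*} [SeminormedAddCommGroup E] [SeminormedAddCommGroup F]
    {a : E} {b : F} (h : ‖a‖ = ‖b‖) : ‖a‖ₑ = ‖b‖ₑ := by
  rw [← ofReal_norm, h, ofReal_norm]

/-- `blockDisc 1 (companion c)` as a polynomial in the parameters on which `c` depends. -/
def companionDiscPoly {σ : Type*} (c : Fin n → MvPolynomial σ ℚ_[p]) : MvPolynomial σ ℚ_[p] :=
  blockDisc 1 (companion c)

theorem eval_companionDiscPoly {σ : Type*} (c : Fin n → MvPolynomial σ ℚ_[p]) (x : σ → ℚ_[p]) :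
    MvPolynomial.eval x (companionDiscPoly c) =
      blockDisc 1 (companion fun i => MvPolynomial.eval x (c i)) := by
  rw [companionDiscPoly, map_blockDisc, map_companion, Matrix.map_one _ (map_zero _) (map_one _)]

theorem continuous_eval_companion :
    Continuous fun c : Fin n → ℚ_[p] => blockDisc 1 (companion c) := by
  have := MvPolynomial.continuous_eval (companionDiscPoly (p := p) (n := n) MvPolynomial.X)
  simpa only [eval_companionDiscPoly, MvPolynomial.eval_X] using this

theorem continuous_sepDisc : Continuous fun c : Fin n → ℚ_[p] => sepDisc c := by
  have := MvPolynomial.continuous_eval (sepDisc (MvPolynomial.X (R := ℚ_[p]) (σ := Fin n)))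
  simpa only [map_sepDisc, MvPolynomial.eval_X] using this

theorem continuous_twistCoeff (c₀ : Fin n → ℚ_[p]) : Continuous (twistCoeff c₀) := by
  refine continuous_pi fun k => ?_
  have := MvPolynomial.continuous_eval (twistPoly c₀ k)
  simpa only [eval_twistPoly] using this

theorem continuous_det_jacobian (Φ : Fin n → MvPolynomial (Fin n) ℚ_[p]) :
    Continuous fun x => (jacobian Φ x).det :=
  Continuous.matrix_det (continuous_matrix fun _ _ => MvPolynomial.continuous_eval _)

theorem twistCoeff_single (hn : 0 < n) {c₀ : Fin n → ℚ_[p]} (hsep : sepDisc c₀ ≠ 0) :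
    twistCoeff c₀ (Pi.single ⟨0, hn⟩ 1) = c₀ := by
  let φ := algebraMap ℚ_[p] (PadicAlgCl p)
  obtain ⟨y, hy⟩ := exists_sqrt_roots fun k => φ (c₀ k)
  have hsep' : sepDisc (fun k => φ (c₀ k)) ≠ 0 := by
    rw [← map_sepDisc]; exact (map_ne_zero φ).2 hsep
  obtain ⟨hinj, hne⟩ := injective_and_ne_zero_of_sepDisc hsep' hy
  have hroot : ∀ i, (monicPoly fun k => φ (c₀ k)).eval (y i ^ 2) = 0 := by
    intro i
    rw [hy, eval_prod]
    exact Finset.prod_eq_zero (Finset.mem_univ i) (by simp)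
  have h1 : monicPoly (fun k => φ (twistCoeff c₀ (Pi.single ⟨0, hn⟩ 1) k)) =
      monicPoly fun k => φ (c₀ k) := by
    simp only [map_twistCoeff]
    rw [monicPoly_twistCoeff, charpoly_twist _ _ hroot
      (isUnit_iff_ne_zero.2 (det_vandermonde_ne_zero_iff.2 hinj)), hy]
    refine Finset.prod_congr rfl fun i _ => ?_
    congr 2
    rw [eval_lowPoly, Finset.sum_eq_single ⟨0, hn⟩]
    · simp
    · intro b _ hb
      rw [Pi.single_eq_of_ne hb]; simp
    · simp
  ext k
  apply φ.injective
  have := congrArg (fun f => f.coeff k) h1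
  simpa only [coeff_monicPoly] using this

theorem blockDisc_companion_ne_zero {c : Fin n → ℚ_[p]} (hc : sepDisc c ≠ 0) :
    blockDisc 1 (companion c) ≠ 0 := by
  let φ := algebraMap ℚ_[p] (PadicAlgCl p)
  obtain ⟨y, hy⟩ := exists_sqrt_roots fun k => φ (c k)
  have hsep' : sepDisc (fun k => φ (c k)) ≠ 0 := by
    rw [← map_sepDisc]; exact (map_ne_zero φ).2 hc
  obtain ⟨hinj, hne⟩ := injective_and_ne_zero_of_sepDisc hsep' hy
  have hroot : ∀ i, (monicPoly fun k => φ (c k)).eval (y i ^ 2) = 0 := by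
    intro i
    rw [hy, eval_prod]
    exact Finset.prod_eq_zero (Finset.mem_univ i) (by simp)
  have h := blockDisc_companion two_ne_zero (fun k => φ (c k))
    (fun i h => hne i (by rw [h]; simp)) hinj hroot
  intro h0
  have h6 : blockDisc 1 (companion fun i => φ (c i)) = φ (blockDisc 1 (companion c)) := by
    rw [map_blockDisc, map_companion, Matrix.map_one _ (map_zero φ) (map_one φ)]
  rw [h6, h0, map_zero] at h
  refine mul_ne_zero (Finset.prod_ne_zero_iff.2 fun i _ => ?_) (pow_ne_zero _
    (Finset.prod_ne_zero_iff.2 fun i _ => Finset.prod_ne_zero_iff.2 fun j hj => ?_)) h.symm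
  · exact neg_ne_zero.2 (mul_ne_zero (by norm_num) (hne i))
  · exact sub_ne_zero.2 fun h => (Finset.mem_erase.1 hj).1 (hinj h.symm)

/-- The parameters of norm at most `R` for which the twist of `c₀` is integral and separable. -/
def twistDomain (c₀ : Fin n → ℚ_[p]) (R : ℝ) : Set (Fin n → ℚ_[p]) :=
  {x | ‖x‖ ≤ R ∧ ‖twistCoeff c₀ x‖ ≤ 1 ∧ sepDisc (twistCoeff c₀ x) ≠ 0}

theorem isOpen_twistDomain (c₀ : Fin n → ℚ_[p]) {R : ℝ} (hR : 0 < R) :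
    IsOpen (twistDomain c₀ R) := by
  have h1 : IsOpen {x : Fin n → ℚ_[p] | ‖x‖ ≤ R} := by
    have := IsUltrametricDist.isOpen_closedBall (0 : Fin n → ℚ_[p]) hR.ne'
    simpa only [Metric.closedBall, dist_zero_right] using this
  have h2 : IsOpen {x : Fin n → ℚ_[p] | ‖x‖ ≤ 1} := by
    have := IsUltrametricDist.isOpen_closedBall (0 : Fin n → ℚ_[p]) one_ne_zero
    simpa only [Metric.closedBall, dist_zero_right] using this
  exact h1.inter ((h2.preimage (continuous_twistCoeff c₀)).inter
    ((isOpen_ne (x := (0 : ℚ_[p]))).preimage (continuous_sepDisc.comp (continuous_twistCoeff c₀))))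

theorem lintegral_twist_image_lt_top (hn : 0 < n) (c₀ : Fin n → ℚ_[p]) (hc₀ : sepDisc c₀ ≠ 0) :
    ∃ ε₀ : ℝ, 0 < ε₀ ∧ ∀ ε, 0 < ε → ε ≤ ε₀ → ∀ R, 0 < R →
      ∫⁻ c in twistCoeff c₀ '' twistDomain c₀ R,
        ‖blockDisc 1 (companion c)‖ₑ ^ (-(1 / 4 + ε)) < ⊤ := by
  let φ := algebraMap ℚ_[p] (PadicAlgCl p)
  obtain ⟨y₀, hy⟩ := exists_sqrt_roots fun k => φ (c₀ k)
  have hsep' : sepDisc (fun k => φ (c₀ k)) ≠ 0 := by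
    rw [← map_sepDisc]; exact (map_ne_zero φ).2 hc₀
  obtain ⟨hinj, hne⟩ := injective_and_ne_zero_of_sepDisc hsep' hy
  obtain ⟨A, hA, hbound⟩ := det_jacobian_twistPoly_bound two_ne_zero φ
    (fun t => PadicAlgCl.norm_extends p t) c₀ (y₀ := y₀)
    (fun i h => hne i (by rw [h]; simp)) hinj (by
      intro i
      rw [hy, eval_prod]
      exact Finset.prod_eq_zero (Finset.mem_univ i) (by simp))
  let W := companionDiscPoly (twistPoly c₀)
  have hW : ∀ x, MvPolynomial.eval x W = blockDisc 1 (companion (twistCoeff c₀ x)) := by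
    intro x
    simp only [W, eval_companionDiscPoly, eval_twistPoly]
  have hW0 : W ≠ 0 := by
    intro h
    have h1 := hW (Pi.single ⟨0, hn⟩ 1)
    rw [twistCoeff_single hn hc₀, h, map_zero] at h1
    exact blockDisc_companion_ne_zero hc₀ h1.symm
  obtain ⟨ε₀, hε₀, hsoft⟩ := exists_lintegral_mvPolynomial_rpow_lt_top W hW0
  refine ⟨ε₀, hε₀, fun ε hε hle R hR => ?_⟩
  let J : (Fin n → ℚ_[p]) → ℚ_[p] := fun x => (jacobian (twistPoly c₀) x).det
  have hJc : Continuous J := continuous_det_jacobian _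
  let h : (Fin n → ℚ_[p]) → ℝ≥0∞ := fun c => ‖blockDisc 1 (companion c)‖ₑ ^ (-(1 / 4 + ε))
  let K : (Fin n → ℚ_[p]) → ℝ≥0∞ := fun x => h (twistCoeff c₀ x) * ‖J x‖ₑ
  let U := twistDomain c₀ R
  let N : ℕ → (Fin n → ℚ_[p]) → Set (Fin n → ℚ_[p]) :=
    fun m x => Metric.closedBall x ((p : ℝ)⁻¹ ^ m)
  have hp1 : (1 : ℝ) < p := by exact_mod_cast hp.out.one_lt
  have hr0 : ∀ m, 0 < (p : ℝ)⁻¹ ^ m := fun m => by positivity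
  have hrlim : Tendsto (fun m => (p : ℝ)⁻¹ ^ m) atTop (𝓝 0) :=
    tendsto_pow_atTop_nhds_zero_of_lt_one (by positivity) (inv_lt_one_of_one_lt₀ hp1)
  have hJU : ∀ x ∈ U, J x ≠ 0 ∧ ‖J x‖ ^ 4 ≤ A * ‖blockDisc 1 (companion (twistCoeff c₀ x))‖ :=
    fun x hx => hbound x (fun k => (norm_le_pi_norm _ k).trans hx.2.1) hx.2.2
  have hWU : ∀ x ∈ U, blockDisc 1 (companion (twistCoeff c₀ x)) ≠ 0 :=
    fun x hx => blockDisc_companion_ne_zero hx.2.2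
  have key : ∫⁻ c in twistCoeff c₀ '' U, h c ≤ ∫⁻ x in U, K x := by
    refine lintegral_image_le_of_cells volume volume (twistCoeff c₀) U h K N
      (fun m x _ => IsUltrametricDist.isOpen_closedBall x (hr0 m).ne')
      (fun m x _ => Metric.mem_closedBall_self (hr0 m).le)
      (fun m x _ y hyx => (IsUltrametricDist.closedBall_eq_of_mem hyx).symm)
      (fun m x _ => Metric.closedBall_subset_closedBall (pow_le_pow_of_le_one (by positivity)
        (inv_le_one_of_one_le₀ hp1.le) (Nat.le_succ m))) fun x hx => ?_
    obtain ⟨r₀, hr₀, hvol⟩ := volume_image_closedBall_le (twistPoly c₀) x (hJU x hx).1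
    have hev : ∀ᶠ y in 𝓝 x, y ∈ U ∧ ‖J y‖ = ‖J x‖ ∧ ‖blockDisc 1 (companion (twistCoeff c₀ y))‖ =
        ‖blockDisc 1 (companion (twistCoeff c₀ x))‖ :=
      (show ∀ᶠ y in 𝓝 x, y ∈ U from (isOpen_twistDomain c₀ hR).mem_nhds hx).and
        ((eventually_norm_eq hJc (hJU x hx).1).and
        (eventually_norm_eq (continuous_eval_companion.comp (continuous_twistCoeff c₀)) (hWU x hx)))
    obtain ⟨δ, hδ, hball⟩ := Metric.eventually_nhds_iff.1 hev
    obtain ⟨m, hm⟩ := ((hrlim.eventually_lt_const hδ).and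
      (hrlim.eventually_lt_const hr₀)).exists
    have hN : ∀ y ∈ N m x, y ∈ U ∧ ‖J y‖ = ‖J x‖ ∧
        ‖blockDisc 1 (companion (twistCoeff c₀ y))‖ =
        ‖blockDisc 1 (companion (twistCoeff c₀ x))‖ :=
      fun y hy => hball (lt_of_le_of_lt (Metric.mem_closedBall.1 hy) hm.1)
    have hh : ∀ y ∈ N m x, h (twistCoeff c₀ y) = h (twistCoeff c₀ x) := fun y hy => by
      simp only [h, enorm_eq_of_norm_eq (hN y hy).2.2]
    refine ⟨m, fun y hy => (hN y hy).1, fun y hy => ?_, ?_⟩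
    · simp only [K]
      rw [hh y hy, enorm_eq_of_norm_eq (hN y hy).2.1]
    · have hmeas : MeasurableSet (twistCoeff c₀ '' N m x) :=
        ((isCompact_closedBall _ _).image (continuous_twistCoeff c₀)).measurableSet
      have e : ∫⁻ c in twistCoeff c₀ '' N m x, h c =
          ∫⁻ _ in twistCoeff c₀ '' N m x, h (twistCoeff c₀ x) := by
        refine setLIntegral_congr_fun hmeas ?_
        rintro _ ⟨y, hy, rfl⟩
        exact hh y hy
      rw [e, setLIntegral_const, mul_assoc]
      refine mul_le_mul_right ?_ _
      have := hvol _ (hr0 m) hm.2.le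
      simpa only [eval_twistPoly] using this
  refine key.trans_lt ?_
  have hKle : ∀ x ∈ U, K x ≤ ENNReal.ofReal A ^ (1 / 4 : ℝ) * ‖MvPolynomial.eval x W‖ₑ ^ (-ε) := by
    intro x hx
    rw [hW]
    set w := blockDisc 1 (companion (twistCoeff c₀ x)) with hw
    have hw0 : ‖w‖ₑ ≠ 0 := enorm_ne_zero.2 (hWU x hx)
    have h4 : ‖J x‖ₑ ^ (4 : ℝ) ≤ ENNReal.ofReal A * ‖w‖ₑ := by
      have := ENNReal.ofReal_le_ofReal (hJU x hx).2
      rw [ENNReal.ofReal_mul hA.le, ENNReal.ofReal_pow (norm_nonneg _), ofReal_norm,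
        ofReal_norm] at this
      exact_mod_cast this
    have h5 : ‖J x‖ₑ ≤ ENNReal.ofReal A ^ (1 / 4 : ℝ) * ‖w‖ₑ ^ (1 / 4 : ℝ) := by
      rw [← ENNReal.mul_rpow_of_nonneg _ _ (by norm_num)]
      calc ‖J x‖ₑ = (‖J x‖ₑ ^ (4 : ℝ)) ^ (1 / 4 : ℝ) := by
            rw [← ENNReal.rpow_mul]; norm_num
        _ ≤ _ := ENNReal.rpow_le_rpow h4 (by norm_num)
    calc K x ≤ ‖w‖ₑ ^ (-(1 / 4 + ε)) * (ENNReal.ofReal A ^ (1 / 4 : ℝ) * ‖w‖ₑ ^ (1 / 4 : ℝ)) :=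
          mul_le_mul_right h5 _
      _ = ENNReal.ofReal A ^ (1 / 4 : ℝ) * (‖w‖ₑ ^ (-(1 / 4 + ε)) * ‖w‖ₑ ^ (1 / 4 : ℝ)) := by ring
      _ = _ := by
        rw [← ENNReal.rpow_add _ _ hw0 enorm_ne_top]
        congr 2
        ring
  have hUm : MeasurableSet U := (isOpen_twistDomain c₀ hR).measurableSet
  calc ∫⁻ x in U, K x ≤ ∫⁻ x in U, ENNReal.ofReal A ^ (1 / 4 : ℝ) *
        ‖MvPolynomial.eval x W‖ₑ ^ (-ε) := setLIntegral_mono' hUm hKle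
    _ ≤ ∫⁻ x in Metric.closedBall 0 R, ENNReal.ofReal A ^ (1 / 4 : ℝ) *
        ‖MvPolynomial.eval x W‖ₑ ^ (-ε) :=
      lintegral_mono_set fun x hx => mem_closedBall_zero_iff.2 hx.1
    _ < ⊤ := by
      rw [lintegral_const_mul' _ _ (ENNReal.rpow_ne_top_of_nonneg (by norm_num)
        ENNReal.ofReal_ne_top)]
      exact ENNReal.mul_lt_top (ENNReal.rpow_lt_top_of_nonneg (by norm_num)
        ENNReal.ofReal_ne_top) (hsoft ε hε hle R)

end Fiber

section Cover
open Matrix Filter Topology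
variable {n : ℕ}

/-- `y` is a tuple of square roots of the roots of `monicPoly c`. -/
def IsSqrtRoots (c : Fin n → ℚ_[p]) (y : Fin n → PadicAlgCl p) : Prop :=
  monicPoly (fun k => algebraMap ℚ_[p] (PadicAlgCl p) (c k)) = ∏ i, (X - C (y i ^ 2))

theorem IsSqrtRoots.eval_eq_zero {c : Fin n → ℚ_[p]} {y : Fin n → PadicAlgCl p}
    (h : IsSqrtRoots c y) (i : Fin n) :
    (monicPoly fun k => algebraMap ℚ_[p] (PadicAlgCl p) (c k)).eval (y i ^ 2) = 0 := by
  rw [IsSqrtRoots] at h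
  rw [h, eval_prod]
  exact Finset.prod_eq_zero (Finset.mem_univ i) (by simp)

theorem IsSqrtRoots.injective_and_ne_zero {c : Fin n → ℚ_[p]} {y : Fin n → PadicAlgCl p}
    (h : IsSqrtRoots c y) (hc : sepDisc c ≠ 0) :
    Function.Injective (fun i => y i ^ 2) ∧ ∀ i, y i ≠ 0 := by
  obtain ⟨h1, h2⟩ := injective_and_ne_zero_of_sepDisc
    (by rw [← map_sepDisc]; exact (_root_.map_ne_zero _).2 hc) h
  exact ⟨h1, fun i hi => h2 i (by rw [hi]; simp)⟩

theorem IsSqrtRoots.norm_le_one {c : Fin n → ℚ_[p]} {y : Fin n → PadicAlgCl p}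
    (h : IsSqrtRoots c y) (hc : ‖c‖ ≤ 1) (i : Fin n) : ‖y i‖ ≤ 1 := by
  have := norm_le_one_of_monicPoly_eval (fun k => algebraMap ℚ_[p] (PadicAlgCl p) (c k))
    (fun k => (PadicAlgCl.norm_extends p (c k)).le.trans ((norm_le_pi_norm c k).trans hc))
    (h.eval_eq_zero i)
  rw [norm_pow] at this
  exact (pow_le_one_iff_of_nonneg (norm_nonneg _) two_ne_zero).1 this

/-- The sign change of `z` encoded by a Boolean. -/
def signed {K : Type*} [Neg K] (b : Bool) (z : K) : K := if b then z else -z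

theorem exists_twist_of_same_type {c₀ : Fin n → ℚ_[p]} {y₀ : Fin n → PadicAlgCl p}
    (h₀ : IsSqrtRoots c₀ y₀) (hs₀ : sepDisc c₀ ≠ 0) :
    ∃ R : ℝ, 0 < R ∧ ∀ (c : Fin n → ℚ_[p]) (y : Fin n → PadicAlgCl p), IsSqrtRoots c y →
      ‖c‖ ≤ 1 →
      (∀ (σ : PadicAlgCl p ≃ₐ[ℚ_[p]] PadicAlgCl p) (i j : Fin n) (b : Bool),
        σ (y₀ i) = signed b (y₀ j) → σ (y i) = signed b (y j)) →
      ∃ x : Fin n → ℚ_[p], ‖x‖ ≤ R ∧ twistCoeff c₀ x = c := by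
  obtain ⟨hinj, hne⟩ := h₀.injective_and_ne_zero hs₀
  set φ := algebraMap ℚ_[p] (PadicAlgCl p) with hφ
  set V : Matrix (Fin n) (Fin n) (PadicAlgCl p) := vandermonde fun i => y₀ i ^ 2 with hV
  have hVdet : V.det ≠ 0 := det_vandermonde_ne_zero_iff.2 hinj
  have hVi : V⁻¹ * V = 1 := Matrix.nonsing_inv_mul V (isUnit_iff_ne_zero.2 hVdet)
  have hVi' : V * V⁻¹ = 1 := Matrix.mul_nonsing_inv V (isUnit_iff_ne_zero.2 hVdet)
  refine ⟨1 + ∑ a, ∑ i, ‖V⁻¹ a i‖ * ‖(y₀ i)⁻¹‖, by positivity, fun c y hy hc hσ => ?_⟩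
  let q : Fin n → PadicAlgCl p := fun i => y i * (y₀ i)⁻¹
  let x' := V⁻¹.mulVec q
  have hVx : V.mulVec x' = q := by
    simp only [x', Matrix.mulVec_mulVec, hVi', Matrix.one_mulVec]
  have hfix : ∀ a, ∀ σ : PadicAlgCl p ≃ₐ[ℚ_[p]] PadicAlgCl p, σ (x' a) = x' a := by
    intro a σ
    have hperm : ∀ i, ∃ j b, σ (y₀ i) = signed b (y₀ j) := by
      intro i
      have h1 : (monicPoly fun k => φ (c₀ k)).eval (σ (y₀ i ^ 2)) = 0 := by
        have h2 := congrArg σ (h₀.eval_eq_zero i)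
        rw [map_zero] at h2
        rw [← h2, ← map_monicPoly, eval_map_algebraMap, eval_map_algebraMap,
          aeval_algHom_apply]
      rw [show (monicPoly fun k => φ (c₀ k)) = _ from h₀, eval_prod,
        Finset.prod_eq_zero_iff] at h1
      obtain ⟨j, -, hj⟩ := h1
      rw [eval_sub, eval_X, eval_C, map_pow, sub_eq_zero] at hj
      rcases sq_eq_sq_iff_eq_or_eq_neg.1 hj with h | h
      · exact ⟨j, true, by simpa [signed] using h⟩
      · exact ⟨j, false, by simpa [signed] using h⟩
    choose π b hπ using hperm
    have hπ2 : ∀ i, σ (y₀ i ^ 2) = y₀ (π i) ^ 2 := by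
      intro i
      rw [map_pow, hπ]
      cases b i <;> simp [signed]
    have hπinj : Function.Injective π := by
      intro i i' h
      apply hinj
      apply σ.injective
      simp only [hπ2, h]
    have hπq : ∀ i, σ (q i) = q (π i) := by
      intro i
      simp only [q, map_mul, map_inv₀, hπ, hσ σ i _ _ (hπ i)]
      cases b i <;> simp [signed, inv_neg]
    have h3 : V.mulVec (fun a => σ (x' a)) = q := by
      ext j
      obtain ⟨i, rfl⟩ := (Finite.injective_iff_surjective.1 hπinj) j
      rw [← hπq, ← hVx]
      simp only [Matrix.mulVec, dotProduct, map_sum, map_mul, hV, vandermonde_apply, map_pow]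
      refine Finset.sum_congr rfl fun a _ => ?_
      rw [← hπ2, map_pow]
    have h4 : (fun a => σ (x' a)) = x' := by
      have := congrArg V⁻¹.mulVec h3
      rwa [Matrix.mulVec_mulVec, hVi, Matrix.one_mulVec] at this
    exact congrFun h4 a
  have hx : ∀ a, ∃ t, φ t = x' a := fun a =>
    InfiniteGalois.mem_range_algebraMap_iff_fixed (k := ℚ_[p]) (x' a) |>.2 (hfix a)
  choose x hx using hx
  refine ⟨x, ?_, ?_⟩
  · refine (pi_norm_le_iff_of_nonneg (by positivity)).2 fun a => ?_
    rw [← PadicAlgCl.norm_extends p (x a)]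
    change ‖φ (x a)‖ ≤ _
    rw [hx]
    simp only [x', Matrix.mulVec, dotProduct]
    have h5 : ‖∑ i, V⁻¹ a i * q i‖ ≤ ∑ i, ‖V⁻¹ a i‖ * ‖(y₀ i)⁻¹‖ := by
      refine (norm_sum_le _ _).trans (Finset.sum_le_sum fun i _ => ?_)
      rw [norm_mul]
      refine mul_le_mul_of_nonneg_left ?_ (norm_nonneg _)
      rw [norm_mul]
      exact mul_le_of_le_one_left (norm_nonneg _) (hy.norm_le_one hc i)
    have h6 : ∑ i, ‖V⁻¹ a i‖ * ‖(y₀ i)⁻¹‖ ≤ ∑ a, ∑ i, ‖V⁻¹ a i‖ * ‖(y₀ i)⁻¹‖ :=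
      Finset.single_le_sum (f := fun a => ∑ i, ‖V⁻¹ a i‖ * ‖(y₀ i)⁻¹‖)
        (fun a _ => by positivity) (Finset.mem_univ a)
    linarith
  · have h1 : monicPoly (fun k => φ (twistCoeff c₀ x k)) = monicPoly fun k => φ (c k) := by
      simp only [map_twistCoeff]
      rw [monicPoly_twistCoeff, charpoly_twist _ _ h₀.eval_eq_zero (isUnit_iff_ne_zero.2 hVdet),
        show (monicPoly fun k => φ (c k)) = _ from hy]
      refine Finset.prod_congr rfl fun i _ => ?_
      have h2 : eval (y₀ i ^ 2) (lowPoly fun k => φ (x k)) = q i := by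
        rw [eval_lowPoly, ← hVx]
        simp only [hx, Matrix.mulVec, dotProduct, hV, vandermonde_apply]
        exact Finset.sum_congr rfl fun a _ => mul_comm _ _
      rw [h2]
      congr 2
      simp only [q]
      have := hne i
      field_simp
    ext k
    apply φ.injective
    have := congrArg (fun f => f.coeff k) h1
    simpa only [coeff_monicPoly] using this

theorem exists_finite_preimage_cover {α β : Type*} [Finite β] (f : α → β) :
    ∃ s : Finset α, ∀ a, ∃ b ∈ s, f b = f a := by
  classical
  have : Fintype (Set.range f) := Fintype.ofFinite _
  choose g hg using fun b : Set.range f => b.2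
  exact ⟨Finset.univ.image g, fun a =>
    ⟨g ⟨f a, a, rfl⟩, Finset.mem_image_of_mem _ (Finset.mem_univ _), hg ⟨f a, a, rfl⟩⟩⟩

theorem exists_field_sqrtRoots (n : ℕ) :
    ∃ L : IntermediateField ℚ_[p] (PadicAlgCl p), FiniteDimensional ℚ_[p] L ∧
      ∀ (c : Fin n → ℚ_[p]) (y : Fin n → PadicAlgCl p), IsSqrtRoots c y → ∀ i, y i ∈ L := by
  obtain ⟨L, hL, h⟩ := hasCommonSplittingField (p := p) (2 * n) ⊥ inferInstance
  refine ⟨L, hL, fun c y hy i => ?_⟩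
  have hm : (expand ℚ_[p] 2 (monicPoly c)).Monic := (monic_monicPoly c).expand two_pos
  refine h ((expand ℚ_[p] 2 (monicPoly c)).map (algebraMap ℚ_[p] _)) (hm.map _) ?_ _ ?_
  · rw [natDegree_map, natDegree_expand, natDegree_monicPoly, mul_comm]
  · rw [aeval_map_algebraMap, expand_aeval]
    have := hy.eval_eq_zero i
    rwa [← map_monicPoly, eval_map_algebraMap] at this

theorem exists_finite_twist_cover (n : ℕ) :
    ∃ (S : Finset (Fin n → ℚ_[p])) (R : (Fin n → ℚ_[p]) → ℝ),
      (∀ c₀ ∈ S, sepDisc c₀ ≠ 0 ∧ 0 < R c₀) ∧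
      ∀ c : Fin n → ℚ_[p], sepDisc c ≠ 0 → ‖c‖ ≤ 1 →
        ∃ c₀ ∈ S, c ∈ twistCoeff c₀ '' twistDomain c₀ (R c₀) := by
  classical
  obtain ⟨L, hL, hy⟩ := exists_field_sqrtRoots (p := p) n
  let G := {c : Fin n → ℚ_[p] // sepDisc c ≠ 0 ∧ ‖c‖ ≤ 1}
  have hex : ∀ c : Fin n → ℚ_[p], ∃ y, IsSqrtRoots c y := fun c => exists_sqrt_roots _
  choose y hyc using hex
  let T : G → Set ((L →ₐ[ℚ_[p]] PadicAlgCl p) × Fin n × Fin n × Bool) := fun c =>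
    {t | t.1 ⟨y c.1 t.2.1, hy _ _ (hyc c.1) _⟩ = signed t.2.2.2 (y c.1 t.2.2.1)}
  obtain ⟨s, hs⟩ := exists_finite_preimage_cover T
  have hR : ∀ c₀ : G, _ := fun c₀ => exists_twist_of_same_type (hyc c₀.1) c₀.2.1
  choose R hR0 hR using hR
  refine ⟨s.image Subtype.val, fun c => if h : sepDisc c ≠ 0 ∧ ‖c‖ ≤ 1 then R ⟨c, h⟩ else 1,
    fun c₀ hc₀ => ?_, fun c hsep hc => ?_⟩
  · obtain ⟨c, -, rfl⟩ := Finset.mem_image.1 hc₀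
    refine ⟨c.2.1, ?_⟩
    simp only [dif_pos c.2]
    exact hR0 _
  · obtain ⟨c₀, hc₀, hT⟩ := hs ⟨c, hsep, hc⟩
    refine ⟨c₀.1, Finset.mem_image_of_mem _ hc₀, ?_⟩
    obtain ⟨x, hx, hxc⟩ := hR c₀ c (y c) (hyc c) hc fun σ i j b h => by
      have h1 : (σ.toAlgHom.comp L.val, i, j, b) ∈ T c₀ := h
      rw [hT] at h1
      exact h1
    refine ⟨x, ⟨?_, ?_, ?_⟩, hxc⟩
    · simpa only [dif_pos c₀.2] using hx
    · rw [hxc]; exact hc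
    · rw [hxc]; exact hsep

end Cover

section CompanionIntegral

theorem measurable_enorm_rpow {X : Type*} [TopologicalSpace X] [MeasurableSpace X]
    [OpensMeasurableSpace X] {f : X → ℚ_[p]} (hf : Continuous f) (s : ℝ) :
    Measurable fun x => ‖f x‖ₑ ^ s := by
  have : Measurable fun x => ‖f x‖ₑ := hf.enorm.measurable
  exact this.pow_const s

theorem ae_eval_ne_zero {ι : Type*} [Fintype ι] {f : MvPolynomial ι ℚ_[p]} (hf : f ≠ 0) :
    ∀ᵐ x : ι → ℚ_[p], MvPolynomial.eval x f ≠ 0 := by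
  obtain ⟨ε, hε, h⟩ := exists_lintegral_mvPolynomial_rpow_lt_top f hf
  have hm := measurable_enorm_rpow (MvPolynomial.continuous_eval f) (-ε)
  have h1 : ∀ k : ℕ, ∀ᵐ x : ι → ℚ_[p], x ∈ Metric.closedBall (0 : ι → ℚ_[p]) k →
      MvPolynomial.eval x f ≠ 0 := by
    intro k
    rw [← ae_restrict_iff' Metric.isClosed_closedBall.measurableSet]
    filter_upwards [ae_lt_top hm (h ε hε le_rfl k).ne] with x hx h0
    rw [h0, enorm_zero, ENNReal.zero_rpow_of_neg (by linarith)] at hx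
    exact lt_irrefl _ hx
  filter_upwards [ae_all_iff.2 h1] with x hx
  obtain ⟨k, hk⟩ := exists_nat_ge ‖x‖
  exact hx k (mem_closedBall_zero_iff.2 hk)

variable {n : ℕ}

theorem exists_sepDisc_ne_zero (n : ℕ) : ∃ c : Fin n → ℚ_[p], sepDisc c ≠ 0 := by
  let l : Fin n → ℚ_[p] := fun i => ((i : ℕ) + 1 : ℕ)
  let f : ℚ_[p][X] := ∏ i, (X - C (l i))
  have hf : f.Monic := monic_prod_of_monic _ _ fun i _ => monic_X_sub_C _
  have hdeg : f.natDegree = n := by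
    rw [natDegree_prod_of_monic _ _ fun i _ => monic_X_sub_C _]; simp
  refine ⟨fun i => f.coeff i, sepDisc_ne_zero (l := l) (fun i => ?_) (fun i j h => ?_) fun i => ?_⟩
  · rw [monicPoly_coeff hf hdeg, eval_prod]
    exact Finset.prod_eq_zero (Finset.mem_univ i) (by simp)
  · have := Nat.cast_injective h
    exact Fin.ext (by omega)
  · exact Nat.cast_ne_zero.2 (Nat.succ_ne_zero _)

theorem ae_sepDisc_ne_zero (n : ℕ) : ∀ᵐ c : Fin n → ℚ_[p], sepDisc c ≠ 0 := by
  have h : ∀ c : Fin n → ℚ_[p],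
      MvPolynomial.eval c (sepDisc (MvPolynomial.X (R := ℚ_[p]) (σ := Fin n))) = sepDisc c := by
    intro c
    rw [map_sepDisc]
    simp
  have h0 : sepDisc (MvPolynomial.X (R := ℚ_[p]) (σ := Fin n)) ≠ 0 := by
    intro h1
    obtain ⟨c, hc⟩ := exists_sepDisc_ne_zero (p := p) n
    rw [← h, h1, map_zero] at hc
    exact hc rfl
  simpa only [h] using ae_eval_ne_zero h0

theorem exists_lintegral_companion_lt_top (hn : 0 < n) :
    ∃ ε : ℝ, 0 < ε ∧ ∫⁻ c in Metric.closedBall (0 : Fin n → ℚ_[p]) 1,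
      ‖blockDisc 1 (companion c)‖ₑ ^ (-(1 / 4 + ε)) < ⊤ := by
  classical
  obtain ⟨S, R, hS, hcover⟩ := exists_finite_twist_cover (p := p) n
  have hε : ∀ c₀ : Fin n → ℚ_[p], ∃ ε₀ : ℝ, 0 < ε₀ ∧ (c₀ ∈ S → ∀ ε, 0 < ε → ε ≤ ε₀ →
      ∫⁻ c in twistCoeff c₀ '' twistDomain c₀ (R c₀),
        ‖blockDisc 1 (companion c)‖ₑ ^ (-(1 / 4 + ε)) < ⊤) := by
    intro c₀
    by_cases h : c₀ ∈ S
    · obtain ⟨ε₀, h0, h1⟩ := lintegral_twist_image_lt_top hn c₀ (hS c₀ h).1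
      exact ⟨ε₀, h0, fun _ ε hε hle => h1 ε hε hle _ (hS c₀ h).2⟩
    · exact ⟨1, one_pos, fun h' => absurd h' h⟩
  choose ε₀ hε₀ hfin using hε
  obtain ⟨ε, hεpos, hεle⟩ : ∃ ε : ℝ, 0 < ε ∧ ∀ c ∈ S, ε ≤ ε₀ c := by
    clear hfin hcover hS
    induction S using Finset.induction_on with
    | empty => exact ⟨1, one_pos, by simp⟩
    | insert a s _ ih =>
      obtain ⟨ε, h1, h2⟩ := ih
      refine ⟨min ε (ε₀ a), lt_min h1 (hε₀ a), fun c hc => ?_⟩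
      rcases Finset.mem_insert.1 hc with rfl | hc
      · exact min_le_right _ _
      · exact (min_le_left _ _).trans (h2 c hc)
  refine ⟨ε, hεpos, ?_⟩
  have hae : Metric.closedBall (0 : Fin n → ℚ_[p]) 1 ≤ᵐ[volume]
      ⋃ c₀ : S, twistCoeff c₀.1 '' twistDomain c₀.1 (R c₀.1) := by
    filter_upwards [ae_sepDisc_ne_zero (p := p) n] with c hc hcb
    obtain ⟨c₀, h1, h2⟩ := hcover c hc (mem_closedBall_zero_iff.1 hcb)
    exact Set.mem_iUnion.2 ⟨⟨c₀, h1⟩, h2⟩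
  refine (lintegral_mono_set' hae).trans_lt ?_
  refine (lintegral_iUnion_le _ _).trans_lt ?_
  rw [tsum_fintype]
  exact ENNReal.sum_lt_top.2 fun c₀ _ => hfin c₀.1 c₀.2 ε hεpos (hεle _ c₀.2)

end CompanionIntegral

section Lattice
open Matrix
variable {n : ℕ}

theorem encard_le_mul_of_fibers {α β : Type*} {A : Set α} {B : Set β} (r : α → β)
    (hr : Set.MapsTo r A B) (N : ℕ∞) (hN : N ≠ 0)
    (h : ∀ b ∈ B, {a ∈ A | r a = b}.encard ≤ N) : A.encard ≤ B.encard * N := by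
  by_cases hB : B.Finite
  · have key : ∀ B' : Set β, B'.Finite → B' ⊆ B → {a ∈ A | r a ∈ B'}.encard ≤ B'.encard * N := by
      intro B' hB'
      induction B', hB' using Set.Finite.induction_on with
      | empty => simp
      | @insert b s hbs _ ih =>
        intro hsub
        rw [Set.encard_insert_of_notMem hbs, add_mul, one_mul]
        have e : {a ∈ A | r a ∈ insert b s} ⊆ {a ∈ A | r a ∈ s} ∪ {a ∈ A | r a = b} := by
          rintro a ⟨ha, rfl | h⟩
          · exact Or.inr ⟨ha, rfl⟩
          · exact Or.inl ⟨ha, h⟩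
        refine (Set.encard_le_encard e).trans ((Set.encard_union_le _ _).trans ?_)
        exact add_le_add (ih ((Set.subset_insert _ _).trans hsub))
          (h b (hsub (Set.mem_insert _ _)))
    exact (Set.encard_le_encard (show A ⊆ {a ∈ A | r a ∈ B} from fun a ha => ⟨ha, hr ha⟩)).trans
      (key B hB subset_rfl)
  · rw [Set.encard_eq_top_iff.2 hB, ENat.top_mul hN]
    exact le_top

theorem encard_extensions_le {E : Type*} [AddCommGroup E] [Module ℤ_[p] E]
    [IsDomain ℤ_[p]] [Module.IsTorsionFree ℤ_[p] E] {k : ℕ} (f : Fin k → E) (w : E) (e : ℕ) :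
    {Y : Submodule ℤ_[p] E | ∃ h, (p : ℤ_[p]) ^ e • h - w ∈ Submodule.span ℤ_[p] (Set.range f) ∧
      Y = Submodule.span ℤ_[p] (Set.range f) ⊔ Submodule.span ℤ_[p] {h}}.encard ≤
      ((p ^ (e * k) : ℕ) : ℕ∞) := by
  set S := {Y : Submodule ℤ_[p] E | ∃ h, (p : ℤ_[p]) ^ e • h - w ∈
      Submodule.span ℤ_[p] (Set.range f) ∧
      Y = Submodule.span ℤ_[p] (Set.range f) ⊔ Submodule.span ℤ_[p] {h}} with hS
  have hY : ∀ Y : S, ∃ (h : E) (x : Fin k → ℤ_[p]), ∑ i, x i • f i = (p : ℤ_[p]) ^ e • h - w ∧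
      Y.1 = Submodule.span ℤ_[p] (Set.range f) ⊔ Submodule.span ℤ_[p] {h} := by
    rintro ⟨Y, h, h1, h2⟩
    obtain ⟨x, hx⟩ := (Submodule.mem_span_range_iff_exists_fun _).1 h1
    exact ⟨h, x, hx, h2⟩
  choose h x hx hYh using hY
  have : NeZero (p ^ e) := ⟨pow_ne_zero _ hp.out.ne_zero⟩
  let F : S → (Fin k → ZMod (p ^ e)) := fun Y i => PadicInt.toZModPow e (x Y i)
  have hle : ∀ Y Y' : S, F Y = F Y' → Y.1 ≤ Y'.1 := by
    intro Y Y' hF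
    have hu : ∀ i, ∃ u, x Y i - x Y' i = (p : ℤ_[p]) ^ e * u := by
      intro i
      have h1 : x Y i - x Y' i ∈ RingHom.ker (PadicInt.toZModPow (p := p) e) := by
        rw [RingHom.mem_ker, map_sub, sub_eq_zero]
        exact congrFun hF i
      rw [PadicInt.ker_toZModPow] at h1
      exact Ideal.mem_span_singleton.1 h1
    choose u hu using hu
    have h1 : h Y - h Y' = ∑ i, u i • f i := by
      have hp0 : (p : ℤ_[p]) ^ e ≠ 0 := pow_ne_zero _ (Nat.cast_ne_zero.2 hp.out.ne_zero)
      refine smul_right_injective E hp0 ?_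
      change (p : ℤ_[p]) ^ e • (h Y - h Y') = (p : ℤ_[p]) ^ e • ∑ i, u i • f i
      have : (p : ℤ_[p]) ^ e • (h Y - h Y') = ∑ i, x Y i • f i - ∑ i, x Y' i • f i := by
        rw [hx, hx, smul_sub]; abel
      rw [this, ← Finset.sum_sub_distrib, Finset.smul_sum]
      exact Finset.sum_congr rfl fun i _ => by rw [← sub_smul, hu, mul_smul]
    rw [hYh Y, hYh Y']
    refine sup_le le_sup_left ?_
    rw [Submodule.span_singleton_le_iff_mem]
    have h2 : h Y = ∑ i, u i • f i + h Y' := by rw [← h1]; abel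
    rw [h2]
    refine Submodule.add_mem_sup ?_ (Submodule.mem_span_singleton_self _)
    exact Submodule.sum_mem _ fun i _ => Submodule.smul_mem _ _
      (Submodule.subset_span ⟨i, rfl⟩)
  have hinj : Function.Injective F := fun Y Y' hF =>
    Subtype.ext (le_antisymm (hle _ _ hF) (hle _ _ hF.symm))
  have h3 : S.encard ≤ (Set.range F).encard := hinj.encard_range
  refine h3.trans ?_
  refine (Set.encard_le_encard (Set.subset_univ _)).trans ?_
  rw [Set.encard_univ, ENat.card_eq_coe_fintype_card, Fintype.card_fun, ZMod.card,
    Fintype.card_fin, ← pow_mul]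

/-- The vectors supported on the last `k` coordinates. -/
def flag (p : ℕ) [Fact p.Prime] (n k : ℕ) : Submodule ℤ_[p] (Fin n → ℤ_[p]) where
  carrier := {v | ∀ i : Fin n, k ≤ (i : ℕ) → v i.rev = 0}
  add_mem' := fun ha hb i hi => by simp [ha i hi, hb i hi]
  zero_mem' := fun i _ => rfl
  smul_mem' := fun c v hv i hi => by simp [hv i hi]

theorem flag_mono {k l : ℕ} (h : k ≤ l) : flag p n k ≤ flag p n l :=
  fun _ hv i hi => hv i (h.trans hi)

theorem flag_zero : flag p n 0 = ⊥ := by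
  rw [eq_bot_iff]
  intro v hv
  rw [Submodule.mem_bot]
  ext i
  have := hv i.rev (Nat.zero_le _)
  simpa using this

theorem flag_eq_top {k : ℕ} (h : n ≤ k) : flag p n k = ⊤ := by
  rw [eq_top_iff]
  intro v _ i hi
  exact absurd i.2 (by omega)

theorem mem_flag_of_mem_succ {v : Fin n → ℤ_[p]} (i : Fin n) (hv : v ∈ flag p n (i + 1))
    (h : v i.rev = 0) : v ∈ flag p n i := by
  intro j hj
  rcases hj.eq_or_lt with h1 | h1
  · rwa [← Fin.ext h1]
  · exact hv j h1

/-- The leading coefficients of `Γ` along the flag are generated by the powers `p ^ m i`. -/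
def HasLeads (Γ : Submodule ℤ_[p] (Fin n → ℤ_[p])) (m : Fin n → ℕ) : Prop :=
  ∀ i : Fin n, (∃ f ∈ Γ ⊓ flag p n (i + 1), f i.rev = (p : ℤ_[p]) ^ m i) ∧
    ∀ v ∈ Γ ⊓ flag p n (i + 1), (p : ℤ_[p]) ^ m i ∣ v i.rev

variable {Γ : Submodule ℤ_[p] (Fin n → ℤ_[p])} {m : Fin n → ℕ}

theorem exists_hasLeads {d : ℤ_[p]} (hd : d ≠ 0) (hΓ : ∀ v, d • v ∈ Γ) : ∃ m, HasLeads Γ m := by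
  have h : ∀ i : Fin n, ∃ k : ℕ, (Γ ⊓ flag p n (i + 1)).map (LinearMap.proj i.rev) =
      Ideal.span {(p : ℤ_[p]) ^ k} := by
    intro i
    refine PadicInt.ideal_eq_span_pow_p fun hbot => hd ?_
    have h1 : d • (Pi.single i.rev 1 : Fin n → ℤ_[p]) ∈ Γ ⊓ flag p n (i + 1) := by
      refine ⟨hΓ _, fun j hj => ?_⟩
      have : j.rev ≠ i.rev := fun h => by
        have := Fin.rev_injective h
        subst this
        omega
      simp [Pi.single_eq_of_ne this]
    have h2 := Submodule.mem_map_of_mem (f := LinearMap.proj (R := ℤ_[p])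
      (φ := fun _ : Fin n => ℤ_[p]) i.rev) h1
    rw [hbot] at h2
    simpa using h2
  choose k hk using h
  refine ⟨k, fun i => ⟨?_, fun v hv => ?_⟩⟩
  · have : (p : ℤ_[p]) ^ k i ∈ (Γ ⊓ flag p n (i + 1)).map (LinearMap.proj i.rev) := by
      rw [hk]; exact Ideal.mem_span_singleton_self _
    obtain ⟨f, hf, hfe⟩ := this
    exact ⟨f, hf, hfe⟩
  · have h2 := Submodule.mem_map_of_mem (f := LinearMap.proj (R := ℤ_[p])
      (φ := fun _ : Fin n => ℤ_[p]) i.rev) hv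
    rw [hk] at h2
    exact Ideal.mem_span_singleton.1 h2

theorem HasLeads.inf_flag_succ (h : HasLeads Γ m) (i : Fin n) {f : Fin n → ℤ_[p]}
    (hf : f ∈ Γ ⊓ flag p n (i + 1)) (hfi : f i.rev = (p : ℤ_[p]) ^ m i) :
    Γ ⊓ flag p n (i + 1) = Γ ⊓ flag p n i ⊔ Submodule.span ℤ_[p] {f} := by
  refine le_antisymm (fun v hv => ?_) (sup_le (inf_le_inf_left _ (flag_mono (Nat.le_succ _))) ?_)
  · obtain ⟨a, ha⟩ := (h i).2 v hv
    have h1 : v = (v - a • f) + a • f := by abel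
    rw [h1]
    refine Submodule.add_mem_sup ?_ (Submodule.smul_mem _ _ (Submodule.mem_span_singleton_self _))
    have h2 : v - a • f ∈ Γ ⊓ flag p n (i + 1) :=
      Submodule.sub_mem _ hv (Submodule.smul_mem _ _ hf)
    refine ⟨h2.1, mem_flag_of_mem_succ i h2.2 ?_⟩
    simp only [Pi.sub_apply, Pi.smul_apply, smul_eq_mul, ha, hfi]
    ring
  · rwa [Submodule.span_singleton_le_iff_mem]

theorem HasLeads.exists_basis (h : HasLeads Γ m) :
    ∃ f : Fin n → Fin n → ℤ_[p], (∀ i : Fin n, f i ∈ Γ ⊓ flag p n (i + 1)) ∧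
      (∀ i : Fin n, f i i.rev = (p : ℤ_[p]) ^ m i) ∧
      ∀ k ≤ n, Γ ⊓ flag p n k = Submodule.span ℤ_[p] (f '' {i : Fin n | (i : ℕ) < k}) := by
  choose f hf hfi using fun i => (h i).1
  refine ⟨f, hf, hfi, fun k => ?_⟩
  induction k with
  | zero => intro _; simp [flag_zero]
  | succ k ih =>
    intro hk
    have h1 := h.inf_flag_succ ⟨k, hk⟩ (hf _) (hfi _)
    have h2 : {i : Fin n | (i : ℕ) < k + 1} = insert ⟨k, hk⟩ {i : Fin n | (i : ℕ) < k} := by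
      ext i
      simp only [Set.mem_ofPred_eq, Set.mem_insert_iff, Fin.ext_iff]
      omega
    rw [h2, Set.image_insert_eq, Submodule.span_insert, ← ih (by omega), sup_comm]
    exact h1

theorem HasLeads.exists_generators (h : HasLeads Γ m) {k : ℕ} (hk : k ≤ n) :
    ∃ f : Fin k → Fin n → ℤ_[p], Γ ⊓ flag p n k = Submodule.span ℤ_[p] (Set.range f) := by
  obtain ⟨f, -, -, h3⟩ := h.exists_basis
  refine ⟨fun i => f (i.castLE hk), ?_⟩
  rw [h3 k hk]
  congr 1
  ext v
  constructor
  · rintro ⟨i, hi, rfl⟩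
    exact ⟨⟨i, hi⟩, rfl⟩
  · rintro ⟨i, rfl⟩
    exact ⟨i.castLE hk, i.2, rfl⟩

end Lattice

section Pairs
variable {n : ℕ}

/-- Pairs of lattices `Y ≤ X` with prescribed leading exponents such that `C` maps `X` to `Y`. -/
def leadPairs (C : (Fin n → ℤ_[p]) →ₗ[ℤ_[p]] (Fin n → ℤ_[p])) (m m' : ℕ → ℕ) :
    Set (Submodule ℤ_[p] (Fin n → ℤ_[p]) × Submodule ℤ_[p] (Fin n → ℤ_[p])) :=
  {P | HasLeads P.1 (fun i => m i) ∧ HasLeads P.2 (fun i => m' i) ∧ P.2 ≤ P.1 ∧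
    ∀ v ∈ P.1, C v ∈ P.2}

theorem pow_p_dvd_pow_p_iff {a b : ℕ} : (p : ℤ_[p]) ^ a ∣ (p : ℤ_[p]) ^ b ↔ a ≤ b :=
  pow_dvd_pow_iff (Nat.cast_ne_zero.2 hp.out.ne_zero) PadicInt.p_nonunit

theorem HasLeads.le_of_le {X Y : Submodule ℤ_[p] (Fin n → ℤ_[p])} {m m' : Fin n → ℕ}
    (hX : HasLeads X m) (hY : HasLeads Y m') (h : Y ≤ X) (i : Fin n) : m i ≤ m' i := by
  obtain ⟨f, hf, hfi⟩ := (hY i).1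
  have := (hX i).2 f ⟨h hf.1, hf.2⟩
  rwa [hfi, pow_p_dvd_pow_p_iff] at this

theorem HasLeads.inf_flag_one {X : Submodule ℤ_[p] (Fin n → ℤ_[p])} {m : Fin n → ℕ}
    (hX : HasLeads X m) (hn : 0 < n) :
    X ⊓ flag p n 1 =
      Submodule.span ℤ_[p] {Pi.single (Fin.rev ⟨0, hn⟩) ((p : ℤ_[p]) ^ m ⟨0, hn⟩)} := by
  obtain ⟨f, hf, hfi⟩ := (hX ⟨0, hn⟩).1
  have h1 := hX.inf_flag_succ ⟨0, hn⟩ hf hfi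
  simp only [zero_add] at h1
  rw [h1, flag_zero, inf_bot_eq, bot_sup_eq]
  congr 2
  ext j
  by_cases hj : j = Fin.rev ⟨0, hn⟩
  · subst hj; simp [hfi]
  · rw [Pi.single_eq_of_ne hj]
    have := hf.2 j.rev (by
      have : (j.rev : ℕ) ≠ 0 := fun h => hj (by
        rw [← Fin.rev_rev j]; congr 1; exact Fin.ext h)
      simp only [zero_add]
      omega)
    rwa [Fin.rev_rev] at this

variable {C : (Fin n → ℤ_[p]) →ₗ[ℤ_[p]] (Fin n → ℤ_[p])}

theorem shift_mem_flag (hC : ∀ v (i j : Fin n), (i : ℕ) = j + 1 → C v i.rev = v j.rev)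
    {k : ℕ} {v : Fin n → ℤ_[p]} (hv : v ∈ flag p n k) : C v ∈ flag p n (k + 1) := by
  intro i hi
  rw [hC v i ⟨i - 1, by omega⟩ (by simp; omega)]
  exact hv _ (by simp; omega)

theorem encard_extension_fiber_le {α : Type*} {k : ℕ} {m : ℕ → ℕ} {hk : k < n}
    {Z : Submodule ℤ_[p] (Fin n → ℤ_[p])}
    (f : Fin k → Fin n → ℤ_[p]) (hZ : Z = Submodule.span ℤ_[p] (Set.range f)) (w : Fin n → ℤ_[p])
    (e : ℕ) (hw : w ∈ flag p n (k + 1)) (hwk : w (Fin.rev ⟨k, hk⟩) = (p : ℤ_[p]) ^ (m k + e))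
    (S : Set α) (F : Submodule ℤ_[p] (Fin n → ℤ_[p]) → α)
    (hS : ∀ a ∈ S, ∃ Y, HasLeads Y (fun i => m i) ∧ Y ⊓ flag p n k = Z ∧ w ∈ Y ∧
      a = F (Y ⊓ flag p n (k + 1))) : S.encard ≤ ((p ^ (e * k) : ℕ) : ℕ∞) := by
  refine le_trans (Set.encard_le_encard ?_) ((Set.encard_image_le F _).trans
    (encard_extensions_le f w e))
  intro a ha
  obtain ⟨Y, hY, hYZ, hwY, rfl⟩ := hS a ha
  refine ⟨_, ?_, rfl⟩
  obtain ⟨h, hh, hhi⟩ := (hY ⟨k, hk⟩).1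
  refine ⟨h, ?_, ?_⟩
  · rw [← hZ, ← hYZ]
    have h1 : (p : ℤ_[p]) ^ e • h - w ∈ Y ⊓ flag p n (k + 1) :=
      Submodule.sub_mem _ (Submodule.smul_mem _ _ hh) ⟨hwY, hw⟩
    refine ⟨h1.1, mem_flag_of_mem_succ ⟨k, hk⟩ h1.2 ?_⟩
    simp only [Pi.sub_apply, Pi.smul_apply, smul_eq_mul, hhi, hwk]
    ring
  · rw [← hZ, ← hYZ]
    exact hY.inf_flag_succ ⟨k, hk⟩ hh hhi

theorem encard_image_leadPairs_le
    (hC : ∀ v (i j : Fin n), (i : ℕ) = j + 1 → C v i.rev = v j.rev) (m m' : ℕ → ℕ) (k : ℕ)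
    (hk : k + 1 ≤ n) :
    ((fun P => (P.1 ⊓ flag p n (k + 1), P.2 ⊓ flag p n (k + 1))) '' leadPairs C m m').encard *
      ((p ^ (k * m k) : ℕ) : ℕ∞) ≤ ((p ^ (∑ j ∈ Finset.range k, m j) : ℕ) : ℕ∞) := by
  induction k with
  | zero =>
    simp only [zero_add, zero_mul, pow_zero, Nat.cast_one, mul_one, Finset.range_zero,
      Finset.sum_empty]
    rw [Set.encard_le_one_iff]
    rintro _ _ ⟨P, hP, rfl⟩ ⟨P', hP', rfl⟩
    simp only [hP.1.inf_flag_one hk, hP.2.1.inf_flag_one hk, hP'.1.inf_flag_one hk,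
      hP'.2.1.inf_flag_one hk]
  | succ k ih =>
    specialize ih (by omega)
    rcases (leadPairs C m m').eq_empty_or_nonempty with hemp | ⟨P₁, hP₁⟩
    · simp [hemp]
    have le₁ : m (k + 1) ≤ m' (k + 1) := hP₁.1.le_of_le hP₁.2.1 hP₁.2.2.1 ⟨k + 1, hk⟩
    have le₂ : m' (k + 1) ≤ m k := by
      obtain ⟨f, hf, hfi⟩ := (hP₁.1 ⟨k, by omega⟩).1
      have h1 := (hP₁.2.1 ⟨k + 1, hk⟩).2 (C f) ⟨hP₁.2.2.2 f hf.1, shift_mem_flag hC hf.2⟩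
      rw [hC f ⟨k + 1, hk⟩ ⟨k, by omega⟩ rfl, hfi] at h1
      exact pow_p_dvd_pow_p_iff.1 h1
    set T := (fun P : Submodule ℤ_[p] (Fin n → ℤ_[p]) × Submodule ℤ_[p] (Fin n → ℤ_[p]) =>
      (P.1 ⊓ flag p n (k + 1), P.2 ⊓ flag p n (k + 1))) '' leadPairs C m m' with hT
    set U := (fun P : Submodule ℤ_[p] (Fin n → ℤ_[p]) × Submodule ℤ_[p] (Fin n → ℤ_[p]) =>
      (P.1 ⊓ flag p n (k + 1), P.2 ⊓ flag p n (k + 2))) '' leadPairs C m m' with hU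
    set V := (fun P : Submodule ℤ_[p] (Fin n → ℤ_[p]) × Submodule ℤ_[p] (Fin n → ℤ_[p]) =>
      (P.1 ⊓ flag p n (k + 2), P.2 ⊓ flag p n (k + 2))) '' leadPairs C m m' with hV
    have hflag : flag p n (k + 2) ⊓ flag p n (k + 1) = flag p n (k + 1) :=
      inf_eq_right.2 (flag_mono (Nat.le_succ _))
    have hp0 : ∀ a : ℕ, ((p ^ a : ℕ) : ℕ∞) ≠ 0 := fun a =>
      Nat.cast_ne_zero.2 (pow_ne_zero _ hp.out.ne_zero)
    have hUT : U.encard ≤ T.encard * ((p ^ ((m k - m' (k + 1)) * (k + 1)) : ℕ) : ℕ∞) := by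
      refine encard_le_mul_of_fibers (fun a => (a.1, a.2 ⊓ flag p n (k + 1))) ?_ _ (hp0 _) ?_
      · rintro _ ⟨P, hP, rfl⟩
        exact ⟨P, hP, by simp only [inf_assoc, hflag]⟩
      · rintro _ ⟨P₀, hP₀, rfl⟩
        obtain ⟨f, hf⟩ := hP₀.2.1.exists_generators (k := k + 1) (by omega)
        obtain ⟨g, hg, hgi⟩ := (hP₀.1 ⟨k, by omega⟩).1
        refine encard_extension_fiber_le (m := m') (hk := hk) f hf (C g) _
          (shift_mem_flag hC hg.2) ?_ _ (fun Y => (P₀.1 ⊓ flag p n (k + 1), Y)) ?_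
        · rw [hC g ⟨k + 1, hk⟩ ⟨k, by omega⟩ rfl, hgi, Nat.add_sub_cancel' le₂]
        · rintro _ ⟨⟨P, hP, rfl⟩, h⟩
          simp only [inf_assoc, hflag, Prod.mk.injEq] at h
          refine ⟨P.2, hP.2.1, h.2, hP.2.2.2 _ ?_, by rw [← h.1]⟩
          have : g ∈ P.1 ⊓ flag p n (k + 1) := by rw [h.1]; exact hg
          exact this.1
    have hVU : V.encard ≤ U.encard * ((p ^ ((m' (k + 1) - m (k + 1)) * (k + 1)) : ℕ) : ℕ∞) := by
      refine encard_le_mul_of_fibers (fun a => (a.1 ⊓ flag p n (k + 1), a.2)) ?_ _ (hp0 _) ?_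
      · rintro _ ⟨P, hP, rfl⟩
        exact ⟨P, hP, by simp only [inf_assoc, hflag]⟩
      · rintro _ ⟨P₀, hP₀, rfl⟩
        obtain ⟨f, hf⟩ := hP₀.1.exists_generators (k := k + 1) (by omega)
        obtain ⟨g, hg, hgi⟩ := (hP₀.2.1 ⟨k + 1, hk⟩).1
        refine encard_extension_fiber_le (m := m) (hk := hk) f hf g _
          hg.2 ?_ _ (fun Y => (Y, P₀.2 ⊓ flag p n (k + 2))) ?_
        · rw [hgi, Nat.add_sub_cancel' le₁]
        · rintro _ ⟨⟨P, hP, rfl⟩, h⟩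
          simp only [inf_assoc, hflag, Prod.mk.injEq] at h
          refine ⟨P.1, hP.1, h.1, hP.2.2.1 ?_, by rw [← h.2]⟩
          have : g ∈ P.2 ⊓ flag p n (k + 2) := by rw [h.2]; exact hg
          exact this.1
    calc V.encard * ((p ^ ((k + 1) * m (k + 1)) : ℕ) : ℕ∞)
        ≤ T.encard * ((p ^ ((m k - m' (k + 1)) * (k + 1)) : ℕ) : ℕ∞) *
          ((p ^ ((m' (k + 1) - m (k + 1)) * (k + 1)) : ℕ) : ℕ∞) *
          ((p ^ ((k + 1) * m (k + 1)) : ℕ) : ℕ∞) := by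
          gcongr
          exact hVU.trans (by gcongr)
      _ = T.encard * ((p ^ (k * m k) : ℕ) : ℕ∞) * ((p ^ m k : ℕ) : ℕ∞) := by
          rw [mul_assoc, mul_assoc, mul_assoc, ← Nat.cast_mul, ← Nat.cast_mul, ← Nat.cast_mul,
            ← pow_add, ← pow_add, ← pow_add]
          congr 3
          obtain ⟨a, ha⟩ := Nat.exists_eq_add_of_le le₁
          obtain ⟨b, hb⟩ := Nat.exists_eq_add_of_le le₂
          rw [hb, Nat.add_sub_cancel_left, ha, Nat.add_sub_cancel_left]
          ring
      _ ≤ ((p ^ (∑ j ∈ Finset.range k, m j) : ℕ) : ℕ∞) * ((p ^ m k : ℕ) : ℕ∞) := by gcongr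
      _ = _ := by rw [← Nat.cast_mul, ← pow_add, Finset.sum_range_succ]

theorem encard_leadPairs_le (hn : 0 < n)
    (hC : ∀ v (i j : Fin n), (i : ℕ) = j + 1 → C v i.rev = v j.rev) (m m' : ℕ → ℕ) :
    (leadPairs C m m').encard ≤ ((p ^ (∑ j ∈ Finset.range n, m j) : ℕ) : ℕ∞) := by
  obtain ⟨k, rfl⟩ : ∃ k, n = k + 1 := ⟨n - 1, by omega⟩
  have h := encard_image_leadPairs_le hC m m' k le_rfl
  simp only [flag_eq_top le_rfl, inf_top_eq, Prod.mk.eta, Set.image_id'] at h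
  refine le_trans ?_ (h.trans ?_)
  · refine le_mul_of_one_le_right zero_le ?_
    exact_mod_cast Nat.one_le_pow _ _ hp.out.pos
  · exact_mod_cast Nat.pow_le_pow_right hp.out.pos
      (Finset.sum_le_sum_of_subset (Finset.range_mono (Nat.le_succ k)))

end Pairs

section MatrixVolume
open scoped Matrix

scoped instance {ι : Type*} [Fintype ι] : (volume : Measure (ι → ℚ_[p])).IsAddHaarMeasure :=
  inferInstanceAs (Measure.pi fun _ => volume).IsAddHaarMeasure

scoped instance {ι κ : Type*} [Fintype ι] [Fintype κ] :
    (volume : Measure (ι → κ → ℚ_[p])).IsAddHaarMeasure :=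
  Measure.pi.isAddHaarMeasure (fun _ : ι => (volume : Measure (κ → ℚ_[p])))

variable {n : ℕ}

theorem eq_volume_of_unitBall {ι κ : Type*} [Fintype ι] [Fintype κ]
    (μ : Measure (ι → κ → ℚ_[p])) [μ.IsAddHaarMeasure]
    (h : μ (Metric.closedBall 0 1) = 1) : μ = volume := by
  have h1 := Measure.isAddLeftInvariant_eq_smul μ (volume : Measure (ι → κ → ℚ_[p]))
  have h2 : volume (Metric.closedBall (0 : ι → κ → ℚ_[p]) 1) = 1 := by
    rw [closedBall_pi _ zero_le_one, volume_pi_pi]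
    simp only [Pi.zero_apply, volume_unitBall_pi, Finset.prod_const_one]
  rw [h1, Measure.smul_apply, h2] at h
  rw [h1]
  have h3 : (μ.addHaarScalarFactor volume) = 1 := by
    simpa [ENNReal.smul_def] using h
  rw [h3, one_smul]

theorem volume_unitBall_matrix {ι κ : Type*} [Fintype ι] [Fintype κ] :
    volume (Metric.closedBall (0 : ι → κ → ℚ_[p]) 1) = 1 := by
  rw [closedBall_pi _ zero_le_one, volume_pi_pi]
  simp only [Pi.zero_apply, volume_unitBall_pi, Finset.prod_const_one]

theorem measurePreserving_flip {ι κ : Type*} [Fintype ι] [Fintype κ] :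
    MeasurePreserving (fun (X : ι → κ → ℚ_[p]) k i => X i k) := by
  let e : (ι → κ → ℚ_[p]) ≃ₜ+ (κ → ι → ℚ_[p]) :=
    { toFun := fun X k i => X i k
      invFun := fun X k i => X i k
      left_inv := fun _ => rfl
      right_inv := fun _ => rfl
      map_add' := fun _ _ => rfl
      continuous_toFun := by fun_prop
      continuous_invFun := by fun_prop }
  have hm : Measurable (fun (X : ι → κ → ℚ_[p]) k i => X i k) := e.continuous_toFun.measurable
  have : (Measure.map e (volume : Measure (ι → κ → ℚ_[p]))).IsAddHaarMeasure :=
    e.isAddHaarMeasure_map _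
  refine ⟨hm, eq_volume_of_unitBall (Measure.map e volume) ?_⟩
  refine (Measure.map_apply hm Metric.isClosed_closedBall.measurableSet).trans ?_
  rw [← volume_unitBall_matrix (p := p) (ι := ι) (κ := κ)]
  congr 1
  ext X
  simp only [Set.mem_preimage, Metric.mem_closedBall, dist_zero_right,
    pi_norm_le_iff_of_nonneg zero_le_one]
  exact forall_comm

/-- Right multiplication by a matrix on arrays. -/
def mulR (g : Matrix (Fin n) (Fin n) ℚ_[p]) (X : Fin n → Fin n → ℚ_[p]) :
    Fin n → Fin n → ℚ_[p] := fun i j => ∑ k, X i k * g k j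

/-- Left multiplication by a matrix on arrays. -/
def mulL (g : Matrix (Fin n) (Fin n) ℚ_[p]) (X : Fin n → Fin n → ℚ_[p]) :
    Fin n → Fin n → ℚ_[p] := fun i j => ∑ k, g i k * X k j

theorem of_mulR (g : Matrix (Fin n) (Fin n) ℚ_[p]) (X : Fin n → Fin n → ℚ_[p]) :
    Matrix.of (mulR g X) = Matrix.of X * g := by
  ext i j; simp [mulR, Matrix.mul_apply]

theorem of_mulL (g : Matrix (Fin n) (Fin n) ℚ_[p]) (X : Fin n → Fin n → ℚ_[p]) :
    Matrix.of (mulL g X) = g * Matrix.of X := by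
  ext i j; simp [mulL, Matrix.mul_apply]

theorem continuous_mulR (g : Matrix (Fin n) (Fin n) ℚ_[p]) : Continuous (mulR g) := by
  unfold mulR; fun_prop

theorem continuous_mulL (g : Matrix (Fin n) (Fin n) ℚ_[p]) : Continuous (mulL g) := by
  unfold mulL; fun_prop

theorem volume_preimage_mulR (g : Matrix (Fin n) (Fin n) ℚ_[p]) (hg : g.det ≠ 0)
    {s : Set (Fin n → Fin n → ℚ_[p])} (hs : MeasurableSet s) :
    ‖g.det‖ₑ ^ n * volume (mulR g ⁻¹' s) = volume s := by
  have hgu : IsUnit g.det := isUnit_iff_ne_zero.2 hg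
  let e : (Fin n → Fin n → ℚ_[p]) ≃ₜ+ (Fin n → Fin n → ℚ_[p]) :=
    { toFun := mulR g
      invFun := mulR g⁻¹
      left_inv := fun X => Matrix.of.injective (by
        rw [of_mulR, of_mulR, Matrix.mul_assoc, Matrix.mul_nonsing_inv _ hgu, Matrix.mul_one])
      right_inv := fun X => Matrix.of.injective (by
        rw [of_mulR, of_mulR, Matrix.mul_assoc, Matrix.nonsing_inv_mul _ hgu, Matrix.mul_one])
      map_add' := fun X Y => by
        ext i j
        simp [mulR, add_mul, Finset.sum_add_distrib]
      continuous_toFun := continuous_mulR g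
      continuous_invFun := continuous_mulR g⁻¹ }
  have hm : Measurable (mulR g) := (continuous_mulR g).measurable
  have : (Measure.map (mulR g) (volume : Measure (Fin n → Fin n → ℚ_[p]))).IsAddHaarMeasure :=
    e.isAddHaarMeasure_map _
  have h1 := Measure.isAddLeftInvariant_eq_smul (Measure.map (mulR g) volume)
    (volume : Measure (Fin n → Fin n → ℚ_[p]))
  set c := (Measure.map (mulR g) volume).addHaarScalarFactor
    (volume : Measure (Fin n → Fin n → ℚ_[p]))
  have h2 : ‖g.det‖ₑ ^ n * (Measure.map (mulR g) volume) (Metric.closedBall 0 1) = 1 := by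
    rw [Measure.map_apply hm Metric.isClosed_closedBall.measurableSet, closedBall_pi _ zero_le_one]
    have h3 := volume_preimage_rows (κ := Fin n) gᵀ (by rwa [Matrix.det_transpose])
      (s := fun _ => Metric.closedBall 0 1) (fun _ => Metric.isClosed_closedBall.measurableSet)
    rw [Matrix.det_transpose, Fintype.card_fin] at h3
    have h4 : mulR g = (fun X k => gᵀ.mulVec (X k)) := by
      funext X k
      rw [Matrix.mulVec_transpose]
      rfl
    rw [h4]
    refine h3.trans ?_
    rw [volume_pi_pi]
    simp only [volume_unitBall_pi, Finset.prod_const_one]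
  have h5 : ‖g.det‖ₑ ^ n * (c : ℝ≥0∞) = 1 := by
    rw [h1, Measure.smul_apply, volume_unitBall_matrix] at h2
    simpa [ENNReal.smul_def] using h2
  rw [← Measure.map_apply hm hs, h1, Measure.smul_apply, ENNReal.smul_def, smul_eq_mul,
    ← mul_assoc, h5, one_mul]

theorem volume_preimage_mulL (g : Matrix (Fin n) (Fin n) ℚ_[p]) (hg : g.det ≠ 0)
    {s : Set (Fin n → Fin n → ℚ_[p])} (hs : MeasurableSet s) :
    ‖g.det‖ₑ ^ n * volume (mulL g ⁻¹' s) = volume s := by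
  have hf := measurePreserving_flip (p := p) (ι := Fin n) (κ := Fin n)
  have h1 := volume_preimage_mulR gᵀ (by rwa [Matrix.det_transpose]) (hf.measurable hs)
  rw [Matrix.det_transpose, hf.measure_preimage hs.nullMeasurableSet] at h1
  have hm : Measurable (mulL g) := (continuous_mulL g).measurable
  rw [← h1, ← hf.measure_preimage (hm hs).nullMeasurableSet]
  congr 2
  have : ∀ X : Fin n → Fin n → ℚ_[p], (fun i j => mulR gᵀ X j i) = mulL g fun k i => X i k := by
    intro X
    funext i j
    exact Finset.sum_congr rfl fun k _ => mul_comm _ _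
  ext X
  simp only [Set.mem_preimage, this]

end MatrixVolume

section IntegralMatrices
open scoped Matrix
variable {n : ℕ}

/-- Matrices with entries in the ring of integers. -/
def IntMat (M : Matrix (Fin n) (Fin n) ℚ_[p]) : Prop := ∀ i j, ‖M i j‖ ≤ 1

theorem IntMat.exists_lift {M : Matrix (Fin n) (Fin n) ℚ_[p]} (h : IntMat M) :
    ∃ N : Matrix (Fin n) (Fin n) ℤ_[p], N.map PadicInt.Coe.ringHom = M :=
  ⟨Matrix.of fun i j => ⟨M i j, h i j⟩, rfl⟩

theorem intMat_map (N : Matrix (Fin n) (Fin n) ℤ_[p]) : IntMat (N.map PadicInt.Coe.ringHom) :=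
  fun i j => (N i j).norm_le_one

theorem IntMat.mul {M N : Matrix (Fin n) (Fin n) ℚ_[p]} (hM : IntMat M) (hN : IntMat N) :
    IntMat (M * N) := by
  obtain ⟨M, rfl⟩ := hM.exists_lift
  obtain ⟨N, rfl⟩ := hN.exists_lift
  rw [← Matrix.map_mul]
  exact intMat_map _

theorem map_matrix_injective {M N : Matrix (Fin n) (Fin n) ℤ_[p]}
    (h : M.map PadicInt.Coe.ringHom = N.map PadicInt.Coe.ringHom) : M = N := by
  ext i j
  exact Subtype.ext (congrFun (congrFun h i) j)

theorem norm_coe_det (g : Matrix (Fin n) (Fin n) ℤ_[p]) :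
    ‖(g.map PadicInt.Coe.ringHom).det‖ = ‖g.det‖ := by
  rw [← RingHom.mapMatrix_apply, ← RingHom.map_det]
  rfl

theorem HasLeads.norm_det {g : Matrix (Fin n) (Fin n) ℤ_[p]} {m : Fin n → ℕ}
    (h : HasLeads (LinearMap.range g.mulVecLin) m) :
    ‖g.det‖ = ‖(p : ℤ_[p]) ^ ∑ i, m i‖ := by
  obtain ⟨f, hf, hfi, hspan⟩ := h.exists_basis
  have hspan := hspan n le_rfl
  have huniv : {i : Fin n | (i : ℕ) < n} = Set.univ := by ext i; simp
  rw [flag_eq_top le_rfl, inf_top_eq, huniv, Set.image_univ] at hspan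
  set t : Matrix (Fin n) (Fin n) ℤ_[p] := (Matrix.of f)ᵀ with ht
  have hle : ∀ {a b : Matrix (Fin n) (Fin n) ℤ_[p]}, ‖(a * b).det‖ ≤ ‖a.det‖ := by
    intro a b
    rw [Matrix.det_mul, norm_mul]
    exact mul_le_of_le_one_right (norm_nonneg _) (PadicInt.norm_le_one _)
  have h1 : ∃ u : Matrix (Fin n) (Fin n) ℤ_[p], t = g * u := by
    choose u hu using fun i => (hf i).1
    refine ⟨(Matrix.of u)ᵀ, ?_⟩
    ext i j
    exact (congrFun (hu j) i).symm
  have h2 : ∃ u : Matrix (Fin n) (Fin n) ℤ_[p], g = t * u := by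
    have : ∀ j, ∃ x : Fin n → ℤ_[p], ∑ i, x i • f i = g *ᵥ Pi.single j 1 := fun j =>
      (Submodule.mem_span_range_iff_exists_fun _).1 (hspan ▸ ⟨_, rfl⟩)
    choose x hx using this
    refine ⟨(Matrix.of x)ᵀ, ?_⟩
    ext i j
    have := congrFun (hx j) i
    rw [Matrix.mulVec_single_one] at this
    rw [Matrix.mul_apply]
    refine this.symm.trans ?_
    simp [t, mul_comm]
  have h3 : ‖g.det‖ = ‖t.det‖ := by
    obtain ⟨u, hu⟩ := h1
    obtain ⟨v, hv⟩ := h2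
    refine le_antisymm ?_ ?_
    · rw [hv]; exact hle
    · rw [hu]; exact hle
  have h4 : (t.submatrix Fin.revPerm id).det = (p : ℤ_[p]) ^ ∑ i, m i := by
    rw [Matrix.det_of_isUpperTriangular, ← Finset.prod_pow_eq_pow_sum]
    · exact Finset.prod_congr rfl fun i _ => hfi i
    · intro i j hij
      exact (hf j).2 i hij
  rw [h3, ← h4, Matrix.det_permute, norm_mul]
  have : ‖((Equiv.Perm.sign (Fin.revPerm (n := n)) : ℤ) : ℤ_[p])‖ = 1 := by
    rcases Int.units_eq_one_or (Equiv.Perm.sign (Fin.revPerm (n := n))) with h | h <;> simp [h]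
  rw [this, one_mul]

theorem HasLeads.enorm_det {g : Matrix (Fin n) (Fin n) ℤ_[p]} {m : Fin n → ℕ}
    (h : HasLeads (LinearMap.range g.mulVecLin) m) :
    ‖(g.map PadicInt.Coe.ringHom).det‖ₑ = ((p : ℝ≥0∞)⁻¹) ^ ∑ i, m i := by
  have h1 : ‖(g.map PadicInt.Coe.ringHom).det‖ = ‖(p : ℚ_[p]) ^ ∑ i, m i‖ := by
    rw [norm_coe_det, h.norm_det, norm_pow, norm_pow, PadicInt.norm_p, Padic.norm_p]
  rw [enorm_eq_of_norm_eq h1, enorm_pow]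
  congr 1
  rw [← ofReal_norm, Padic.norm_p, ENNReal.ofReal_inv_of_pos (by exact_mod_cast hp.out.pos),
    ENNReal.ofReal_natCast]

theorem exists_hasLeads_range {g : Matrix (Fin n) (Fin n) ℤ_[p]} (hg : g.det ≠ 0) :
    ∃ m, HasLeads (LinearMap.range g.mulVecLin) m :=
  exists_hasLeads hg fun v => ⟨g.adjugate *ᵥ v, by
    rw [Matrix.mulVecLin_apply, Matrix.mulVec_mulVec, Matrix.mul_adjugate, Matrix.smul_mulVec,
      Matrix.one_mulVec]⟩

theorem range_mulVecLin_le_iff {g h : Matrix (Fin n) (Fin n) ℤ_[p]} :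
    LinearMap.range h.mulVecLin ≤ LinearMap.range g.mulVecLin ↔ ∃ u, h = g * u := by
  constructor
  · intro hle
    have : ∀ j, ∃ x, g *ᵥ x = h *ᵥ Pi.single j 1 := fun j => hle ⟨_, rfl⟩
    choose x hx using this
    refine ⟨(Matrix.of x)ᵀ, ?_⟩
    ext i j
    have := congrFun (hx j) i
    rw [Matrix.mulVec_single_one] at this
    exact this.symm
  · rintro ⟨u, rfl⟩ _ ⟨x, rfl⟩
    exact ⟨u *ᵥ x, by simp [Matrix.mulVec_mulVec]⟩

theorem exists_eq_mul_of_intMat_inv_mul {g h : Matrix (Fin n) (Fin n) ℤ_[p]} (hg : g.det ≠ 0)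
    (H : IntMat ((g.map PadicInt.Coe.ringHom)⁻¹ * h.map PadicInt.Coe.ringHom)) :
    ∃ u, h = g * u := by
  obtain ⟨u, hu⟩ := H.exists_lift
  refine ⟨u, map_matrix_injective ?_⟩
  have : IsUnit (g.map PadicInt.Coe.ringHom).det := by
    rw [isUnit_iff_ne_zero, ← norm_ne_zero_iff, norm_coe_det, norm_ne_zero_iff]
    exact hg
  rw [Matrix.map_mul, hu, ← Matrix.mul_assoc, Matrix.mul_nonsing_inv _ this, Matrix.one_mul]

end IntegralMatrices

section LatticeSum
open scoped Matrix
variable {n : ℕ}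

theorem tsum_pow_sum_lt_top {q : ℝ≥0∞} (hq : q < 1) (n : ℕ) :
    ∑' m : Fin n → ℕ, q ^ (∑ i, m i) < ⊤ := by
  induction n with
  | zero => simp [tsum_fintype]
  | succ n ih =>
    rw [← (Fin.consEquiv fun _ : Fin (n + 1) => ℕ).tsum_eq]
    refine (ENNReal.tsum_prod (f := fun (k : ℕ) (m : Fin n → ℕ) =>
      q ^ ∑ i, (Fin.cons k m : Fin (n + 1) → ℕ) i)).trans_lt ?_
    simp only [Fin.sum_univ_succ, Fin.cons_zero, Fin.cons_succ, pow_add,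
      ENNReal.tsum_mul_left, ENNReal.tsum_mul_right]
    refine ENNReal.mul_lt_top ?_ ih
    rw [ENNReal.tsum_geometric]
    exact ENNReal.inv_lt_top.2 (tsub_pos_of_lt hq)

/-- Pairs `(g₁, g₂)` of integral matrices for which `g₁⁻¹ g₂` and `g₂⁻¹ C g₁` are integral, `C`
being a companion matrix. -/
def pairRegion (c : Fin n → ℚ_[p]) :
    Set ((Fin n → Fin n → ℚ_[p]) × (Fin n → Fin n → ℚ_[p])) :=
  {G | IntMat (Matrix.of G.1) ∧ IntMat (Matrix.of G.2) ∧ (Matrix.of G.1).det ≠ 0 ∧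
    (Matrix.of G.2).det ≠ 0 ∧ IntMat ((Matrix.of G.1)⁻¹ * Matrix.of G.2) ∧
    IntMat ((Matrix.of G.2)⁻¹ * companion c * Matrix.of G.1)}

/-- The density against which pairs of matrices are integrated. -/
def pairWeight (a : ℝ) (G : (Fin n → Fin n → ℚ_[p]) × (Fin n → Fin n → ℚ_[p])) : ℝ≥0∞ :=
  (‖(Matrix.of G.1).det‖ₑ ^ a * ‖(Matrix.of G.2).det‖ₑ ^ a) * (‖(Matrix.of G.1).det‖ₑ *
    (‖(Matrix.of G.1).det‖ₑ ^ n)⁻¹ * (‖(Matrix.of G.2).det‖ₑ ^ n)⁻¹)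

/-- Pairs of integral matrices with given column lattices. -/
def latticeCell (P : Submodule ℤ_[p] (Fin n → ℤ_[p]) × Submodule ℤ_[p] (Fin n → ℤ_[p])) :
    Set ((Fin n → Fin n → ℚ_[p]) × (Fin n → Fin n → ℚ_[p])) :=
  {G | ∃ N₁ N₂ : Matrix (Fin n) (Fin n) ℤ_[p], N₁.map PadicInt.Coe.ringHom = Matrix.of G.1 ∧
    N₂.map PadicInt.Coe.ringHom = Matrix.of G.2 ∧ LinearMap.range N₁.mulVecLin = P.1 ∧
    LinearMap.range N₂.mulVecLin = P.2}

theorem enorm_ne_zero_of_ne_zero {x : ℚ_[p]} (hx : x ≠ 0) : ‖x‖ₑ ≠ 0 := by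
  rwa [Ne, enorm_eq_zero]

theorem volume_preimage_mulL_inv (g : Matrix (Fin n) (Fin n) ℚ_[p]) (hg : g.det ≠ 0) :
    volume (mulL g⁻¹ ⁻¹' Metric.closedBall 0 1) = ‖g.det‖ₑ ^ n := by
  have h1 : g⁻¹.det = g.det⁻¹ := by
    rw [Matrix.det_nonsing_inv, Ring.inverse_eq_inv']
  have h := volume_preimage_mulL g⁻¹ (by rw [h1]; exact inv_ne_zero hg)
    (Metric.isClosed_closedBall (x := (0 : Fin n → Fin n → ℚ_[p])) (ε := 1)).measurableSet
  rw [volume_unitBall_matrix, h1] at h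
  have h2 : ‖g.det‖ₑ ^ n * ‖g.det⁻¹‖ₑ ^ n = 1 := by
    rw [← mul_pow, ← enorm_mul, mul_inv_cancel₀ hg]; simp
  rw [← one_mul (volume _), ← h2, mul_assoc, h, mul_one]

theorem volume_latticeCell_le {P : Submodule ℤ_[p] (Fin n → ℤ_[p]) ×
    Submodule ℤ_[p] (Fin n → ℤ_[p])} {m m' : Fin n → ℕ} (h₁ : HasLeads P.1 m)
    (h₂ : HasLeads P.2 m') :
    volume (latticeCell P) ≤
      (((p : ℝ≥0∞)⁻¹) ^ ∑ i, m i) ^ n * (((p : ℝ≥0∞)⁻¹) ^ ∑ i, m' i) ^ n := by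
  rcases (latticeCell P).eq_empty_or_nonempty with he | ⟨G, N₁, N₂, hG₁, hG₂, hN₁, hN₂⟩
  · simp [he]
  have hp0 : ∀ k : ℕ, (((p : ℝ≥0∞)⁻¹) ^ k) ≠ 0 := fun k =>
    pow_ne_zero _ (ENNReal.inv_ne_zero.2 (ENNReal.natCast_ne_top p))
  have e₁ := HasLeads.enorm_det (hN₁ ▸ h₁)
  have e₂ := HasLeads.enorm_det (hN₂ ▸ h₂)
  have d₁ : (N₁.map PadicInt.Coe.ringHom).det ≠ 0 := by
    rw [← enorm_ne_zero, e₁]; exact hp0 _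
  have d₂ : (N₂.map PadicInt.Coe.ringHom).det ≠ 0 := by
    rw [← enorm_ne_zero, e₂]; exact hp0 _
  rw [← e₁, ← e₂, ← volume_preimage_mulL_inv _ d₁, ← volume_preimage_mulL_inv _ d₂,
    ← Measure.prod_prod, ← Measure.volume_eq_prod]
  refine measure_mono ?_
  have key : ∀ (N N' : Matrix (Fin n) (Fin n) ℤ_[p]) (G : Fin n → Fin n → ℚ_[p]),
      (N.map PadicInt.Coe.ringHom).det ≠ 0 → N'.map PadicInt.Coe.ringHom = Matrix.of G →
      LinearMap.range N'.mulVecLin ≤ LinearMap.range N.mulVecLin →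
      mulL (N.map PadicInt.Coe.ringHom)⁻¹ G ∈ Metric.closedBall 0 1 := by
    intro N N' G hN hG hle
    obtain ⟨u, rfl⟩ := range_mulVecLin_le_iff.1 hle
    have : Matrix.of (mulL (N.map PadicInt.Coe.ringHom)⁻¹ G) = u.map PadicInt.Coe.ringHom := by
      rw [of_mulL, ← hG, Matrix.map_mul, ← Matrix.mul_assoc,
        Matrix.nonsing_inv_mul _ (isUnit_iff_ne_zero.2 hN), Matrix.one_mul]
    rw [mem_closedBall_zero_iff, pi_norm_le_iff_of_nonneg zero_le_one]
    intro i
    rw [pi_norm_le_iff_of_nonneg zero_le_one]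
    intro j
    have h2 := intMat_map u i j
    rw [← this] at h2
    exact h2
  rintro G' ⟨N₁', N₂', hG₁', hG₂', hN₁', hN₂'⟩
  exact ⟨key _ _ _ d₁ hG₁' (by rw [hN₁', hN₁]), key _ _ _ d₂ hG₂' (by rw [hN₂', hN₂])⟩

theorem lintegral_latticeCell_le {P : Submodule ℤ_[p] (Fin n → ℤ_[p]) ×
    Submodule ℤ_[p] (Fin n → ℤ_[p])} {m m' : Fin n → ℕ} (h₁ : HasLeads P.1 m)
    (h₂ : HasLeads P.2 m') (a : ℝ) :
    ∫⁻ G in latticeCell P, pairWeight a G ≤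
      ((((p : ℝ≥0∞)⁻¹) ^ a) ^ ∑ i, m i) * ((((p : ℝ≥0∞)⁻¹) ^ a) ^ ∑ i, m' i) *
        ((p : ℝ≥0∞)⁻¹) ^ ∑ i, m i := by
  set x := ((p : ℝ≥0∞)⁻¹) ^ ∑ i, m i with hx
  set y := ((p : ℝ≥0∞)⁻¹) ^ ∑ i, m' i with hy
  have hp0 : ∀ k : ℕ, (((p : ℝ≥0∞)⁻¹) ^ k) ≠ 0 := fun k =>
    pow_ne_zero _ (ENNReal.inv_ne_zero.2 (ENNReal.natCast_ne_top p))
  have hpt : ∀ k : ℕ, (((p : ℝ≥0∞)⁻¹) ^ k) ≠ ⊤ := fun k =>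
    ENNReal.pow_ne_top (ENNReal.inv_ne_top.2 (Nat.cast_ne_zero.2 hp.out.ne_zero))
  calc ∫⁻ G in latticeCell P, pairWeight a G
      ≤ ∫⁻ G in latticeCell P, (x ^ a * y ^ a) * (x * (x ^ n)⁻¹ * (y ^ n)⁻¹) := by
        refine setLIntegral_mono measurable_const ?_
        rintro G ⟨N₁, N₂, hG₁, hG₂, hN₁, hN₂⟩
        have e₁ := HasLeads.enorm_det (hN₁ ▸ h₁)
        have e₂ := HasLeads.enorm_det (hN₂ ▸ h₂)
        rw [pairWeight, ← hG₁, ← hG₂, e₁, e₂]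
    _ ≤ (x ^ a * y ^ a) * (x * (x ^ n)⁻¹ * (y ^ n)⁻¹) * (x ^ n * y ^ n) := by
        rw [setLIntegral_const]
        gcongr
        exact volume_latticeCell_le h₁ h₂
    _ = (x ^ a * y ^ a) * x * ((x ^ n)⁻¹ * x ^ n) * ((y ^ n)⁻¹ * y ^ n) := by ring
    _ = x ^ a * y ^ a * x := by
        rw [ENNReal.inv_mul_cancel, ENNReal.inv_mul_cancel, mul_one, mul_one] <;>
          simp only [hx, hy, ← pow_mul] <;> first | exact hp0 _ | exact hpt _
    _ = _ := by
        simp only [hx, hy, ← ENNReal.rpow_natCast, ← ENNReal.rpow_mul]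
        congr 3
        all_goals rw [mul_comm]

theorem exists_lintegral_pairRegion_le (hn : 0 < n) {a : ℝ} (ha : 0 < a) :
    ∃ K : ℝ≥0∞, K < ⊤ ∧ ∀ c : Fin n → ℚ_[p], ‖c‖ ≤ 1 →
      ∫⁻ G in pairRegion c, pairWeight a G ≤ K := by
  set q := ((p : ℝ≥0∞)⁻¹) ^ a with hq
  have hq1 : q < 1 := ENNReal.rpow_lt_one
    (ENNReal.inv_lt_one.2 (by exact_mod_cast hp.out.one_lt)) ha
  refine ⟨(∑' m : Fin n → ℕ, q ^ (∑ i, m i)) * ∑' m : Fin n → ℕ, q ^ (∑ i, m i),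
    ENNReal.mul_lt_top (tsum_pow_sum_lt_top hq1 n) (tsum_pow_sum_lt_top hq1 n), fun c hc => ?_⟩
  have hci : ∀ i, ‖c i‖ ≤ 1 := fun i => (norm_le_pi_norm c i).trans hc
  let c' : Fin n → ℤ_[p] := fun i => ⟨c i, hci i⟩
  have hc' : companion c = (companion c').map PadicInt.Coe.ringHom := by
    rw [map_companion]; rfl
  let C := (companion c').mulVecLin
  have hC : ∀ v (i j : Fin n), (i : ℕ) = j + 1 → C v i.rev = v j.rev := by
    intro v i j hij
    have h1 : ((i.rev : Fin n) : ℕ) + 1 < n := by simp only [Fin.val_rev]; omega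
    rw [Matrix.mulVecLin_apply, companion_mulVec, dif_pos h1]
    congr 1
    ext
    simp only [Fin.val_rev]
    omega
  let ex : (Fin n → ℕ) → ℕ → ℕ := fun m k => if h : k < n then m ⟨k, h⟩ else 0
  have hex : ∀ m (i : Fin n), ex m i = m i := fun m i => dif_pos i.2
  have hex' : ∀ m : Fin n → ℕ, (fun i : Fin n => ex m i) = m := fun m => funext (hex m)
  have hsum : ∀ m : Fin n → ℕ, ∑ j ∈ Finset.range n, ex m j = ∑ i, m i := fun m => by
    rw [Finset.sum_range]
    exact Finset.sum_congr rfl fun i _ => hex m i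
  have hcover : pairRegion c ⊆ ⋃ M : (Fin n → ℕ) × (Fin n → ℕ),
      ⋃ P : leadPairs C (ex M.1) (ex M.2), latticeCell P.1 := by
    rintro ⟨G₁, G₂⟩ ⟨i₁, i₂, d₁, d₂, hA, hB⟩
    obtain ⟨N₁, hN₁⟩ := i₁.exists_lift
    obtain ⟨N₂, hN₂⟩ := i₂.exists_lift
    simp only at hN₁ hN₂ d₁ d₂ hA hB
    rw [← hN₁, ← norm_ne_zero_iff, norm_coe_det, norm_ne_zero_iff] at d₁
    rw [← hN₂, ← norm_ne_zero_iff, norm_coe_det, norm_ne_zero_iff] at d₂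
    obtain ⟨m, hm⟩ := exists_hasLeads_range d₁
    obtain ⟨m', hm'⟩ := exists_hasLeads_range d₂
    rw [← hN₁, ← hN₂] at hA hB
    rw [hc', Matrix.mul_assoc, ← Matrix.map_mul] at hB
    refine Set.mem_iUnion.2 ⟨(m, m'), Set.mem_iUnion.2 ⟨⟨(LinearMap.range N₁.mulVecLin,
      LinearMap.range N₂.mulVecLin), ?_, ?_, ?_, ?_⟩, ⟨N₁, N₂, hN₁, hN₂, rfl, rfl⟩⟩⟩
    · simpa only [hex'] using hm
    · simpa only [hex'] using hm'
    · exact range_mulVecLin_le_iff.2 (exists_eq_mul_of_intMat_inv_mul d₁ hA)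
    · rintro _ ⟨x, rfl⟩
      refine range_mulVecLin_le_iff.2 (exists_eq_mul_of_intMat_inv_mul d₂ hB) ⟨x, ?_⟩
      simp [C, Matrix.mulVec_mulVec]
  have hfin : ∀ m m', (leadPairs C (ex m) (ex m')).encard ≤ ((p ^ (∑ i, m i) : ℕ) : ℕ∞) :=
    fun m m' => hsum m ▸ encard_leadPairs_le hn hC (ex m) (ex m')
  have hcount : ∀ m m', Countable (leadPairs C (ex m) (ex m')) := fun m m' =>
    (Set.finite_of_encard_le_coe (hfin m m')).countable.to_subtype
  calc ∫⁻ G in pairRegion c, pairWeight a G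
      ≤ ∫⁻ G in ⋃ M : (Fin n → ℕ) × (Fin n → ℕ),
          ⋃ P : leadPairs C (ex M.1) (ex M.2), latticeCell P.1, pairWeight a G :=
        lintegral_mono_set hcover
    _ ≤ ∑' M : (Fin n → ℕ) × (Fin n → ℕ), ∑' P : leadPairs C (ex M.1) (ex M.2),
          ∫⁻ G in latticeCell P.1, pairWeight a G := by
        refine (lintegral_iUnion_le _ _).trans (ENNReal.tsum_le_tsum fun M => ?_)
        exact lintegral_iUnion_le _ _
    _ ≤ ∑' M : (Fin n → ℕ) × (Fin n → ℕ), ∑' _ : leadPairs C (ex M.1) (ex M.2),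
          (q ^ ∑ i, M.1 i) * (q ^ ∑ i, M.2 i) * ((p : ℝ≥0∞)⁻¹) ^ ∑ i, M.1 i := by
        refine ENNReal.tsum_le_tsum fun M => ENNReal.tsum_le_tsum fun P => ?_
        have h := P.2
        exact lintegral_latticeCell_le (by simpa only [hex'] using h.1)
          (by simpa only [hex'] using h.2.1) a
    _ ≤ ∑' M : (Fin n → ℕ) × (Fin n → ℕ), (q ^ ∑ i, M.1 i) * (q ^ ∑ i, M.2 i) := by
        refine ENNReal.tsum_le_tsum fun M => ?_
        rw [ENNReal.tsum_set_const]
        have h1 : (((leadPairs C (ex M.1) (ex M.2)).encard : ℕ∞) : ℝ≥0∞) ≤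
            (p : ℝ≥0∞) ^ ∑ i, M.1 i := by
          have := ENat.toENNReal_le.2 (hfin M.1 M.2)
          simpa using this
        calc _ ≤ (p : ℝ≥0∞) ^ (∑ i, M.1 i) * ((q ^ ∑ i, M.1 i) * (q ^ ∑ i, M.2 i) *
              ((p : ℝ≥0∞)⁻¹) ^ ∑ i, M.1 i) := by gcongr
          _ = (q ^ ∑ i, M.1 i) * (q ^ ∑ i, M.2 i) * ((p : ℝ≥0∞) * (p : ℝ≥0∞)⁻¹) ^ ∑ i, M.1 i := by
            rw [mul_pow]; ring
          _ = _ := by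
            rw [ENNReal.mul_inv_cancel (Nat.cast_ne_zero.2 hp.out.ne_zero)
              (ENNReal.natCast_ne_top p), one_pow, mul_one]
    _ = _ := by
        refine (ENNReal.tsum_prod (f := fun (m m' : Fin n → ℕ) =>
          (q ^ ∑ i, m i) * (q ^ ∑ i, m' i))).trans ?_
        simp only [ENNReal.tsum_mul_left, ENNReal.tsum_mul_right]

end LatticeSum

section SmallMatrices
open scoped Matrix
variable {n : ℕ}

/-- Matrices with entries of norm at most `r`. -/
def SmallMat (r : ℝ) (M : Matrix (Fin n) (Fin n) ℚ_[p]) : Prop := ∀ i j, ‖M i j‖ ≤ r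

theorem SmallMat.add {r : ℝ} {M N : Matrix (Fin n) (Fin n) ℚ_[p]} (hM : SmallMat r M)
    (hN : SmallMat r N) : SmallMat r (M + N) := fun i j =>
  (IsUltrametricDist.norm_add_le_max _ _).trans (max_le (hM i j) (hN i j))

theorem SmallMat.neg {r : ℝ} {M : Matrix (Fin n) (Fin n) ℚ_[p]} (hM : SmallMat r M) :
    SmallMat r (-M) := fun i j => by
  rw [Matrix.neg_apply, norm_neg]; exact hM i j

theorem SmallMat.mono {r s : ℝ} (hrs : r ≤ s) {M : Matrix (Fin n) (Fin n) ℚ_[p]}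
    (hM : SmallMat r M) : SmallMat s M := fun i j => (hM i j).trans hrs

theorem SmallMat.mul {r s : ℝ} (hr : 0 ≤ r) (hs : 0 ≤ s) {M N : Matrix (Fin n) (Fin n) ℚ_[p]}
    (hM : SmallMat r M) (hN : SmallMat s N) : SmallMat (r * s) (M * N) := fun i j => by
  rw [Matrix.mul_apply]
  refine IsUltrametricDist.norm_sum_le_of_forall_le_of_nonneg (mul_nonneg hr hs) fun k _ => ?_
  rw [norm_mul]
  exact mul_le_mul (hM i k) (hN k j) (norm_nonneg _) hr

theorem SmallMat.mul_intMat {r : ℝ} (hr : 0 ≤ r) {M N : Matrix (Fin n) (Fin n) ℚ_[p]}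
    (hM : SmallMat r M) (hN : IntMat N) : SmallMat r (M * N) := by
  simpa using hM.mul hr zero_le_one (show SmallMat 1 N from hN)

theorem IntMat.mul_smallMat {r : ℝ} (hr : 0 ≤ r) {M N : Matrix (Fin n) (Fin n) ℚ_[p]}
    (hM : IntMat M) (hN : SmallMat r N) : SmallMat r (M * N) := by
  simpa using SmallMat.mul zero_le_one hr (show SmallMat 1 M from hM) hN

theorem exists_smallMat (M : Matrix (Fin n) (Fin n) ℚ_[p]) :
    ∃ R : ℝ, 0 < R ∧ SmallMat R M := by
  refine ⟨1 + ∑ i, ∑ j, ‖M i j‖, by positivity, fun i j => ?_⟩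
  have h1 := Finset.single_le_sum (f := fun j => ‖M i j‖) (fun j _ => norm_nonneg _)
    (Finset.mem_univ j)
  have h2 := Finset.single_le_sum (f := fun i => ∑ j, ‖M i j‖)
    (fun i _ => Finset.sum_nonneg fun j _ => norm_nonneg _) (Finset.mem_univ i)
  have h3 := h1.trans h2
  linarith

theorem intMat_one : IntMat (1 : Matrix (Fin n) (Fin n) ℚ_[p]) := fun i j => by
  rw [Matrix.one_apply]; split_ifs <;> simp

/-- Matrices congruent to the identity. -/
def NearOne (r : ℝ) (M : Matrix (Fin n) (Fin n) ℚ_[p]) : Prop := SmallMat r (M - 1)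

theorem nearOne_one {r : ℝ} (hr : 0 ≤ r) : NearOne r (1 : Matrix (Fin n) (Fin n) ℚ_[p]) :=
  fun i j => by simpa using hr

theorem NearOne.intMat {r : ℝ} (hr1 : r ≤ 1) {M : Matrix (Fin n) (Fin n) ℚ_[p]}
    (hM : NearOne r M) : IntMat M := by
  have := (hM.mono hr1).add (show SmallMat 1 (1 : Matrix (Fin n) (Fin n) ℚ_[p]) from intMat_one)
  rwa [sub_add_cancel] at this

theorem NearOne.mul {r : ℝ} (hr : 0 ≤ r) (hr1 : r ≤ 1) {M N : Matrix (Fin n) (Fin n) ℚ_[p]}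
    (hM : NearOne r M) (hN : NearOne r N) : NearOne r (M * N) := by
  have : M * N - 1 = (M - 1) * N + (N - 1) := by noncomm_ring
  rw [NearOne, this]
  exact (SmallMat.mul_intMat hr hM (hN.intMat hr1)).add hN

theorem NearOne.exists_inv {r : ℝ} (hr1 : r < 1) {M : Matrix (Fin n) (Fin n) ℚ_[p]}
    (hM : NearOne r M) : ‖M.det‖ = 1 ∧ IntMat M⁻¹ := by
  obtain ⟨N, rfl⟩ := (hM.intMat hr1.le).exists_lift
  have h1 : (PadicInt.toZMod (p := p)).mapMatrix (N - 1) = 0 := by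
    ext i j
    rw [RingHom.mapMatrix_apply, Matrix.map_apply, Matrix.zero_apply, ← RingHom.mem_ker,
      PadicInt.ker_toZMod, IsLocalRing.mem_maximalIdeal, PadicInt.mem_nonunits]
    refine lt_of_le_of_lt ?_ hr1
    have := hM i j
    rw [← Matrix.map_one _ (map_zero PadicInt.Coe.ringHom) (map_one PadicInt.Coe.ringHom),
      ← Matrix.map_sub _ (fun a b => map_sub _ a b)] at this
    exact this
  rw [map_sub, map_one, sub_eq_zero] at h1
  have h2 : PadicInt.toZMod N.det = 1 := by rw [RingHom.map_det, h1, Matrix.det_one]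
  have h3 : ‖N.det‖ = 1 := by
    refine (PadicInt.norm_le_one _).antisymm (not_lt.1 fun h => ?_)
    have : N.det ∈ RingHom.ker (PadicInt.toZMod (p := p)) := by
      rw [PadicInt.ker_toZMod, IsLocalRing.mem_maximalIdeal, PadicInt.mem_nonunits]
      exact h
    rw [RingHom.mem_ker, h2] at this
    exact one_ne_zero this
  refine ⟨by rw [norm_coe_det, h3], ?_⟩
  have h4 : IsUnit N.det := PadicInt.isUnit_iff.2 h3
  have h5 : (N.map PadicInt.Coe.ringHom)⁻¹ = N⁻¹.map PadicInt.Coe.ringHom := by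
    refine Matrix.inv_eq_right_inv ?_
    rw [← Matrix.map_mul, Matrix.mul_nonsing_inv _ h4,
      Matrix.map_one _ (map_zero PadicInt.Coe.ringHom) (map_one PadicInt.Coe.ringHom)]
  rw [h5]
  exact intMat_map _

theorem NearOne.det_ne_zero {r : ℝ} (hr1 : r < 1) {M : Matrix (Fin n) (Fin n) ℚ_[p]}
    (hM : NearOne r M) : M.det ≠ 0 := by
  rw [← norm_ne_zero_iff, (hM.exists_inv hr1).1]; exact one_ne_zero

theorem NearOne.inv {r : ℝ} (hr : 0 ≤ r) (hr1 : r < 1) {M : Matrix (Fin n) (Fin n) ℚ_[p]}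
    (hM : NearOne r M) : NearOne r M⁻¹ := by
  have : M⁻¹ - 1 = -(M⁻¹ * (M - 1)) := by
    rw [mul_sub, Matrix.nonsing_inv_mul _ (hM.det_ne_zero hr1).isUnit, mul_one, neg_sub]
  rw [NearOne, this]
  exact ((hM.exists_inv hr1).2.mul_smallMat hr hM).neg

theorem smallMat_companion_sub {r : ℝ} (hr : 0 ≤ r) {c c' : Fin n → ℚ_[p]} (h : ‖c' - c‖ ≤ r) :
    SmallMat r (companion c' - companion c) := by
  intro i j
  simp only [companion, Matrix.sub_apply, Matrix.of_apply]
  split_ifs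
  · have : -c' j - -c j = -(c' - c) j := by simp; ring
    rw [this, norm_neg]
    exact (norm_le_pi_norm _ j).trans h
  · simpa using hr
  · simpa using hr

theorem intMat_companion {c : Fin n → ℚ_[p]} (h : ‖c‖ ≤ 1) : IntMat (companion c) := by
  intro i j
  simp only [companion, Matrix.of_apply]
  split_ifs
  · rw [norm_neg]
    exact (norm_le_pi_norm c j).trans h
  · simp
  · simp

end SmallMatrices

section Orbits
open scoped Matrix
variable {n : ℕ}

theorem volume_closedBall_center {E : Type*} [NormedAddCommGroup E] [MeasurableSpace E]
    [BorelSpace E] (μ : Measure E) [μ.IsAddHaarMeasure] (x : E) (r : ℝ) :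
    μ (Metric.closedBall x r) = μ (Metric.closedBall 0 r) := by
  rw [← measure_preimage_add_right μ x (Metric.closedBall x r)]
  congr 1
  ext y
  simp [dist_eq_norm]

theorem mem_closedBall_array {r : ℝ} (hr : 0 ≤ r) {M : Matrix (Fin n) (Fin n) ℚ_[p]}
    {X : Fin n → Fin n → ℚ_[p]} :
    X ∈ Metric.closedBall (fun i j => M i j : Fin n → Fin n → ℚ_[p]) r ↔
      SmallMat r (Matrix.of X - M) := by
  rw [Metric.mem_closedBall, dist_eq_norm, pi_norm_le_iff_of_nonneg hr]
  simp only [pi_norm_le_iff_of_nonneg hr]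
  rfl

theorem det_inv_ne_zero {g : Matrix (Fin n) (Fin n) ℚ_[p]} (hg : g.det ≠ 0) : g⁻¹.det ≠ 0 := by
  rw [Matrix.det_nonsing_inv, Ring.inverse_eq_inv']
  exact inv_ne_zero hg

theorem enorm_det_inv {g : Matrix (Fin n) (Fin n) ℚ_[p]} (hg : g.det ≠ 0) :
    ‖g⁻¹.det‖ₑ = ‖g.det‖ₑ⁻¹ := by
  rw [Matrix.det_nonsing_inv, Ring.inverse_eq_inv', enorm_inv hg]

/-- The matrices `k * g` with `k` congruent to the identity. -/
def orbit (r : ℝ) (g : Matrix (Fin n) (Fin n) ℚ_[p]) : Set (Fin n → Fin n → ℚ_[p]) :=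
  mulR g⁻¹ ⁻¹' Metric.closedBall (fun i j => (1 : Matrix (Fin n) (Fin n) ℚ_[p]) i j) r

theorem mem_orbit {r : ℝ} (hr : 0 ≤ r) {g : Matrix (Fin n) (Fin n) ℚ_[p]}
    {X : Fin n → Fin n → ℚ_[p]} : X ∈ orbit r g ↔ NearOne r (Matrix.of X * g⁻¹) := by
  rw [orbit, Set.mem_preimage, mem_closedBall_array hr, of_mulR]; rfl

theorem isOpen_orbit {r : ℝ} (hr : 0 < r) (g : Matrix (Fin n) (Fin n) ℚ_[p]) :
    IsOpen (orbit r g) :=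
  (IsUltrametricDist.isOpen_closedBall _ hr.ne').preimage (continuous_mulR _)

theorem orbit_mono {r s : ℝ} (h : r ≤ s) (g : Matrix (Fin n) (Fin n) ℚ_[p]) :
    orbit r g ⊆ orbit s g := Set.preimage_mono (Metric.closedBall_subset_closedBall h)

theorem mem_orbit_self {r : ℝ} (hr : 0 ≤ r) {X : Fin n → Fin n → ℚ_[p]}
    (h : (Matrix.of X).det ≠ 0) : X ∈ orbit r (Matrix.of X) := by
  rw [mem_orbit hr, Matrix.mul_nonsing_inv _ h.isUnit]
  exact nearOne_one hr

theorem det_ne_zero_of_mem_orbit {r : ℝ} (hr : 0 ≤ r) (hr1 : r < 1)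
    {g : Matrix (Fin n) (Fin n) ℚ_[p]} (hg : g.det ≠ 0) {X : Fin n → Fin n → ℚ_[p]}
    (h : X ∈ orbit r g) : (Matrix.of X).det ≠ 0 ∧ ‖(Matrix.of X).det‖ = ‖g.det‖ := by
  have h1 := (mem_orbit hr).1 h
  have h2 : Matrix.of X = Matrix.of X * g⁻¹ * g := by
    rw [Matrix.nonsing_inv_mul_cancel_right _ _ hg.isUnit]
  have h3 : ‖(Matrix.of X).det‖ = ‖g.det‖ := by
    rw [h2, Matrix.det_mul, norm_mul, (h1.exists_inv hr1).1, one_mul]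
  exact ⟨by rw [← norm_ne_zero_iff, h3, norm_ne_zero_iff]; exact hg, h3⟩

theorem orbit_eq_of_mem {r : ℝ} (hr : 0 ≤ r) (hr1 : r < 1)
    {g : Matrix (Fin n) (Fin n) ℚ_[p]} (hg : g.det ≠ 0) {X : Fin n → Fin n → ℚ_[p]}
    (h : X ∈ orbit r g) : orbit r (Matrix.of X) = orbit r g := by
  have hX := (det_ne_zero_of_mem_orbit hr hr1 hg h).1
  rw [mem_orbit hr] at h
  ext Y
  rw [mem_orbit hr, mem_orbit hr]
  have e1 : Matrix.of Y * g⁻¹ = Matrix.of Y * (Matrix.of X)⁻¹ * (Matrix.of X * g⁻¹) := by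
    rw [← mul_assoc, Matrix.nonsing_inv_mul_cancel_right _ _ hX.isUnit]
  have e2 : Matrix.of Y * (Matrix.of X)⁻¹ = Matrix.of Y * g⁻¹ * (Matrix.of X * g⁻¹)⁻¹ := by
    rw [Matrix.mul_inv_rev, Matrix.nonsing_inv_nonsing_inv _ hg.isUnit, ← mul_assoc,
      Matrix.nonsing_inv_mul_cancel_right _ _ hg.isUnit]
  constructor
  · intro hY
    rw [e1]; exact hY.mul hr hr1.le h
  · intro hY
    rw [e2]; exact hY.mul hr hr1.le (h.inv hr hr1)

theorem volume_orbit (r : ℝ) {g : Matrix (Fin n) (Fin n) ℚ_[p]} (hg : g.det ≠ 0) :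
    volume (orbit r g) =
      ‖g.det‖ₑ ^ n * volume (Metric.closedBall (0 : Fin n → Fin n → ℚ_[p]) r) := by
  have h := volume_preimage_mulR g⁻¹ (det_inv_ne_zero hg)
    (Metric.isClosed_closedBall (x := fun i j => (1 : Matrix (Fin n) (Fin n) ℚ_[p]) i j)
      (ε := r)).measurableSet
  rw [volume_closedBall_center] at h
  rw [← h, ← mul_assoc, enorm_det_inv hg, ← mul_pow,
    ENNReal.mul_inv_cancel (enorm_ne_zero_of_ne_zero hg) enorm_ne_top, one_pow, one_mul, orbit]

/-- The matrices `X` with `g * X * h⁻¹` close to `M`. -/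
def conjBall (r : ℝ) (g h M : Matrix (Fin n) (Fin n) ℚ_[p]) : Set (Fin n → Fin n → ℚ_[p]) :=
  mulL g ⁻¹' (mulR h⁻¹ ⁻¹' Metric.closedBall (fun i j => M i j) r)

theorem mem_conjBall {r : ℝ} (hr : 0 ≤ r) {g h M : Matrix (Fin n) (Fin n) ℚ_[p]}
    {X : Fin n → Fin n → ℚ_[p]} :
    X ∈ conjBall r g h M ↔ SmallMat r (g * Matrix.of X * h⁻¹ - M) := by
  rw [conjBall, Set.mem_preimage, Set.mem_preimage, mem_closedBall_array hr, of_mulR, of_mulL]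

theorem volume_conjBall (r : ℝ) {g h : Matrix (Fin n) (Fin n) ℚ_[p]} (hg : g.det ≠ 0)
    (hh : h.det ≠ 0) (M : Matrix (Fin n) (Fin n) ℚ_[p]) :
    volume (conjBall r g h M) = (‖g.det‖ₑ ^ n)⁻¹ * (‖h.det‖ₑ ^ n *
      volume (Metric.closedBall (0 : Fin n → Fin n → ℚ_[p]) r)) := by
  have hb := (Metric.isClosed_closedBall (x := fun i j => M i j) (ε := r))
  have h1 := volume_preimage_mulR h⁻¹ (det_inv_ne_zero hh) hb.measurableSet
  have h2 := volume_preimage_mulL g hg (hb.preimage (continuous_mulR h⁻¹)).measurableSet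
  rw [volume_closedBall_center] at h1
  have e : ∀ {x : ℚ_[p]}, x ≠ 0 → (‖x‖ₑ ^ n)⁻¹ * ‖x‖ₑ ^ n = 1 := fun hx =>
    ENNReal.inv_mul_cancel (pow_ne_zero _ (enorm_ne_zero_of_ne_zero hx))
      (ENNReal.pow_ne_top enorm_ne_top)
  have e' : ‖h.det‖ₑ ^ n * ‖h⁻¹.det‖ₑ ^ n = 1 := by
    rw [enorm_det_inv hh, ← ENNReal.inv_pow, mul_comm, e hh]
  rw [← h1, ← mul_assoc (‖h.det‖ₑ ^ n), e', one_mul, ← h2, ← mul_assoc, e hg, one_mul, conjBall]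

/-- The vectors `w` with `w * g⁻¹` close to `v`. -/
def rowBall (r : ℝ) (g : Matrix (Fin n) (Fin n) ℚ_[p]) (v : Fin n → ℚ_[p]) :
    Set (Fin n → ℚ_[p]) :=
  (fun x => (g⁻¹)ᵀ *ᵥ x) ⁻¹' Metric.closedBall v r

theorem volume_rowBall (r : ℝ) {g : Matrix (Fin n) (Fin n) ℚ_[p]} (hg : g.det ≠ 0)
    (v : Fin n → ℚ_[p]) :
    volume (rowBall r g v) = ‖g.det‖ₑ * volume (Metric.closedBall (0 : Fin n → ℚ_[p]) r) := by
  have h := volume_preimage_mulVec (g⁻¹)ᵀ (by rw [Matrix.det_transpose]; exact det_inv_ne_zero hg)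
    (Metric.isClosed_closedBall (x := v) (ε := r)).measurableSet
  rw [volume_closedBall_center, Matrix.det_transpose, enorm_det_inv hg] at h
  rw [← h, ← mul_assoc, ENNReal.mul_inv_cancel (enorm_ne_zero_of_ne_zero hg) enorm_ne_top,
    one_mul, rowBall]

end Orbits

section Krylov
open scoped Matrix
variable {n : ℕ}

/-- The matrix with rows `w * M ^ i`. -/
def krylov {R : Type*} [CommRing R] (M : Matrix (Fin n) (Fin n) R) (w : Fin n → R) :
    Matrix (Fin n) (Fin n) R :=
  Matrix.of fun i => w ᵥ* M ^ (i : ℕ)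

theorem krylov_of_companion_mul {R : Type*} [CommRing R] {c : Fin n → R}
    {g M : Matrix (Fin n) (Fin n) R} (h : companion c * g = g * M) (hn : 0 < n) :
    krylov M (g ⟨0, hn⟩) = g := by
  have key : ∀ (i : ℕ) (hi : i < n), g ⟨0, hn⟩ ᵥ* M ^ i = g ⟨i, hi⟩ := by
    intro i
    induction i with
    | zero => intro _; simp
    | succ i ih =>
      intro hi
      have hi' : i < n := by omega
      rw [pow_succ, ← Matrix.vecMul_vecMul, ih hi']
      funext j
      have h1 : (g * M) ⟨i, hi'⟩ j = (companion c *ᵥ fun k => g k j) ⟨i, hi'⟩ := by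
        rw [← h]; rfl
      rw [companion_mulVec, dif_pos hi] at h1
      exact h1
  ext i j
  exact congrFun (key i i.2) j

theorem companion_mul_krylov {R : Type*} [CommRing R] [Nontrivial R]
    (M : Matrix (Fin n) (Fin n) R) (w : Fin n → R) :
    companion (fun i => M.charpoly.coeff (i : ℕ)) * krylov M w = krylov M w * M := by
  ext i j
  have h1 : (krylov M w * M) i j = (w ᵥ* M ^ ((i : ℕ) + 1)) j := by
    rw [pow_succ, ← Matrix.vecMul_vecMul]; rfl
  have h2 : ((companion fun i => M.charpoly.coeff (i : ℕ)) * krylov M w :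
      Matrix (Fin n) (Fin n) R) i j =
      (companion (fun i => M.charpoly.coeff (i : ℕ)) *ᵥ fun k => krylov M w k j) i := rfl
  rw [h1, h2, companion_mulVec]
  split_ifs with hi
  · rfl
  · have hin : (i : ℕ) + 1 = n := by omega
    have h3 := Matrix.aeval_self_charpoly M
    rw [← monicPoly_coeff M.charpoly_monic (by
      rw [Matrix.charpoly_natDegree_eq_dim, Fintype.card_fin])] at h3
    simp only [monicPoly, map_add, map_sum, map_mul, map_pow, aeval_X, aeval_C] at h3
    have h4 : M ^ n = -∑ k : Fin n, M.charpoly.coeff k • M ^ (k : ℕ) := by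
      rw [eq_neg_iff_add_eq_zero, ← h3]
      simp only [Algebra.smul_def]
    rw [hin, h4, Matrix.vecMul_neg, Matrix.vecMul_sum]
    simp only [Pi.neg_apply, Finset.sum_apply, Matrix.vecMul_smul, Pi.smul_apply, smul_eq_mul]
    rfl

theorem IntMat.charpoly_coeff {M : Matrix (Fin n) (Fin n) ℚ_[p]} (hM : IntMat M) (k : ℕ) :
    ‖M.charpoly.coeff k‖ ≤ 1 := by
  obtain ⟨N, rfl⟩ := hM.exists_lift
  rw [Matrix.charpoly_map, coeff_map]
  exact PadicInt.norm_le_one (N.charpoly.coeff k)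

theorem IntMat.krylov {M : Matrix (Fin n) (Fin n) ℚ_[p]} (hM : IntMat M) {w : Fin n → ℚ_[p]}
    (hw : ‖w‖ ≤ 1) : IntMat (krylov M w) := by
  have hpow : ∀ k : ℕ, IntMat (M ^ k) := by
    intro k
    induction k with
    | zero => rw [pow_zero]; exact intMat_one
    | succ k ih => rw [pow_succ]; exact ih.mul hM
  intro i j
  change ‖∑ k, w k * (M ^ (i : ℕ)) k j‖ ≤ 1
  refine IsUltrametricDist.norm_sum_le_of_forall_le_of_nonneg zero_le_one fun k _ => ?_
  rw [norm_mul]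
  exact mul_le_one₀ ((norm_le_pi_norm w k).trans hw) (norm_nonneg _) (hpow _ k j)

/-- The discriminant of the triple `(A, B, w)`. -/
def krylovDisc {R : Type*} [CommRing R] (A B : Matrix (Fin n) (Fin n) R) (w : Fin n → R) : R :=
  (krylov (A * B) w).det ^ 2 * A.det

end Krylov

section PairMap
open scoped Matrix
variable {n : ℕ}

/-- The map sending `(c, g₁, g₂)` to the triple `(g₁⁻¹ g₂, g₂⁻¹ C g₁, e₀ g₁)`. -/
def pairMap (i₀ : Fin n)
    (x : (Fin n → ℚ_[p]) × ((Fin n → Fin n → ℚ_[p]) × (Fin n → Fin n → ℚ_[p]))) :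
    ((Fin n → Fin n → ℚ_[p]) × (Fin n → Fin n → ℚ_[p])) × (Fin n → ℚ_[p]) :=
  ((fun i j => ((Matrix.of x.2.1)⁻¹ * Matrix.of x.2.2) i j,
    fun i j => ((Matrix.of x.2.2)⁻¹ * companion x.1 * Matrix.of x.2.1) i j), x.2.1 i₀)

/-- The parameters `(c, g₁, g₂)` at which `pairMap` takes integral and regular values. -/
def pairDomain : Set ((Fin n → ℚ_[p]) × ((Fin n → Fin n → ℚ_[p]) × (Fin n → Fin n → ℚ_[p]))) :=
  {x | ‖x.1‖ ≤ 1 ∧ x.2 ∈ pairRegion x.1 ∧ blockDisc 1 (companion x.1) ≠ 0}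

/-- A neighbourhood of `(c, g₁, g₂)` on which `pairMap` is under control. -/
def pairCell (r : ℝ)
    (x : (Fin n → ℚ_[p]) × ((Fin n → Fin n → ℚ_[p]) × (Fin n → Fin n → ℚ_[p]))) :
    Set ((Fin n → ℚ_[p]) × ((Fin n → Fin n → ℚ_[p]) × (Fin n → Fin n → ℚ_[p]))) :=
  Metric.closedBall x.1 r ×ˢ (orbit r (Matrix.of x.2.1) ×ˢ orbit r (Matrix.of x.2.2))

/-- A set containing the image of `pairCell r x` under `pairMap`. -/
def pairImage (r : ℝ) (i₀ : Fin n)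
    (x : (Fin n → ℚ_[p]) × ((Fin n → Fin n → ℚ_[p]) × (Fin n → Fin n → ℚ_[p]))) :
    Set (((Fin n → Fin n → ℚ_[p]) × (Fin n → Fin n → ℚ_[p])) × (Fin n → ℚ_[p])) :=
  (conjBall r (Matrix.of x.2.1) (Matrix.of x.2.2) 1 ×ˢ
    conjBall r (Matrix.of x.2.2) (Matrix.of x.2.1) (companion x.1)) ×ˢ
    rowBall r (Matrix.of x.2.1) ((1 : Matrix (Fin n) (Fin n) ℚ_[p]) i₀)

variable {x y : (Fin n → ℚ_[p]) × ((Fin n → Fin n → ℚ_[p]) × (Fin n → Fin n → ℚ_[p]))} {r : ℝ}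

theorem blockDisc_pairMap (i₀ : Fin n) (h₁ : (Matrix.of x.2.1).det ≠ 0)
    (h₂ : (Matrix.of x.2.2).det ≠ 0) :
    blockDisc (Matrix.of (pairMap i₀ x).1.1) (Matrix.of (pairMap i₀ x).1.2) =
      blockDisc 1 (companion x.1) := by
  rw [← blockDisc_conj h₁.isUnit h₂.isUnit 1 (companion x.1), mul_one]
  rfl

theorem krylovDisc_pairMap (hn : 0 < n) (h₁ : (Matrix.of x.2.1).det ≠ 0)
    (h₂ : (Matrix.of x.2.2).det ≠ 0) :
    krylovDisc (Matrix.of (pairMap ⟨0, hn⟩ x).1.1) (Matrix.of (pairMap ⟨0, hn⟩ x).1.2)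
      (pairMap ⟨0, hn⟩ x).2 = (Matrix.of x.2.1).det * (Matrix.of x.2.2).det := by
  set g₁ := Matrix.of x.2.1 with hg₁
  set g₂ := Matrix.of x.2.2 with hg₂
  change krylovDisc (g₁⁻¹ * g₂) (g₂⁻¹ * companion x.1 * g₁) (g₁ ⟨0, hn⟩) = _
  have h : companion x.1 * g₁ = g₁ * (g₁⁻¹ * g₂ * (g₂⁻¹ * companion x.1 * g₁)) := by
    simp only [mul_assoc]
    rw [Matrix.mul_nonsing_inv_cancel_left _ _ h₁.isUnit,
      Matrix.mul_nonsing_inv_cancel_left _ _ h₂.isUnit]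
  rw [krylovDisc, krylov_of_companion_mul h hn, Matrix.det_mul, Matrix.det_nonsing_inv,
    Ring.inverse_eq_inv']
  field_simp

theorem pairMap_mem_pairImage (hr : 0 ≤ r) (hr1 : r < 1) (i₀ : Fin n) (hc : ‖x.1‖ ≤ 1)
    (h₁ : (Matrix.of x.2.1).det ≠ 0) (h₂ : (Matrix.of x.2.2).det ≠ 0) (hy : y ∈ pairCell r x) :
    pairMap i₀ y ∈ pairImage r i₀ x := by
  obtain ⟨hyc, hy₁, hy₂⟩ := hy
  have d₁ := (det_ne_zero_of_mem_orbit hr hr1 h₁ hy₁).1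
  have d₂ := (det_ne_zero_of_mem_orbit hr hr1 h₂ hy₂).1
  rw [mem_orbit hr] at hy₁ hy₂
  rw [Metric.mem_closedBall, dist_eq_norm] at hyc
  have hyc' : ‖y.1‖ ≤ 1 := by
    rw [← sub_add_cancel y.1 x.1]
    exact (IsUltrametricDist.norm_add_le_max _ _).trans (max_le (hyc.trans hr1.le) hc)
  set g₁ := Matrix.of x.2.1 with hg₁
  set g₂ := Matrix.of x.2.2 with hg₂
  set k₁ := Matrix.of y.2.1 with hk₁
  set k₂ := Matrix.of y.2.2 with hk₂
  have inv_eq : ∀ {g k : Matrix (Fin n) (Fin n) ℚ_[p]}, g.det ≠ 0 → g * k⁻¹ = (k * g⁻¹)⁻¹ := by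
    intro g k hg
    rw [Matrix.mul_inv_rev, Matrix.nonsing_inv_nonsing_inv _ hg.isUnit]
  refine ⟨⟨(mem_conjBall hr).2 ?_, (mem_conjBall hr).2 ?_⟩, ?_⟩
  · change NearOne r (g₁ * (k₁⁻¹ * k₂) * g₂⁻¹)
    have : g₁ * (k₁⁻¹ * k₂) * g₂⁻¹ = (k₁ * g₁⁻¹)⁻¹ * (k₂ * g₂⁻¹) := by
      rw [← inv_eq h₁]; simp only [mul_assoc]
    rw [this]
    exact (hy₁.inv hr hr1).mul hr hr1.le hy₂
  · change SmallMat r (g₂ * (k₂⁻¹ * companion y.1 * k₁) * g₁⁻¹ - companion x.1)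
    have : g₂ * (k₂⁻¹ * companion y.1 * k₁) * g₁⁻¹ - companion x.1 =
        ((k₂ * g₂⁻¹)⁻¹ - 1) * (companion y.1 * (k₁ * g₁⁻¹)) + (companion y.1 * (k₁ * g₁⁻¹ - 1) +
          (companion y.1 - companion x.1)) := by
      rw [← inv_eq h₂]; noncomm_ring
    rw [this]
    have hC := intMat_companion hyc'
    exact (SmallMat.mul_intMat hr (hy₂.inv hr hr1) (hC.mul (hy₁.intMat hr1.le))).add
      ((hC.mul_smallMat hr hy₁).add (smallMat_companion_sub hr hyc))
  · change (g₁⁻¹)ᵀ *ᵥ (y.2.1 i₀) ∈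
      Metric.closedBall ((1 : Matrix (Fin n) (Fin n) ℚ_[p]) i₀ : Fin n → ℚ_[p]) r
    rw [Metric.mem_closedBall, dist_eq_norm, Matrix.mulVec_transpose]
    refine (pi_norm_le_iff_of_nonneg hr).2 ?_
    intro j
    have h := hy₁ i₀ j
    rw [Matrix.sub_apply, Matrix.mul_apply_eq_vecMul] at h
    exact h

theorem exists_pairCell_subset (hx : x ∈ pairDomain) :
    ∃ r₀ : ℝ, 0 < r₀ ∧ ∀ r, 0 ≤ r → r < 1 → r ≤ r₀ → ∀ y ∈ pairCell r x,
      y ∈ pairDomain ∧ ‖blockDisc 1 (companion y.1)‖ = ‖blockDisc 1 (companion x.1)‖ := by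
  obtain ⟨hc, ⟨i₁, i₂, h₁, h₂, iA, iB⟩, hD⟩ := hx
  obtain ⟨δ, hδ, hball⟩ := Metric.eventually_nhds_iff.1
    (eventually_norm_eq continuous_eval_companion hD)
  obtain ⟨R₁, hR₁, b₁⟩ := exists_smallMat (Matrix.of x.2.1)⁻¹
  obtain ⟨R₂, hR₂, b₂⟩ := exists_smallMat (Matrix.of x.2.2)⁻¹
  refine ⟨min (δ / 2) (min R₁⁻¹ R₂⁻¹), by positivity, fun r hr hr1 hle y hy => ?_⟩
  obtain ⟨hyc, hy₁, hy₂⟩ := id hy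
  have d₁ := (det_ne_zero_of_mem_orbit hr hr1 h₁ hy₁).1
  have d₂ := (det_ne_zero_of_mem_orbit hr hr1 h₂ hy₂).1
  have hnorm : ‖blockDisc 1 (companion y.1)‖ = ‖blockDisc 1 (companion x.1)‖ :=
    hball (lt_of_le_of_lt (Metric.mem_closedBall.1 hyc)
      (by linarith [hle.trans (min_le_left _ _)]))
  rw [Metric.mem_closedBall, dist_eq_norm] at hyc
  have hyc' : ‖y.1‖ ≤ 1 := by
    rw [← sub_add_cancel y.1 x.1]
    exact (IsUltrametricDist.norm_add_le_max _ _).trans (max_le (hyc.trans hr1.le) hc)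
  have h_int : ∀ {g : Matrix (Fin n) (Fin n) ℚ_[p]} {Y : Fin n → Fin n → ℚ_[p]}, IntMat g →
      g.det ≠ 0 → Y ∈ orbit r g → IntMat (Matrix.of Y) := by
    intro g Y hg hg0 hY
    rw [← Matrix.nonsing_inv_mul_cancel_right _ (Matrix.of Y) hg0.isUnit]
    exact (((mem_orbit hr).1 hY).intMat hr1.le).mul hg
  have hconj : ∀ {g h M : Matrix (Fin n) (Fin n) ℚ_[p]} {Y : Fin n → Fin n → ℚ_[p]} {R : ℝ},
      0 < R → SmallMat R g⁻¹ → r ≤ R⁻¹ → IntMat h → g.det ≠ 0 → h.det ≠ 0 →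
      IntMat (g⁻¹ * M * h) → Y ∈ conjBall r g h M → IntMat (Matrix.of Y) := by
    intro g h M Y R hR hg hrR hh hg0 hh0 hM hY
    rw [mem_conjBall hr] at hY
    have e : Matrix.of Y = g⁻¹ * (g * Matrix.of Y * h⁻¹ - M) * h + g⁻¹ * M * h := by
      rw [mul_sub, sub_mul, sub_add_cancel]
      simp only [← mul_assoc]
      rw [Matrix.nonsing_inv_mul_cancel_right _ _ hh0.isUnit,
        Matrix.nonsing_inv_mul _ hg0.isUnit, one_mul]
    have hRr : R * r ≤ 1 := by
      calc R * r ≤ R * R⁻¹ := by gcongr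
        _ = 1 := mul_inv_cancel₀ hR.ne'
    have s := ((hg.mul hR.le hr hY).mul_intMat (mul_nonneg hR.le hr) hh).mono hRr
    rw [e]
    exact s.add (show SmallMat 1 _ from hM)
  refine ⟨⟨hyc', ⟨h_int i₁ h₁ hy₁, h_int i₂ h₂ hy₂, d₁, d₂, ?_, ?_⟩, ?_⟩, hnorm⟩
  · rcases n.eq_zero_or_pos with rfl | hn
    · intro i; exact i.elim0
    have hm := pairMap_mem_pairImage hr hr1 ⟨0, hn⟩ hc h₁ h₂ hy
    exact hconj (M := 1) hR₁ b₁ (hle.trans ((min_le_right _ _).trans (min_le_left _ _))) i₂ h₁ h₂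
      (by rwa [mul_one]) hm.1.1
  · rcases n.eq_zero_or_pos with rfl | hn
    · intro i; exact i.elim0
    have hm := pairMap_mem_pairImage hr hr1 ⟨0, hn⟩ hc h₁ h₂ hy
    exact hconj hR₂ b₂ (hle.trans ((min_le_right _ _).trans (min_le_right _ _))) i₁ h₂ h₁
      iB hm.1.2
  · rw [← norm_ne_zero_iff, hnorm, norm_ne_zero_iff]; exact hD

end PairMap

section Coordinates
open scoped Matrix
variable {n : ℕ}

theorem map_krylovDisc {R S : Type*} [CommRing R] [CommRing S] (f : R →+* S)
    (A B : Matrix (Fin n) (Fin n) R) (w : Fin n → R) :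
    f (krylovDisc A B w) = krylovDisc (A.map f) (B.map f) fun i => f (w i) := by
  have h : (krylov (A * B) w).map f = krylov (A.map f * B.map f) fun i => f (w i) := by
    ext i j
    rw [← Matrix.map_mul]
    change f (∑ k, w k * ((A * B) ^ (i : ℕ)) k j) =
      ∑ k, f (w k) * (((A * B).map f) ^ (i : ℕ)) k j
    rw [map_sum]
    refine Finset.sum_congr rfl fun k _ => ?_
    rw [map_mul, ← RingHom.mapMatrix_apply, ← map_pow, RingHom.mapMatrix_apply, Matrix.map_apply]
  rw [krylovDisc, krylovDisc, map_mul, map_pow, RingHom.map_det, RingHom.map_det,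
    RingHom.mapMatrix_apply, RingHom.mapMatrix_apply, h]

/-- The coordinates of a pair of matrices and a vector. -/
abbrev TripleIndex (n : ℕ) : Type := (Fin n × Fin n ⊕ Fin n × Fin n) ⊕ Fin n

/-- The vector of coordinates of a triple. -/
def toCoords (z : ((Fin n → Fin n → ℚ_[p]) × (Fin n → Fin n → ℚ_[p])) × (Fin n → ℚ_[p])) :
    TripleIndex n → ℚ_[p] :=
  Sum.elim (Sum.elim (fun q => z.1.1 q.1 q.2) fun q => z.1.2 q.1 q.2) z.2

/-- `blockDisc` as a polynomial in the coordinates. -/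
def blockDiscPoly (p n : ℕ) [Fact p.Prime] : MvPolynomial (TripleIndex n) ℚ_[p] :=
  blockDisc (Matrix.of fun i j => MvPolynomial.X (Sum.inl (Sum.inl (i, j))))
    (Matrix.of fun i j => MvPolynomial.X (Sum.inl (Sum.inr (i, j))))

/-- `krylovDisc` as a polynomial in the coordinates. -/
def krylovDiscPoly (p n : ℕ) [Fact p.Prime] : MvPolynomial (TripleIndex n) ℚ_[p] :=
  krylovDisc (Matrix.of fun i j => MvPolynomial.X (Sum.inl (Sum.inl (i, j))))
    (Matrix.of fun i j => MvPolynomial.X (Sum.inl (Sum.inr (i, j))))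
    fun i => MvPolynomial.X (Sum.inr i)

variable (z : ((Fin n → Fin n → ℚ_[p]) × (Fin n → Fin n → ℚ_[p])) × (Fin n → ℚ_[p]))

theorem eval_blockDiscPoly : MvPolynomial.eval (toCoords z) (blockDiscPoly p n) =
    blockDisc (Matrix.of z.1.1) (Matrix.of z.1.2) := by
  rw [blockDiscPoly, map_blockDisc]
  congr 1 <;> ext i j <;> simp [toCoords]

theorem eval_krylovDiscPoly : MvPolynomial.eval (toCoords z) (krylovDiscPoly p n) =
    krylovDisc (Matrix.of z.1.1) (Matrix.of z.1.2) z.2 := by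
  rw [krylovDiscPoly, map_krylovDisc]
  congr 1
  · ext i j; simp [toCoords]
  · ext i j; simp [toCoords]
  · funext i; simp [toCoords]

theorem blockDiscPoly_ne_zero : blockDiscPoly p n ≠ 0 := by
  obtain ⟨c, hc⟩ := exists_sepDisc_ne_zero (p := p) n
  intro h
  have h1 := eval_blockDiscPoly (((fun i j => (1 : Matrix (Fin n) (Fin n) ℚ_[p]) i j),
    fun i j => companion c i j), (0 : Fin n → ℚ_[p]))
  rw [h, map_zero] at h1
  exact blockDisc_companion_ne_zero hc h1.symm

theorem krylovDiscPoly_ne_zero (hn : 0 < n) : krylovDiscPoly p n ≠ 0 := by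
  intro h
  have h1 := eval_krylovDiscPoly (((fun i j => (1 : Matrix (Fin n) (Fin n) ℚ_[p]) i j),
    fun i j => companion (0 : Fin n → ℚ_[p]) i j),
    ((1 : Matrix (Fin n) (Fin n) ℚ_[p]) ⟨0, hn⟩ : Fin n → ℚ_[p]))
  rw [h, map_zero] at h1
  have h2 : krylov (companion (0 : Fin n → ℚ_[p]))
      ((1 : Matrix (Fin n) (Fin n) ℚ_[p]) ⟨0, hn⟩) = 1 :=
    krylov_of_companion_mul (c := 0) (by rw [one_mul, mul_one]) hn
  change 0 = krylovDisc 1 (companion 0) _ at h1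
  rw [krylovDisc, one_mul, h2, Matrix.det_one] at h1
  simp at h1

/-- `toCoords` as an isomorphism of topological groups. -/
def coordsEquiv (p n : ℕ) [Fact p.Prime] :
    (((Fin n → Fin n → ℚ_[p]) × (Fin n → Fin n → ℚ_[p])) × (Fin n → ℚ_[p])) ≃ₜ+
      (TripleIndex n → ℚ_[p]) where
  toFun := toCoords
  invFun x := ((fun i j => x (Sum.inl (Sum.inl (i, j))), fun i j => x (Sum.inl (Sum.inr (i, j)))),
    fun i => x (Sum.inr i))
  left_inv _ := rfl
  right_inv x := by ext ((_ | _) | _) <;> rfl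
  map_add' x y := by ext ((_ | _) | _) <;> rfl
  continuous_toFun := by
    refine continuous_pi fun k => ?_
    rcases k with (k | k) | k <;> simp only [toCoords, Sum.elim_inl, Sum.elim_inr] <;> fun_prop
  continuous_invFun := by fun_prop

theorem norm_toCoords_le_iff {r : ℝ} (hr : 0 ≤ r) : ‖toCoords z‖ ≤ r ↔ ‖z‖ ≤ r := by
  simp only [Prod.norm_def, max_le_iff, pi_norm_le_iff_of_nonneg hr, Sum.forall, Prod.forall,
    toCoords, Sum.elim_inl, Sum.elim_inr]

theorem volume_unitBall_triple : volume (Metric.closedBall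
    (0 : ((Fin n → Fin n → ℚ_[p]) × (Fin n → Fin n → ℚ_[p])) × (Fin n → ℚ_[p])) 1) = 1 := by
  have h : Metric.closedBall
      (0 : ((Fin n → Fin n → ℚ_[p]) × (Fin n → Fin n → ℚ_[p])) × (Fin n → ℚ_[p])) 1 =
      (Metric.closedBall 0 1 ×ˢ Metric.closedBall 0 1) ×ˢ Metric.closedBall 0 1 := by
    simp only [closedBall_prod_same]; rfl
  rw [h, Measure.volume_eq_prod, Measure.prod_prod, Measure.volume_eq_prod, Measure.prod_prod,
    volume_unitBall_matrix, volume_unitBall_pi]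
  simp

theorem measurePreserving_toCoords : MeasurePreserving
    (toCoords : ((Fin n → Fin n → ℚ_[p]) × (Fin n → Fin n → ℚ_[p])) × (Fin n → ℚ_[p]) → _) := by
  let e := coordsEquiv p n
  have hc : Continuous (toCoords : ((Fin n → Fin n → ℚ_[p]) × (Fin n → Fin n → ℚ_[p])) ×
    (Fin n → ℚ_[p]) → _) := e.continuous_toFun
  have h0 : (volume : Measure ((Fin n → Fin n → ℚ_[p]) ×
      (Fin n → Fin n → ℚ_[p]))).IsAddHaarMeasure :=
    Measure.prod.instIsAddHaarMeasure volume volume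
  have : BorelSpace ((Fin n → Fin n → ℚ_[p]) × (Fin n → Fin n → ℚ_[p])) := inferInstance
  have : MeasurableAdd ((Fin n → Fin n → ℚ_[p]) × (Fin n → Fin n → ℚ_[p])) :=
    ContinuousAdd.measurableAdd
  have h0' : (volume : Measure (((Fin n → Fin n → ℚ_[p]) × (Fin n → Fin n → ℚ_[p])) ×
      (Fin n → ℚ_[p]))).IsAddHaarMeasure :=
    Measure.prod.instIsAddHaarMeasure volume volume
  have h1 : (Measure.map toCoords (volume : Measure (((Fin n → Fin n → ℚ_[p]) ×
      (Fin n → Fin n → ℚ_[p])) × (Fin n → ℚ_[p])))).IsAddHaarMeasure :=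
    e.isAddHaarMeasure_map _
  refine ⟨hc.measurable, ?_⟩
  have h2 := Measure.isAddLeftInvariant_eq_smul (Measure.map toCoords
    (volume : Measure (((Fin n → Fin n → ℚ_[p]) × (Fin n → Fin n → ℚ_[p])) × (Fin n → ℚ_[p]))))
    (volume : Measure (TripleIndex n → ℚ_[p]))
  have h3 := Measure.map_apply (μ := (volume : Measure (((Fin n → Fin n → ℚ_[p]) ×
    (Fin n → Fin n → ℚ_[p])) × (Fin n → ℚ_[p])))) hc.measurable
    (Metric.isClosed_closedBall (x := (0 : TripleIndex n → ℚ_[p])) (ε := 1)).measurableSet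
  have h4 : toCoords ⁻¹' Metric.closedBall (0 : TripleIndex n → ℚ_[p]) 1 =
      Metric.closedBall 0 1 := by
    ext z
    rw [Set.mem_preimage, mem_closedBall_zero_iff, mem_closedBall_zero_iff,
      norm_toCoords_le_iff z zero_le_one]
  rw [h4, volume_unitBall_triple, h2, Measure.smul_apply, volume_unitBall_pi] at h3
  have h5 : (Measure.map toCoords (volume : Measure (((Fin n → Fin n → ℚ_[p]) ×
      (Fin n → Fin n → ℚ_[p])) × (Fin n → ℚ_[p])))).addHaarScalarFactor
      (volume : Measure (TripleIndex n → ℚ_[p])) = 1 := by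
    simpa [ENNReal.smul_def] using h3
  rw [h2, h5, one_smul]

theorem continuous_eval_toCoords (f : MvPolynomial (TripleIndex n) ℚ_[p]) :
    Continuous fun z => MvPolynomial.eval (toCoords z) f :=
  (MvPolynomial.continuous_eval f).comp (coordsEquiv p n).continuous_toFun

theorem ae_eval_toCoords_ne_zero {f : MvPolynomial (TripleIndex n) ℚ_[p]} (hf : f ≠ 0) :
    ∀ᵐ z, MvPolynomial.eval (toCoords z) f ≠ 0 :=
  measurePreserving_toCoords.quasiMeasurePreserving.ae (ae_eval_ne_zero hf)

theorem exists_lintegral_eval_toCoords_rpow_lt_top {f : MvPolynomial (TripleIndex n) ℚ_[p]}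
    (hf : f ≠ 0) : ∃ ε₀ : ℝ, 0 < ε₀ ∧ ∀ ε, 0 < ε → ε ≤ ε₀ →
      ∫⁻ z in Metric.closedBall (0 : ((Fin n → Fin n → ℚ_[p]) × (Fin n → Fin n → ℚ_[p])) ×
        (Fin n → ℚ_[p])) 1, ‖MvPolynomial.eval (toCoords z) f‖ₑ ^ (-ε) < ⊤ := by
  obtain ⟨ε₀, hε₀, h⟩ := exists_lintegral_mvPolynomial_rpow_lt_top f hf
  refine ⟨ε₀, hε₀, fun ε hε hle => ?_⟩
  have h1 := measurePreserving_toCoords.setLIntegral_comp_preimage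
    (Metric.isClosed_closedBall (x := (0 : TripleIndex n → ℚ_[p])) (ε := 1)).measurableSet
    (measurable_enorm_rpow (MvPolynomial.continuous_eval f) (-ε))
  have h4 : toCoords ⁻¹' Metric.closedBall (0 : TripleIndex n → ℚ_[p]) 1 =
      Metric.closedBall 0 1 := by
    ext z
    rw [Set.mem_preimage, mem_closedBall_zero_iff, mem_closedBall_zero_iff,
      norm_toCoords_le_iff z zero_le_one]
  rw [h4] at h1
  rw [h1]
  exact h ε hε hle 1

end Coordinates

section ChangeOfVariables
open scoped Matrix
open Filter Topology
variable {n : ℕ}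

/-- The function whose integral over the image of `pairMap` is estimated. -/
def tripleWeight (s a : ℝ)
    (z : ((Fin n → Fin n → ℚ_[p]) × (Fin n → Fin n → ℚ_[p])) × (Fin n → ℚ_[p])) : ℝ≥0∞ :=
  ‖MvPolynomial.eval (toCoords z) (blockDiscPoly p n)‖ₑ ^ (-s) *
    ‖MvPolynomial.eval (toCoords z) (krylovDiscPoly p n)‖ₑ ^ a

theorem measurable_tripleWeight (s a : ℝ) : Measurable (tripleWeight s a (p := p) (n := n)) :=
  (measurable_enorm_rpow (continuous_eval_toCoords _) _).mul
    (measurable_enorm_rpow (continuous_eval_toCoords _) _)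

theorem tripleWeight_pairMap (hn : 0 < n) {s a : ℝ}
    {x : (Fin n → ℚ_[p]) × ((Fin n → Fin n → ℚ_[p]) × (Fin n → Fin n → ℚ_[p]))}
    (h₁ : (Matrix.of x.2.1).det ≠ 0) (h₂ : (Matrix.of x.2.2).det ≠ 0) :
    tripleWeight s a (pairMap ⟨0, hn⟩ x) = ‖blockDisc 1 (companion x.1)‖ₑ ^ (-s) *
      (‖(Matrix.of x.2.1).det‖ₑ ^ a * ‖(Matrix.of x.2.2).det‖ₑ ^ a) := by
  rw [tripleWeight, eval_blockDiscPoly, eval_krylovDiscPoly, blockDisc_pairMap _ h₁ h₂,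
    krylovDisc_pairMap hn h₁ h₂, enorm_mul, ENNReal.mul_rpow_of_ne_top enorm_ne_top enorm_ne_top]

theorem setLIntegral_le_of_eqOn_const {α : Type*} [MeasurableSpace α] {μ : Measure α}
    {f : α → ℝ≥0∞} (hf : Measurable f) {s : Set α} {k : ℝ≥0∞} (h : ∀ x ∈ s, f x = k) :
    ∫⁻ x in s, f x ∂μ ≤ k * μ s := by
  rw [← setLIntegral_const]
  refine lintegral_mono_ae ?_
  rw [ae_restrict_iff (measurableSet_le hf measurable_const)]
  exact Eventually.of_forall fun x hx => (h x hx).le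

theorem lintegral_pairMap_image_le (hn : 0 < n) (s a : ℝ) :
    ∫⁻ z in pairMap (p := p) ⟨0, hn⟩ '' pairDomain, tripleWeight s a z ≤
      ∫⁻ x in pairDomain (p := p) (n := n),
        ‖blockDisc 1 (companion x.1)‖ₑ ^ (-s) * pairWeight a x.2 := by
  have hp1 : (1 : ℝ) < p := by exact_mod_cast hp.out.one_lt
  let r : ℕ → ℝ := fun m => (p : ℝ)⁻¹ ^ (m + 1)
  have hr0 : ∀ m, 0 < r m := fun m => by positivity
  have hr1 : ∀ m, r m < 1 := fun m =>
    pow_lt_one₀ (by positivity) (inv_lt_one_of_one_lt₀ hp1) (Nat.succ_ne_zero m)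
  have hrlim : Tendsto r atTop (𝓝 0) :=
    (tendsto_pow_atTop_nhds_zero_of_lt_one (by positivity) (inv_lt_one_of_one_lt₀ hp1)).comp
      (tendsto_add_atTop_nat 1)
  refine lintegral_image_le_of_cells volume volume _ pairDomain _ _ (fun m x => pairCell (r m) x)
    (fun m x _ => ?_) (fun m x hx => ?_) (fun m x hx y hy => ?_) (fun m x _ => ?_) fun x hx => ?_
  · exact (IsUltrametricDist.isOpen_closedBall _ (hr0 m).ne').prod
      ((isOpen_orbit (hr0 m) _).prod (isOpen_orbit (hr0 m) _))
  · exact ⟨Metric.mem_closedBall_self (hr0 m).le, mem_orbit_self (hr0 m).le hx.2.1.2.2.1,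
      mem_orbit_self (hr0 m).le hx.2.1.2.2.2.1⟩
  · rw [pairCell, pairCell, orbit_eq_of_mem (hr0 m).le (hr1 m) hx.2.1.2.2.1 hy.2.1,
      orbit_eq_of_mem (hr0 m).le (hr1 m) hx.2.1.2.2.2.1 hy.2.2,
      IsUltrametricDist.closedBall_eq_of_mem hy.1]
  · have hle : r (m + 1) ≤ r m :=
      pow_le_pow_of_le_one (by positivity) (inv_le_one_of_one_le₀ hp1.le) (Nat.le_succ _)
    exact Set.prod_mono (Metric.closedBall_subset_closedBall hle)
      (Set.prod_mono (orbit_mono hle _) (orbit_mono hle _))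
  obtain ⟨r₀, hr₀, hcell⟩ := exists_pairCell_subset hx
  obtain ⟨m, hm⟩ := (hrlim.eventually_lt_const hr₀).exists
  have hN := hcell (r m) (hr0 m).le (hr1 m) hm.le
  have h₁ := hx.2.1.2.2.1
  have h₂ := hx.2.1.2.2.2.1
  have hdet : ∀ y ∈ pairCell (r m) x, ‖(Matrix.of y.2.1).det‖ₑ = ‖(Matrix.of x.2.1).det‖ₑ ∧
      ‖(Matrix.of y.2.2).det‖ₑ = ‖(Matrix.of x.2.2).det‖ₑ := fun y hy =>
    ⟨enorm_eq_of_norm_eq (det_ne_zero_of_mem_orbit (hr0 m).le (hr1 m) h₁ hy.2.1).2,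
      enorm_eq_of_norm_eq (det_ne_zero_of_mem_orbit (hr0 m).le (hr1 m) h₂ hy.2.2).2⟩
  refine ⟨m, fun y hy => (hN y hy).1, fun y hy => ?_, ?_⟩
  · simp only [pairWeight, (hdet y hy).1, (hdet y hy).2, enorm_eq_of_norm_eq (hN y hy).2]
  refine (setLIntegral_le_of_eqOn_const (measurable_tripleWeight s a)
    (k := ‖blockDisc 1 (companion x.1)‖ₑ ^ (-s) *
      (‖(Matrix.of x.2.1).det‖ₑ ^ a * ‖(Matrix.of x.2.2).det‖ₑ ^ a)) ?_).trans ?_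
  · rintro _ ⟨y, hy, rfl⟩
    have hy' := (hN y hy).1.2.1
    rw [tripleWeight_pairMap hn hy'.2.2.1 hy'.2.2.2.1, (hdet y hy).1, (hdet y hy).2,
      enorm_eq_of_norm_eq (hN y hy).2]
  have himage : pairMap ⟨0, hn⟩ '' pairCell (r m) x ⊆ pairImage (r m) ⟨0, hn⟩ x := by
    rintro _ ⟨y, hy, rfl⟩
    exact pairMap_mem_pairImage (hr0 m).le (hr1 m) _ hx.1 h₁ h₂ hy
  change _ * _ ≤ ‖blockDisc 1 (companion x.1)‖ₑ ^ (-s) * pairWeight a x.2 * _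
  have regroup : ∀ b d w v : ℝ≥0∞, b * (d * w) * v = b * d * (w * v) := fun b d w v => by ring
  refine le_of_le_of_eq ?_ (regroup _ _ _ _).symm
  refine mul_le_mul_right ((measure_mono (μ := volume) himage).trans (le_of_eq ?_)) _
  have : SFinite (volume : Measure ((Fin n → Fin n → ℚ_[p]) × (Fin n → Fin n → ℚ_[p]))) :=
    Measure.prod.instSFinite
  rw [pairImage, Measure.volume_eq_prod, Measure.prod_prod, Measure.volume_eq_prod,
    Measure.prod_prod, volume_conjBall _ h₁ h₂, volume_conjBall _ h₂ h₁, volume_rowBall _ h₁,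
    pairCell, Measure.volume_eq_prod, Measure.prod_prod, Measure.volume_eq_prod,
    Measure.prod_prod, volume_orbit _ h₁, volume_orbit _ h₂,
    volume_closedBall_center volume x.1]
  ring

end ChangeOfVariables

section TripleIntegral
open scoped Matrix
open Filter Topology
variable {n : ℕ}

theorem isOpen_pairDomain : IsOpen (pairDomain (p := p) (n := n)) := by
  rw [isOpen_iff_mem_nhds]
  intro x hx
  obtain ⟨r₀, hr₀, hcell⟩ := exists_pairCell_subset hx
  have hr : 0 < min r₀ (1 / 2) := by positivity
  have hr1 : min r₀ (1 / 2) < 1 := (min_le_right _ _).trans_lt (by norm_num)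
  have hopen : IsOpen (pairCell (min r₀ (1 / 2)) x) :=
    (IsUltrametricDist.isOpen_closedBall _ hr.ne').prod
      ((isOpen_orbit hr _).prod (isOpen_orbit hr _))
  exact mem_of_superset (hopen.mem_nhds ⟨Metric.mem_closedBall_self hr.le,
    mem_orbit_self hr.le hx.2.1.2.2.1, mem_orbit_self hr.le hx.2.1.2.2.2.1⟩)
    fun y hy => (hcell _ hr.le hr1 (min_le_left _ _) y hy).1

theorem mem_image_pairMap (hn : 0 < n)
    {z : ((Fin n → Fin n → ℚ_[p]) × (Fin n → Fin n → ℚ_[p])) × (Fin n → ℚ_[p])}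
    (hz : ‖z‖ ≤ 1) (hk : krylovDisc (Matrix.of z.1.1) (Matrix.of z.1.2) z.2 ≠ 0)
    (hb : blockDisc (Matrix.of z.1.1) (Matrix.of z.1.2) ≠ 0) :
    z ∈ pairMap ⟨0, hn⟩ '' pairDomain := by
  obtain ⟨⟨A, B⟩, w⟩ := z
  simp only [Prod.norm_def, max_le_iff] at hz
  obtain ⟨⟨hA, hB⟩, hw⟩ := hz
  have h_int : ∀ {Y : Fin n → Fin n → ℚ_[p]}, ‖Y‖ ≤ 1 → IntMat (Matrix.of Y) := fun h i j =>
    ((norm_le_pi_norm _ j).trans (norm_le_pi_norm _ i)).trans h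
  have iA := h_int hA
  have iB := h_int hB
  simp only at hk hb
  set M := Matrix.of A * Matrix.of B with hM
  have iM : IntMat M := iA.mul iB
  rw [krylovDisc, mul_ne_zero_iff] at hk
  have hg₁ : (krylov M w).det ≠ 0 := fun h => hk.1 (by rw [h]; exact zero_pow two_ne_zero)
  have hA0 : (Matrix.of A).det ≠ 0 := hk.2
  have hg₂ : (krylov M w * Matrix.of A).det ≠ 0 := by
    rw [Matrix.det_mul]; exact mul_ne_zero hg₁ hA0
  set c : Fin n → ℚ_[p] := fun i => M.charpoly.coeff (i : ℕ) with hc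
  have hcomp : companion c * krylov M w = krylov M w * M := companion_mul_krylov M w
  let x : (Fin n → ℚ_[p]) × ((Fin n → Fin n → ℚ_[p]) × (Fin n → Fin n → ℚ_[p])) :=
    (c, (fun i j => krylov M w i j, fun i j => (krylov M w * Matrix.of A) i j))
  have e₁ : (krylov M w)⁻¹ * (krylov M w * Matrix.of A) = Matrix.of A := by
    rw [Matrix.nonsing_inv_mul_cancel_left _ _ hg₁.isUnit]
  have e₂ : (krylov M w * Matrix.of A)⁻¹ * companion c * krylov M w = Matrix.of B := by
    rw [mul_assoc, hcomp, hM, ← mul_assoc (krylov _ w),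
      Matrix.nonsing_inv_mul_cancel_left _ _ hg₂.isUnit]
  have e₃ : krylov M w ⟨0, hn⟩ = w := by
    change w ᵥ* M ^ 0 = w
    rw [pow_zero, Matrix.vecMul_one]
  have hx : pairMap ⟨0, hn⟩ x = ((A, B), w) := by
    refine Prod.ext (Prod.ext ?_ ?_) ?_
    · change (fun i j => ((krylov M w)⁻¹ * (krylov M w * Matrix.of A)) i j) = A
      rw [e₁]; rfl
    · change (fun i j => ((krylov M w * Matrix.of A)⁻¹ * companion c * krylov M w) i j) = B
      rw [e₂]; rfl
    · exact e₃
  have ik : IntMat (krylov M w) := iM.krylov hw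
  refine ⟨x, ⟨(pi_norm_le_iff_of_nonneg zero_le_one).2 fun i => iM.charpoly_coeff i,
    ⟨ik, ik.mul iA, hg₁, hg₂, ?_, ?_⟩, ?_⟩, hx⟩
  · change IntMat ((krylov M w)⁻¹ * (krylov M w * Matrix.of A))
    rw [e₁]; exact iA
  · change IntMat ((krylov M w * Matrix.of A)⁻¹ * companion c * krylov M w)
    rw [e₂]; exact iB
  · rw [← blockDisc_pairMap ⟨0, hn⟩ (x := x) hg₁ hg₂, hx]
    exact hb

theorem lintegral_pairDomain_le {f : (Fin n → ℚ_[p]) → ℝ≥0∞}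
    (hf : ∀ c, blockDisc 1 (companion c) ≠ 0 → f c ≠ ⊤)
    {g : (Fin n → Fin n → ℚ_[p]) × (Fin n → Fin n → ℚ_[p]) → ℝ≥0∞} {K : ℝ≥0∞} (hK : K ≠ ⊤)
    (hg : ∀ c : Fin n → ℚ_[p], ‖c‖ ≤ 1 → ∫⁻ G in pairRegion c, g G ≤ K) :
    ∫⁻ x in pairDomain (p := p) (n := n), f x.1 * g x.2 ≤
      (∫⁻ c in Metric.closedBall 0 1, f c) * K := by
  have : SFinite (volume : Measure ((Fin n → Fin n → ℚ_[p]) × (Fin n → Fin n → ℚ_[p]))) :=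
    Measure.prod.instSFinite
  rw [← lintegral_indicator isOpen_pairDomain.measurableSet, Measure.volume_eq_prod]
  refine (lintegral_prod_le _).trans ?_
  rw [← lintegral_mul_const' _ _ hK,
    ← lintegral_indicator Metric.isClosed_closedBall.measurableSet]
  refine lintegral_mono fun c => ?_
  by_cases hc : ‖c‖ ≤ 1 ∧ blockDisc 1 (companion c) ≠ 0
  · rw [Set.indicator_of_mem (mem_closedBall_zero_iff.2 hc.1)]
    calc ∫⁻ G, pairDomain.indicator (fun x => f x.1 * g x.2) (c, G)
        = ∫⁻ G, (pairRegion c).indicator (fun G => f c * g G) G := by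
          refine lintegral_congr fun G => ?_
          by_cases hG : G ∈ pairRegion c
          · rw [Set.indicator_of_mem hG, Set.indicator_of_mem]
            exact ⟨hc.1, hG, hc.2⟩
          · rw [Set.indicator_of_notMem hG, Set.indicator_of_notMem]
            exact fun h => hG h.2.1
      _ ≤ ∫⁻ G in pairRegion c, f c * g G := lintegral_indicator_le _ _
      _ = f c * ∫⁻ G in pairRegion c, g G := lintegral_const_mul' _ _ (hf c hc.2)
      _ ≤ f c * K := mul_le_mul_right (hg c hc.1) _
  · have : ∀ G, pairDomain.indicator (fun x => f x.1 * g x.2) (c, G) = 0 := fun G =>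
      Set.indicator_of_notMem (fun h => hc ⟨h.1, h.2.2⟩) _
    simp only [this, lintegral_zero, zero_le]

theorem exists_lintegral_tripleWeight_lt_top (hn : 0 < n) :
    ∃ ε : ℝ, 0 < ε ∧ ∀ a : ℝ, 0 < a →
      ∫⁻ z in Metric.closedBall (0 : ((Fin n → Fin n → ℚ_[p]) × (Fin n → Fin n → ℚ_[p])) ×
        (Fin n → ℚ_[p])) 1, tripleWeight (1 / 4 + ε) a z < ⊤ := by
  obtain ⟨ε, hε, hP⟩ := exists_lintegral_companion_lt_top (p := p) hn
  refine ⟨ε, hε, fun a ha => ?_⟩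
  obtain ⟨K, hK, hG⟩ := exists_lintegral_pairRegion_le (p := p) hn ha
  have hsub : Metric.closedBall (0 : ((Fin n → Fin n → ℚ_[p]) × (Fin n → Fin n → ℚ_[p])) ×
      (Fin n → ℚ_[p])) 1 ≤ᵐ[volume] pairMap (p := p) ⟨0, hn⟩ '' pairDomain := by
    filter_upwards [ae_eval_toCoords_ne_zero (blockDiscPoly_ne_zero (p := p) (n := n)),
      ae_eval_toCoords_ne_zero (krylovDiscPoly_ne_zero (p := p) hn)] with z h₁ h₂ hz
    rw [eval_blockDiscPoly] at h₁
    rw [eval_krylovDiscPoly] at h₂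
    exact mem_image_pairMap hn (mem_closedBall_zero_iff.1 hz) h₂ h₁
  refine (lintegral_mono_set' hsub).trans_lt ((lintegral_pairMap_image_le hn _ _).trans_lt
    ((lintegral_pairDomain_le (fun c hc => ?_) hK.ne hG).trans_lt (ENNReal.mul_lt_top hP hK)))
  exact ENNReal.rpow_ne_top_of_ne_zero (enorm_ne_zero_of_ne_zero hc) enorm_ne_top

end TripleIntegral

section PairIntegral
open scoped Matrix
variable {n : ℕ}

theorem rpow_neg_le_mul_add {x y : ℝ≥0∞} (hx : x ≠ 0) (hx' : x ≠ ⊤) (hy : y ≠ 0) (hy' : y ≠ ⊤)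
    {s t b : ℝ} (hs : 0 < s) (hst : s < t) :
    x ^ (-s) ≤ x ^ (-t) * y ^ (b * ((t - s) / s)) + y ^ (-b) := by
  rcases le_total (x ^ (-s)) (y ^ (-b)) with h | h
  · exact h.trans le_add_self
  · refine le_trans ?_ le_self_add
    have hq : 0 ≤ (t - s) / s := div_nonneg (by linarith) hs.le
    have h1 := ENNReal.rpow_le_rpow h hq
    rw [← ENNReal.rpow_mul, ← ENNReal.rpow_mul] at h1
    have e1 : -s * ((t - s) / s) = -t - -s := by field_simp; ring
    calc x ^ (-s) = x ^ (-s) * (y ^ (-b * ((t - s) / s)) * y ^ (b * ((t - s) / s))) := by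
          rw [← ENNReal.rpow_add _ _ hy hy']; simp
      _ ≤ x ^ (-s) * (x ^ (-s * ((t - s) / s)) * y ^ (b * ((t - s) / s))) := by gcongr
      _ = x ^ (-t) * y ^ (b * ((t - s) / s)) := by
          rw [← mul_assoc, ← ENNReal.rpow_add _ _ hx hx', e1]; congr 2; ring

theorem exists_lintegral_blockDisc_lt_top (hn : 0 < n) :
    ∃ ε : ℝ, 0 < ε ∧ ∫⁻ X in Metric.closedBall
      (0 : (Fin n → Fin n → ℚ_[p]) × (Fin n → Fin n → ℚ_[p])) 1,
        ‖blockDisc (Matrix.of X.1) (Matrix.of X.2)‖ₑ ^ (-(1 / 4 + ε)) < ⊤ := by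
  obtain ⟨ε, hε, h⟩ := exists_lintegral_tripleWeight_lt_top (p := p) hn
  obtain ⟨b, hb, hsoft⟩ := exists_lintegral_eval_toCoords_rpow_lt_top
    (krylovDiscPoly_ne_zero (p := p) hn)
  have hs : (0 : ℝ) < 1 / 4 + ε / 2 := by positivity
  have hst : 1 / 4 + ε / 2 < 1 / 4 + ε := by linarith
  set a := b * ((1 / 4 + ε - (1 / 4 + ε / 2)) / (1 / 4 + ε / 2)) with ha_def
  have ha : 0 < a := mul_pos hb (div_pos (by linarith) hs)
  refine ⟨ε / 2, by positivity, ?_⟩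
  have hm := measurable_enorm_rpow (continuous_eval_toCoords (krylovDiscPoly p n)) (-b)
  have key : ∫⁻ z in Metric.closedBall
      (0 : ((Fin n → Fin n → ℚ_[p]) × (Fin n → Fin n → ℚ_[p])) × (Fin n → ℚ_[p])) 1,
        ‖blockDisc (Matrix.of z.1.1) (Matrix.of z.1.2)‖ₑ ^ (-(1 / 4 + ε / 2)) < ⊤ := by
    refine lt_of_le_of_lt (lintegral_mono_ae (g := fun z => tripleWeight (1 / 4 + ε) a z +
      ‖MvPolynomial.eval (toCoords z) (krylovDiscPoly p n)‖ₑ ^ (-b)) ?_) ?_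
    · refine ae_restrict_of_ae ?_
      filter_upwards [ae_eval_toCoords_ne_zero (blockDiscPoly_ne_zero (p := p) (n := n)),
        ae_eval_toCoords_ne_zero (krylovDiscPoly_ne_zero (p := p) hn)] with z h₁ h₂
      rw [← eval_blockDiscPoly, tripleWeight]
      exact rpow_neg_le_mul_add (enorm_ne_zero_of_ne_zero h₁) enorm_ne_top
        (enorm_ne_zero_of_ne_zero h₂) enorm_ne_top hs hst
    · rw [lintegral_add_right _ hm]
      exact ENNReal.add_lt_top.2 ⟨h a ha, hsoft b hb le_rfl⟩
  have hmeas : Measurable fun z : ((Fin n → Fin n → ℚ_[p]) × (Fin n → Fin n → ℚ_[p])) ×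
      (Fin n → ℚ_[p]) =>
        ‖blockDisc (Matrix.of z.1.1) (Matrix.of z.1.2)‖ₑ ^ (-(1 / 4 + ε / 2)) := by
    simp only [← eval_blockDiscPoly]
    exact measurable_enorm_rpow (continuous_eval_toCoords _) _
  have hball : Metric.closedBall
      (0 : ((Fin n → Fin n → ℚ_[p]) × (Fin n → Fin n → ℚ_[p])) × (Fin n → ℚ_[p])) 1 =
      Metric.closedBall 0 1 ×ˢ Metric.closedBall 0 1 := (closedBall_prod_same _ _ _).symm
  have : SFinite (volume : Measure ((Fin n → Fin n → ℚ_[p]) × (Fin n → Fin n → ℚ_[p]))) :=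
    Measure.prod.instSFinite
  rw [hball, Measure.volume_eq_prod, ← Measure.prod_restrict, lintegral_prod _ hmeas.aemeasurable]
    at key
  simpa only [setLIntegral_const, volume_unitBall_pi, mul_one] using key

end PairIntegral

section LocalIntegrability

theorem locallyIntegrable_of_integrableOn_closedBall {𝕜 E : Type*} [NontriviallyNormedField 𝕜]
    [NormedAddCommGroup E] [NormedSpace 𝕜 E] [MeasurableSpace E] [BorelSpace E] {f : E → ℝ}
    (hf : ∀ t : 𝕜, t ≠ 0 → ∃ c : ℝ, c ≠ 0 ∧ ∀ x, f (t • x) = c * f x)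
    (h : ∀ ν : Measure E, ν.IsAddHaarMeasure → IntegrableOn f (Metric.closedBall 0 1) ν)
    (μ : Measure E) (hμ : μ.IsAddHaarMeasure) : LocallyIntegrable f μ := by
  intro x
  obtain ⟨t, ht⟩ := NormedField.exists_lt_norm 𝕜 ‖x‖
  have htpos : 0 < ‖t‖ := (norm_nonneg x).trans_lt ht
  have ht0 : t ≠ 0 := norm_pos_iff.1 htpos
  let e : E ≃L[𝕜] E := ContinuousLinearEquiv.smulLeft (Units.mk0 t ht0)⁻¹
  have he : ∀ y, e y = t⁻¹ • y := fun y => rfl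
  obtain ⟨c, hc, hcf⟩ := hf t⁻¹ (inv_ne_zero ht0)
  have h₁ := h (μ.map e) (ContinuousLinearEquiv.isAddHaarMeasure_map e μ)
  have h₂ : IntegrableOn (f ∘ e) (e ⁻¹' Metric.closedBall 0 1) μ :=
    (integrableOn_map_equiv e.toHomeomorph.toMeasurableEquiv).1 h₁
  have h₃ : f ∘ e = fun y => c * f y := funext fun y => by rw [Function.comp, he, hcf]
  rw [h₃] at h₂
  refine ⟨Metric.ball 0 ‖t‖, Metric.isOpen_ball.mem_nhds (by simpa using ht), ?_⟩
  have h₄ : IntegrableOn f (e ⁻¹' Metric.closedBall 0 1) μ :=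
    (integrable_const_mul_iff (IsUnit.mk0 c hc) f).1 h₂
  refine h₄.mono_set fun y hy => ?_
  rw [Set.mem_preimage, he, mem_closedBall_zero_iff, norm_smul, norm_inv]
  rw [mem_ball_zero_iff] at hy
  exact (inv_mul_le_one₀ htpos).2 hy.le

variable {n : ℕ}

theorem norm_blockDisc_smul {t : ℚ_[p]} (ht : t ≠ 0) (A B : Matrix (Fin n) (Fin n) ℚ_[p]) :
    ‖blockDisc (t • A) (t • B)‖ =
      (‖t‖ ^ (2 * n))⁻¹ * ‖t‖ ^ ((2 * n) * (2 * n)) * ‖blockDisc A B‖ := by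
  have h := congrArg norm (blockDisc_smul t A B)
  rw [norm_mul, norm_mul, norm_pow, norm_pow] at h
  have : ‖t‖ ^ (2 * n) ≠ 0 := pow_ne_zero _ (norm_ne_zero_iff.2 ht)
  rw [mul_assoc, ← h, inv_mul_cancel_left₀ this]

theorem continuous_blockDisc : Continuous
    fun X : (Fin n → Fin n → ℚ_[p]) × (Fin n → Fin n → ℚ_[p]) =>
      blockDisc (Matrix.of X.1) (Matrix.of X.2) := by
  have h := (continuous_eval_toCoords (blockDiscPoly p n)).comp
    (Continuous.prodMk_left (0 : Fin n → ℚ_[p]))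
  simpa only [Function.comp_def, eval_blockDiscPoly] using h

theorem enorm_norm_rpow_neg_le (x : ℚ_[p]) {s : ℝ} (hs : 0 < s) :
    ‖‖x‖ ^ (-s)‖ₑ ≤ ‖x‖ₑ ^ (-s) := by
  rcases eq_or_ne x 0 with rfl | hx
  · simp [Real.zero_rpow (neg_ne_zero.2 hs.ne')]
  · rw [enorm_rpow_neg_eq hx, Real.enorm_eq_ofReal (Real.rpow_nonneg (norm_nonneg _) _)]

theorem exists_locallyIntegrable_norm_blockDisc_rpow (hn : 0 < n) :
    ∃ ε : ℝ, 0 < ε ∧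
      ∀ μ : Measure ((Fin n → Fin n → ℚ_[p]) × (Fin n → Fin n → ℚ_[p])), μ.IsAddHaarMeasure →
        LocallyIntegrable
          (fun X => ‖blockDisc (Matrix.of X.1) (Matrix.of X.2)‖ ^ (-(1 / 4 : ℝ) - ε)) μ := by
  obtain ⟨ε, hε, h⟩ := exists_lintegral_blockDisc_lt_top (p := p) hn
  have : BorelSpace ((Fin n → Fin n → ℚ_[p]) × (Fin n → Fin n → ℚ_[p])) := inferInstance
  refine ⟨ε, hε, locallyIntegrable_of_integrableOn_closedBall (𝕜 := ℚ_[p]) ?_ ?_⟩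
  · intro t ht
    have htpos := norm_pos_iff.2 ht
    refine ⟨((‖t‖ ^ (2 * n))⁻¹ * ‖t‖ ^ ((2 * n) * (2 * n))) ^ (-(1 / 4 : ℝ) - ε),
      (Real.rpow_pos_of_pos (by positivity) _).ne', fun X => ?_⟩
    rw [← Real.mul_rpow (by positivity) (norm_nonneg _), ← norm_blockDisc_smul ht]
    rfl
  · intro ν hν
    have hvol : (volume : Measure ((Fin n → Fin n → ℚ_[p]) ×
        (Fin n → Fin n → ℚ_[p]))).IsAddHaarMeasure := by
      have : MeasurableAdd ((Fin n → Fin n → ℚ_[p]) × (Fin n → Fin n → ℚ_[p])) :=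
        ContinuousAdd.measurableAdd
      exact Measure.prod.instIsAddHaarMeasure volume volume
    rw [Measure.isAddLeftInvariant_eq_smul ν volume]
    have h_int : IntegrableOn (fun X : (Fin n → Fin n → ℚ_[p]) × (Fin n → Fin n → ℚ_[p]) =>
        ‖blockDisc (Matrix.of X.1) (Matrix.of X.2)‖ ^ (-(1 / 4 : ℝ) - ε))
        (Metric.closedBall 0 1) volume := by
      refine ⟨(continuous_blockDisc.norm.measurable.pow_const _).aestronglyMeasurable, ?_⟩
      refine lt_of_le_of_lt (lintegral_mono fun X => ?_) h
      rw [← neg_add']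
      exact enorm_norm_rpow_neg_le _ (by positivity)
    rw [IntegrableOn, Measure.restrict_smul]
    exact h_int.smul_measure_nnreal

/-- Pairs of matrices as pairs of functions. -/
def matrixPairEquiv (p n : ℕ) [Fact p.Prime] :
    (Matrix (Fin n) (Fin n) ℚ_[p] × Matrix (Fin n) (Fin n) ℚ_[p]) ≃ₜ+
      (Fin n → Fin n → ℚ_[p]) × (Fin n → Fin n → ℚ_[p]) where
  toFun X := (Matrix.of.symm X.1, Matrix.of.symm X.2)
  invFun X := (Matrix.of X.1, Matrix.of X.2)
  left_inv _ := rfl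
  right_inv _ := rfl
  map_add' _ _ := rfl
  continuous_toFun := continuous_id
  continuous_invFun := continuous_id

theorem exists_locallyIntegrable_norm_blockDisc_matrix_rpow (hn : 0 < n)
    [MeasurableSpace (Matrix (Fin n) (Fin n) ℚ_[p] × Matrix (Fin n) (Fin n) ℚ_[p])]
    [BorelSpace (Matrix (Fin n) (Fin n) ℚ_[p] × Matrix (Fin n) (Fin n) ℚ_[p])] :
    ∃ ε : ℝ, 0 < ε ∧
      ∀ μ : Measure (Matrix (Fin n) (Fin n) ℚ_[p] × Matrix (Fin n) (Fin n) ℚ_[p]),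
        μ.IsAddHaarMeasure →
        LocallyIntegrable (fun X => ‖blockDisc X.1 X.2‖ ^ (-(1 / 4 : ℝ) - ε)) μ := by
  obtain ⟨ε, hε, h⟩ := exists_locallyIntegrable_norm_blockDisc_rpow (p := p) hn
  refine ⟨ε, hε, fun μ hμ => ?_⟩
  have : BorelSpace ((Fin n → Fin n → ℚ_[p]) × (Fin n → Fin n → ℚ_[p])) := inferInstance
  exact (locallyIntegrable_map_homeomorph (matrixPairEquiv p n).toHomeomorph).1
    (h _ ((matrixPairEquiv p n).isAddHaarMeasure_map μ))

end LocalIntegrability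

end
end PadicWeyl

/-- There exists `ε > 0` such that `‖𝔇(X)‖_p^(−1/4−ε)` is locally integrable on
`M_n(ℚ_p) × M_n(ℚ_p)` with respect to any additive Haar measure. -/
theorem weylDiscriminant_rpow_locallyIntegrable (p : ℕ) [Fact p.Prime] (n : ℕ) (hn : 1 ≤ n)
    [MeasurableSpace (Matrix (Fin n) (Fin n) ℚ_[p] × Matrix (Fin n) (Fin n) ℚ_[p])]
    [BorelSpace (Matrix (Fin n) (Fin n) ℚ_[p] × Matrix (Fin n) (Fin n) ℚ_[p])] :
    ∃ ε : ℝ, 0 < ε ∧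
      ∀ μ : Measure (Matrix (Fin n) (Fin n) ℚ_[p] × Matrix (Fin n) (Fin n) ℚ_[p]),
        μ.IsAddHaarMeasure →
        LocallyIntegrable
          (fun X => ‖weylDiscriminantGuoJacquet p n X‖ ^ (-(1 / 4 : ℝ) - ε)) μ := by
  simpa only [weylDiscriminantGuoJacquet, PadicWeyl.charpoly_mulLeft_sub_mulRight,
    PadicWeyl.blockDisc] using
    PadicWeyl.exists_locallyIntegrable_norm_blockDisc_matrix_rpow (p := p) (n := n) hn
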